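/- Let λ ≥ C₀ for a sufficiently large constant C₀, and let Θ = Θ_q(s,p,r,λ) satisfy the conditions of the aggregation theorem (λ ≥ C₀√(log n / n), n·h(λ) ≥ C₀·k*_q·(r + log(ep/k*_q)), n ≥ C₀·(k*_q·log(ep/k*_q) ∨ log λ)). Consider the reduction scheme: generate an independent n×p matrix Z̃ with i.i.d. N(0,1) entries, set X^i = X + (−1)^i·Z̃ for i = 0,1. Suppose there exists an initial estimator V⁰ ∈ O(p,r), measurable with respect to X⁰, satisfying |supp(V⁰)| ≤ k*_q and σ_r(V'V⁰) ≥ 1/2 with probability at least 1 − C'/(n·h(λ)). Let B = X⁰V⁰ with SVD B = LCR', set Y = (1/√2)(X¹)'X⁰V⁰RC⁻¹, let Θ̂ be the penalized least-squares estimator applied to Y with parameters β > 2 and δ ∈ (0,1), and let V̂ ∈ O(p,r) be obtained by orthonormalizing the columns of Θ̂. Then sup_{Σ ∈ Θ} E‖V̂V̂' − VV'‖_F² ≤ 2(r ∧ (p−r)) ∧ C·Ψ(k*_q,p,r,n,λ), where C > 0 depends only on q, β, δ (and κ). -/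

import Mathlib

open MeasureTheory ProbabilityTheory Matrix Real
open scoped BigOperators ENNReal NNReal

noncomputable section

namespace SparsePCA

/-- The measure on `ι → ℝ` with i.i.d. standard normal coordinates. -/
def stdGaussian (ι : Type*) [Fintype ι] : Measure (ι → ℝ) :=
  Measure.pi fun _ => gaussianReal 0 1

/-- The measure on `Fin n → Fin m → ℝ` whose entries are i.i.d. standard normal. -/
def gaussianMatrix (n m : ℕ) : Measure (Fin n → Fin m → ℝ) :=
  Measure.pi fun _ => stdGaussian (Fin m)

/-- `V` has orthonormal columns, i.e. `V ∈ O(p,r)`. -/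
def IsOrthonormalCols {p r : ℕ} (V : Matrix (Fin p) (Fin r) ℝ) : Prop :=
  Vᵀ * V = 1

/-- Squared Frobenius norm. -/
def frobSq {m k : Type*} [Fintype m] [Fintype k] (A : Matrix m k ℝ) : ℝ :=
  ∑ i, ∑ j, (A i j) ^ 2

/-- Subspace estimation loss `‖V Vᵀ - W Wᵀ‖_F²`. -/
def loss {p r : ℕ} (V W : Matrix (Fin p) (Fin r) ℝ) : ℝ :=
  frobSq (V * Vᵀ - W * Wᵀ)

/-- Euclidean norm of row `j` of `V`. -/
def rowNorm {p r : ℕ} (V : Matrix (Fin p) (Fin r) ℝ) (j : Fin p) : ℝ :=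
  Real.sqrt (∑ i, (V j i) ^ 2)

/-- The `j`-th largest row norm of `V` (zero-based: `j = 0` is the largest). -/
def sortedRowNorm {p r : ℕ} (V : Matrix (Fin p) (Fin r) ℝ) (j : Fin p) : ℝ :=
  rowNorm V ((Tuple.sort (fun i => - rowNorm V i)) j)

/-- Weak `ℓ_q` radius `‖V‖_{q,w} = max_j j ‖V_{(j)*}‖^q`, with the convention
`0 ^ q = 0` (so that for `q = 0` this is the number of nonzero rows). -/
def weakLq {p r : ℕ} (q : ℝ) (V : Matrix (Fin p) (Fin r) ℝ) : ℝ :=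
  ⨆ j : Fin p, ((j : ℕ) + 1 : ℝ) *
    (if sortedRowNorm V j = 0 then 0 else (sortedRowNorm V j) ^ q)

/-- `h(λ) = λ² / (λ + 1)`. -/
def hfun (lam : ℝ) : ℝ := lam ^ 2 / (lam + 1)

/-- The rate function `Ψ(k,p,r,n,λ)`. -/
def Psi (k p r n : ℕ) (lam : ℝ) : ℝ :=
  ((r : ℝ) * k + k * Real.log (Real.exp 1 * p / k)) / (n * hfun lam)

/-- The rate function `Ψ₀(k,p,r,n,λ)`. -/
def Psi0 (k p r n : ℕ) (lam : ℝ) : ℝ :=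
  ((r : ℝ) * ((k : ℝ) - r) + k * Real.log (Real.exp 1 * p / k)) / (n * hfun lam)

/-- `x_q(s,p,r,n,λ)`. -/
def xq (q s : ℝ) (p r n : ℕ) (lam : ℝ) : ℝ :=
  sSup {x : ℝ | 0 ≤ x ∧ x ≤ p ∧
    x ≤ s * (n * hfun lam / ((r : ℝ) + Real.log (Real.exp 1 * p / x))) ^ (q / 2)}

/-- Effective dimension `k*_q = ⌈x_q⌉`. -/
def kq (q s : ℝ) (p r n : ℕ) (lam : ℝ) : ℕ := ⌈xq q s p r n lam⌉₊

/-- Membership of `Σ = V Λ Vᵀ + I` in `Θ_q(s,p,r,λ)` with constant `κ`,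
phrased in terms of the pair `(V, Λ)`. -/
def InTheta (q s : ℝ) (p r : ℕ) (lam κ : ℝ)
    (V : Matrix (Fin p) (Fin r) ℝ) (Λ : Fin r → ℝ) : Prop :=
  IsOrthonormalCols V ∧ weakLq q V ≤ s ∧ Antitone Λ ∧
    (∀ i, 0 < lam ∧ lam ≤ Λ i ∧ Λ i ≤ κ * lam)

/-- The distribution of the data matrix `X = U D Vᵀ + σ Z` (rows i.i.d.
`N(0, V Λ Vᵀ + σ² I_p)`), as a measure on `Fin n → Fin p → ℝ`. -/
def spikedMeasure (n p r : ℕ) (Λ : Fin r → ℝ) (V : Matrix (Fin p) (Fin r) ℝ)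
    (σ2 : ℝ) : Measure (Fin n → Fin p → ℝ) :=
  Measure.map
    (fun w : (Fin n → Fin r → ℝ) × (Fin n → Fin p → ℝ) =>
      fun i j => (∑ k, w.1 i k * Real.sqrt (Λ k) * V j k) + Real.sqrt σ2 * w.2 i j)
    ((gaussianMatrix n r).prod (gaussianMatrix n p))


/-- `t_k = r + √(2 r β log(ep/k)) + β log(ep/k)`. -/
def tpen (β : ℝ) (p r : ℕ) (k : ℕ) : ℝ :=
  (r : ℝ) + Real.sqrt (2 * r * β * Real.log (Real.exp 1 * p / k)) +
    β * Real.log (Real.exp 1 * p / k)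

/-- The penalty `pen(k) = (1+δ)² ∑_{i=1}^k t_i`. -/
def pen (β δ : ℝ) (p r : ℕ) (k : ℕ) : ℝ :=
  (1 + δ) ^ 2 * ∑ i ∈ Finset.Icc 1 k, tpen β p r i

/-- Number of nonzero rows of a matrix. -/
def suppCard {p r : ℕ} (T : Matrix (Fin p) (Fin r) ℝ) : ℕ :=
  Nat.card {j : Fin p // T j ≠ 0}

/-- The penalized least-squares estimator
`Θ̂ = argmin_Θ ‖Y - Θ‖_F² + pen(|supp(Θ)|)`. -/
noncomputable def penEst (β δ : ℝ) {p r : ℕ} (Y : Matrix (Fin p) (Fin r) ℝ) :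
    Matrix (Fin p) (Fin r) ℝ :=
  Classical.epsilon fun T : Matrix (Fin p) (Fin r) ℝ =>
    ∀ T' : Matrix (Fin p) (Fin r) ℝ,
      frobSq (Y - T) + pen β δ p r (suppCard T) ≤
        frobSq (Y - T') + pen β δ p r (suppCard T')

/-- Smallest singular value of a square matrix. -/
noncomputable def sigmaMin {r : ℕ} (A : Matrix (Fin r) (Fin r) ℝ) : ℝ :=
  sInf {c : ℝ | ∃ v : Fin r → ℝ, ∑ i, v i ^ 2 = 1 ∧
    c = Real.sqrt (∑ i, (A.mulVec v i) ^ 2)}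

/-- `(L, C, R)` is a thin singular value decomposition `B = L C Rᵀ`. -/
def IsThinSVD {n r : ℕ} (B L : Matrix (Fin n) (Fin r) ℝ)
    (C R : Matrix (Fin r) (Fin r) ℝ) : Prop :=
  B = L * C * Rᵀ ∧ Lᵀ * L = 1 ∧ Rᵀ * R = 1 ∧
    ∃ d : Fin r → ℝ, (∀ i, 0 ≤ d i) ∧ C = Matrix.diagonal d

/-- A choice of the factors `(C, R)` of a thin SVD of `B`. -/
noncomputable def svdCR {n r : ℕ} (B : Matrix (Fin n) (Fin r) ℝ) :
    Matrix (Fin r) (Fin r) ℝ × Matrix (Fin r) (Fin r) ℝ :=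
  Classical.epsilon fun CR : Matrix (Fin r) (Fin r) ℝ × Matrix (Fin r) (Fin r) ℝ =>
    ∃ L, IsThinSVD B L CR.1 CR.2

/-- Orthonormalization of the columns of `T` (Gram–Schmidt / QR): an element
of `O(p,r)` times an upper-triangular factor recovering `T`. -/
noncomputable def orthonormalize {p r : ℕ} (T : Matrix (Fin p) (Fin r) ℝ) :
    Matrix (Fin p) (Fin r) ℝ :=
  Classical.epsilon fun Q : Matrix (Fin p) (Fin r) ℝ =>
    IsOrthonormalCols Q ∧ ∃ Rt : Matrix (Fin r) (Fin r) ℝ,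
      (∀ i j : Fin r, j < i → Rt i j = 0) ∧ T = Q * Rt

/-- The law of the triple `(U, Z, Z̃)` of independent standard Gaussian
matrices generating the data and the auxiliary randomization. -/
noncomputable def reductionMeasure (n p r : ℕ) :
    Measure (((Fin n → Fin r → ℝ) × (Fin n → Fin p → ℝ)) × (Fin n → Fin p → ℝ)) :=
  ((gaussianMatrix n r).prod (gaussianMatrix n p)).prod (gaussianMatrix n p)

/-- `X⁰ = X + Z̃` where `X = U D Vᵀ + Z`. -/
noncomputable def X0w {n p r : ℕ} (Λ : Fin r → ℝ) (V : Matrix (Fin p) (Fin r) ℝ)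
    (w : ((Fin n → Fin r → ℝ) × (Fin n → Fin p → ℝ)) × (Fin n → Fin p → ℝ)) :
    Matrix (Fin n) (Fin p) ℝ :=
  Matrix.of fun i j =>
    (∑ k, w.1.1 i k * Real.sqrt (Λ k) * V j k) + w.1.2 i j + w.2 i j

/-- `X¹ = X - Z̃` where `X = U D Vᵀ + Z`. -/
noncomputable def X1w {n p r : ℕ} (Λ : Fin r → ℝ) (V : Matrix (Fin p) (Fin r) ℝ)
    (w : ((Fin n → Fin r → ℝ) × (Fin n → Fin p → ℝ)) × (Fin n → Fin p → ℝ)) :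
    Matrix (Fin n) (Fin p) ℝ :=
  Matrix.of fun i j =>
    (∑ k, w.1.1 i k * Real.sqrt (Λ k) * V j k) + w.1.2 i j - w.2 i j

/-- The adaptive estimator of Section 3: given the two samples `X⁰, X¹` and an
initial estimator `V⁰ = V0est(X⁰)`, form `B = X⁰ V⁰` with thin SVD
`B = L C Rᵀ`, set `Y = (1/√2) (X¹)ᵀ X⁰ V⁰ R C⁻¹`, apply the penalized
least-squares estimator and orthonormalize. -/
noncomputable def adaptiveEst (n p r : ℕ) (β δ : ℝ)
    (V0est : (Fin n → Fin p → ℝ) → (Fin p → Fin r → ℝ))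
    (X0 X1 : Matrix (Fin n) (Fin p) ℝ) : Matrix (Fin p) (Fin r) ℝ :=
  let V0 : Matrix (Fin p) (Fin r) ℝ := Matrix.of (V0est (fun i j => X0 i j))
  let CR := svdCR (X0 * V0)
  let Y := (Real.sqrt 2)⁻¹ • (X1ᵀ * X0 * V0 * CR.2 * (CR.1)⁻¹)
  orthonormalize (penEst β δ Y)

instance instProbStd (ι : Type*) [Fintype ι] : IsProbabilityMeasure (stdGaussian ι) := by
  unfold stdGaussian; infer_instance

instance instProbMat (n m : ℕ) : IsProbabilityMeasure (gaussianMatrix n m) := by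
  unfold gaussianMatrix; infer_instance

lemma lintegral_pi_prod {ι : Type*} [Fintype ι] {E : Type*} [MeasurableSpace E]
    (μ : Measure E) [IsProbabilityMeasure μ] (f : ι → E → ℝ≥0∞) (hf : ∀ i, Measurable (f i)) :
    ∫⁻ x, ∏ i, f i (x i) ∂(Measure.pi fun _ : ι => μ) = ∏ i, ∫⁻ x, f i x ∂μ := by
  have h := lintegral_prod_eq_prod_lintegral_of_indepFun (μ := Measure.pi fun _ : ι => μ)
    Finset.univ (fun i x => f i (x i))
    (iIndepFun_pi (μ := fun _ : ι => μ) (X := f) fun i => (hf i).aemeasurable)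
    (fun i => (hf i).comp (measurable_pi_apply i))
  rw [h]
  refine Finset.prod_congr rfl fun i _ => ?_
  exact (measurePreserving_eval (fun _ : ι => μ) i).lintegral_comp (hf i)

lemma stdGaussian_map_linear {ι : Type*} [Fintype ι] (a : ι → ℝ) :
    (stdGaussian ι).map (fun x => ∑ i, a i * x i)
      = gaussianReal 0 (∑ i, a i ^ 2).toNNReal := by
  classical
  set E := EuclideanSpace ℝ ι
  have h1 : (fun x : ι → ℝ => ∑ i, a i * x i)
      = (innerSL ℝ (WithLp.toLp 2 a : E)) ∘ (WithLp.toLp 2) := by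
    ext x
    simp [PiLp.inner_apply, mul_comm]
  have h2 : (stdGaussian ι).map (WithLp.toLp 2) = ProbabilityTheory.stdGaussian E :=
    map_pi_eq_stdGaussian
  rw [h1, ← Measure.map_map (by fun_prop) (by fun_prop), h2, IsGaussian.map_eq_gaussianReal,
    integral_strongDual_stdGaussian, variance_dual_stdGaussian]
  congr 2
  rw [innerSL_apply_norm, EuclideanSpace.norm_sq_eq]
  simp

/-- Linear exponential moments. -/
lemma lintegral_exp_linear_real (a : ℝ) :
    ∫⁻ x, ENNReal.ofReal (Real.exp (a * x)) ∂(gaussianReal 0 1)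
      = ENNReal.ofReal (Real.exp (a ^ 2 / 2)) := by
  have h := congrFun (mgf_fun_id_gaussianReal (μ := 0) (v := 1)) a
  rw [mgf] at h
  rw [← ofReal_integral_eq_lintegral_ofReal]
  · rw [h]; simp
  · exact integrable_exp_mul_gaussianReal a
  · exact Filter.Eventually.of_forall fun x => (Real.exp_pos _).le

lemma lintegral_exp_sum_pi {ι : Type*} [Fintype ι] {E : Type*} [MeasurableSpace E]
    (μ : Measure E) [IsProbabilityMeasure μ] (f : ι → E → ℝ) (hf : ∀ i, Measurable (f i)) :
    ∫⁻ x, ENNReal.ofReal (Real.exp (∑ i, f i (x i))) ∂(Measure.pi fun _ : ι => μ)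
      = ∏ i, ∫⁻ x, ENNReal.ofReal (Real.exp (f i x)) ∂μ := by
  rw [← lintegral_pi_prod μ (fun i x => ENNReal.ofReal (Real.exp (f i x)))
    (fun i => by have := hf i; fun_prop)]
  refine lintegral_congr fun x => ?_
  rw [Real.exp_sum, ENNReal.ofReal_prod_of_nonneg fun i _ => (Real.exp_pos _).le]

lemma lintegral_exp_linear {ι : Type*} [Fintype ι] (a : ι → ℝ) :
    ∫⁻ x, ENNReal.ofReal (Real.exp (∑ i, a i * x i)) ∂(stdGaussian ι)
      = ENNReal.ofReal (Real.exp ((∑ i, a i ^ 2) / 2)) := by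
  unfold stdGaussian
  rw [lintegral_exp_sum_pi (gaussianReal 0 1) (fun i x => a i * x) (fun i => by fun_prop)]
  simp_rw [lintegral_exp_linear_real]
  rw [← ENNReal.ofReal_prod_of_nonneg fun i _ => (Real.exp_pos _).le, ← Real.exp_sum,
    Finset.sum_div]

lemma lintegral_exp_linear_mat {n m : ℕ} (a : Fin n → Fin m → ℝ) :
    ∫⁻ x, ENNReal.ofReal (Real.exp (∑ i, ∑ j, a i j * x i j)) ∂(gaussianMatrix n m)
      = ENNReal.ofReal (Real.exp ((∑ i, ∑ j, a i j ^ 2) / 2)) := by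
  unfold gaussianMatrix
  rw [lintegral_exp_sum_pi (stdGaussian (Fin m)) (fun i x => ∑ j, a i j * x j)
    (fun i => by fun_prop)]
  simp_rw [lintegral_exp_linear]
  rw [← ENNReal.ofReal_prod_of_nonneg fun i _ => (Real.exp_pos _).le, ← Real.exp_sum,
    Finset.sum_div]

lemma lintegral_exp_sq_real {θ : ℝ} (hθ : θ < 1 / 2) :
    ∫⁻ x, ENNReal.ofReal (Real.exp (θ * x ^ 2)) ∂(gaussianReal 0 1)
      = ENNReal.ofReal ((1 - 2 * θ) ^ (-(1 / 2) : ℝ)) := by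
  have hb : 0 < 1 / 2 - θ := by linarith
  rw [gaussianReal_of_var_ne_zero _ one_ne_zero, lintegral_withDensity_eq_lintegral_mul _
    (by fun_prop) (by fun_prop)]
  have : ∀ x : ℝ, (gaussianPDF 0 1 * fun x => ENNReal.ofReal (Real.exp (θ * x ^ 2))) x
      = ENNReal.ofReal ((√(2 * π))⁻¹ * Real.exp (-(1 / 2 - θ) * x ^ 2)) := by
    intro x
    rw [Pi.mul_apply, gaussianPDF, ← ENNReal.ofReal_mul (gaussianPDFReal_nonneg _ _ _),
      gaussianPDFReal, mul_assoc, ← Real.exp_add]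
    congr 3
    · simp
    · push_cast; ring_nf
  simp_rw [this]
  rw [← ofReal_integral_eq_lintegral_ofReal]
  · congr 1
    rw [integral_const_mul, integral_gaussian, Real.rpow_neg (by linarith), ← Real.sqrt_eq_rpow,
      ← Real.sqrt_inv, ← Real.sqrt_inv, ← Real.sqrt_mul (by positivity)]
    congr 1
    have : (1 - 2 * θ) ≠ 0 := by linarith
    have := Real.pi_pos.ne'
    field_simp
  · exact (integrable_exp_neg_mul_sq hb).const_mul _
  · exact Filter.Eventually.of_forall fun x => by positivity

lemma lintegral_sq_real : ∫⁻ x, ENNReal.ofReal (x ^ 2) ∂(gaussianReal 0 1) = 1 := by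
  have h : Var[fun x => x; gaussianReal 0 1] = 1 := by simp
  rw [variance_eq_integral (by fun_prop)] at h
  simp only [integral_id_gaussianReal, sub_zero] at h
  rw [← ofReal_integral_eq_lintegral_ofReal]
  · rw [h]; simp
  · exact (memLp_id_gaussianReal 2).integrable_sq
  · exact Filter.Eventually.of_forall fun x => by positivity

lemma stdGaussian_map_unit {ι : Type*} [Fintype ι] (a : ι → ℝ) (ha : ∑ i, a i ^ 2 = 1) :
    (stdGaussian ι).map (fun x => ∑ i, a i * x i) = gaussianReal 0 1 := by
  rw [stdGaussian_map_linear, ha]; simp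

lemma lintegral_linear_sq {ι : Type*} [Fintype ι] (a : ι → ℝ) :
    ∫⁻ x, ENNReal.ofReal ((∑ i, a i * x i) ^ 2) ∂(stdGaussian ι)
      = ENNReal.ofReal (∑ i, a i ^ 2) := by
  have hm : Measurable (fun x : ι → ℝ => ∑ i, a i * x i) := by fun_prop
  rcases eq_or_lt_of_le (show 0 ≤ ∑ i, a i ^ 2 from Finset.sum_nonneg fun i _ => sq_nonneg _)
    with h | h
  · have h0 : ∀ i, a i = 0 := by
      intro i
      have := (Finset.sum_eq_zero_iff_of_nonneg (fun i _ => sq_nonneg (a i))).1 h.symm i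
        (Finset.mem_univ i)
      exact pow_eq_zero_iff (two_ne_zero) |>.1 this
    simp [h0]
  · set c := √(∑ i, a i ^ 2) with hc
    have hc2 : c ^ 2 = ∑ i, a i ^ 2 := Real.sq_sqrt h.le
    have hc0 : 0 < c := Real.sqrt_pos.2 h
    have hu : ∑ i, (a i / c) ^ 2 = 1 := by
      simp_rw [div_pow]; rw [← Finset.sum_div, hc2, div_self h.ne']
    have hlaw := stdGaussian_map_unit (fun i => a i / c) hu
    have : ∀ x : ι → ℝ, ENNReal.ofReal ((∑ i, a i * x i) ^ 2)
        = ENNReal.ofReal (c ^ 2) * ENNReal.ofReal ((∑ i, a i / c * x i) ^ 2) := by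
      intro x
      rw [← ENNReal.ofReal_mul (by positivity), ← mul_pow, Finset.mul_sum]
      have he : ∑ i, c * (a i / c * x i) = ∑ i, a i * x i :=
        Finset.sum_congr rfl fun i _ => by field_simp
      rw [he]
    simp_rw [this]
    rw [lintegral_const_mul _ (by fun_prop)]
    have h3 : ∫⁻ x, ENNReal.ofReal ((∑ i, a i / c * x i) ^ 2) ∂(stdGaussian ι) = 1 := by
      rw [← lintegral_sq_real, ← hlaw, lintegral_map (by fun_prop) (by fun_prop)]
    rw [h3, mul_one, hc2]

/-- quadratic exponential moment of `U y`, `y` a unit vector. -/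
lemma lintegral_exp_mulVec {n m : ℕ} (y : Fin m → ℝ) (hy : ∑ i, y i ^ 2 = 1) {θ : ℝ}
    (hθ : θ < 1 / 2) :
    ∫⁻ U, ENNReal.ofReal (Real.exp (∑ i, θ * (∑ j, y j * U i j) ^ 2)) ∂(gaussianMatrix n m)
      = ENNReal.ofReal ((1 - 2 * θ) ^ (-(1 / 2) : ℝ)) ^ n := by
  unfold gaussianMatrix
  rw [lintegral_exp_sum_pi (stdGaussian (Fin m)) (fun i x => θ * (∑ j, y j * x j) ^ 2)
    (fun i => by fun_prop)]
  have : ∫⁻ x, ENNReal.ofReal (Real.exp (θ * (∑ j, y j * x j) ^ 2)) ∂(stdGaussian (Fin m))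
      = ENNReal.ofReal ((1 - 2 * θ) ^ (-(1 / 2) : ℝ)) := by
    rw [← lintegral_exp_sq_real hθ, ← stdGaussian_map_unit y hy,
      lintegral_map (by fun_prop) (by fun_prop)]
  simp [this]

lemma lintegral_exp_sq_mat {n m : ℕ} {θ : ℝ} (hθ : θ < 1 / 2) (A : Finset (Fin n)) :
    ∫⁻ ξ, ENNReal.ofReal (Real.exp (θ * ∑ j ∈ A, ∑ i, ξ j i ^ 2)) ∂(gaussianMatrix n m)
      = ENNReal.ofReal ((1 - 2 * θ) ^ (-(1 / 2) : ℝ)) ^ (A.card * m) := by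
  classical
  have : ∀ ξ : Fin n → Fin m → ℝ, θ * ∑ j ∈ A, ∑ i, ξ j i ^ 2
      = ∑ j, (fun j (x : Fin m → ℝ) => if j ∈ A then ∑ i, θ * x i ^ 2 else 0) j (ξ j) := by
    intro ξ
    simp [Finset.mul_sum, Finset.sum_ite_mem]
  simp_rw [this]
  unfold gaussianMatrix
  rw [lintegral_exp_sum_pi (stdGaussian (Fin m))
    (fun j (x : Fin m → ℝ) => if j ∈ A then ∑ i, θ * x i ^ 2 else 0)
    (fun i => by split_ifs <;> fun_prop)]
  have h2 : ∀ j : Fin n, ∫⁻ x, ENNReal.ofReal (Real.exp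
      (if j ∈ A then ∑ i, θ * x i ^ 2 else 0)) ∂(stdGaussian (Fin m))
      = if j ∈ A then ENNReal.ofReal ((1 - 2 * θ) ^ (-(1 / 2) : ℝ)) ^ m else 1 := by
    intro j
    split_ifs
    · unfold stdGaussian
      rw [lintegral_exp_sum_pi (gaussianReal 0 1) (fun i x => θ * x ^ 2) (fun i => by fun_prop)]
      simp [lintegral_exp_sq_real hθ]
    · simp
  simp_rw [h2]
  rw [Finset.prod_ite_mem]
  simp [← pow_mul, mul_comm]

/-- squared norm of the rows in `A` of `Wᵀ L`. -/
def projSq {n p r : ℕ} (L : Matrix (Fin n) (Fin r) ℝ) (A : Finset (Fin p))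
    (W : Fin n → Fin p → ℝ) : ℝ :=
  ∑ j ∈ A, ∑ i, (∑ m, W m j * L m i) ^ 2

lemma sum_sq_mulVec_orth {n r : ℕ} (L : Matrix (Fin n) (Fin r) ℝ) (hL : Lᵀ * L = 1)
    (v : Fin r → ℝ) : ∑ m, (∑ i, v i * L m i) ^ 2 = ∑ i, v i ^ 2 := by
  have h1 : (L *ᵥ v) ⬝ᵥ (L *ᵥ v) = v ⬝ᵥ v := by
    rw [Matrix.dotProduct_mulVec, ← Matrix.mulVec_transpose, Matrix.mulVec_mulVec, hL,
      Matrix.one_mulVec]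
  simp only [dotProduct, mulVec] at h1
  simp_rw [pow_two]
  rw [← h1]
  simp_rw [mul_comm (v _)]

lemma lintegral_exp_proj {n p r : ℕ} (L : Matrix (Fin n) (Fin r) ℝ) (hL : Lᵀ * L = 1)
    (A : Finset (Fin p)) {θ : ℝ} (hθ0 : 0 ≤ θ) (hθ : θ < 1 / 2) :
    ∫⁻ W, ENNReal.ofReal (Real.exp (θ * projSq L A W)) ∂(gaussianMatrix n p)
      = ENNReal.ofReal ((1 - 2 * θ) ^ (-(1 / 2) : ℝ)) ^ (A.card * r) := by
  classical
  set s := √(2 * θ) with hs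
  have hs2 : s ^ 2 = 2 * θ := Real.sq_sqrt (by linarith)
  have h1 : ∀ W : Fin n → Fin p → ℝ, ENNReal.ofReal (Real.exp (θ * projSq L A W))
      = ∫⁻ ξ, ENNReal.ofReal (Real.exp (∑ j, ∑ i,
          (if j ∈ A then s * ∑ m, W m j * L m i else 0) * ξ j i)) ∂(gaussianMatrix p r) := by
    intro W
    rw [lintegral_exp_linear_mat]
    congr 2
    rw [projSq, ← Finset.sum_filter_add_sum_filter_not Finset.univ (fun j => j ∈ A)]
    rw [Finset.sum_eq_zero (s := Finset.univ.filter fun j => j ∉ A)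
      (fun j hj => by simp [(Finset.mem_filter.1 hj).2])]
    rw [add_zero, Finset.filter_mem_eq_inter, Finset.univ_inter, Finset.mul_sum, Finset.sum_div]
    refine Finset.sum_congr rfl fun j hj => ?_
    rw [Finset.mul_sum, Finset.sum_div]
    refine Finset.sum_congr rfl fun i _ => ?_
    rw [if_pos hj, mul_pow, hs2]; ring
  simp_rw [h1]
  rw [lintegral_lintegral_swap]
  · rw [← lintegral_exp_sq_mat hθ A]
    refine lintegral_congr fun ξ => ?_
    have h2 : ∀ W : Fin n → Fin p → ℝ, ∑ j, ∑ i,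
          (if j ∈ A then s * ∑ m, W m j * L m i else 0) * ξ j i
          = ∑ m, ∑ j, (if j ∈ A then s * ∑ i, ξ j i * L m i else 0) * W m j := by
      intro W
      rw [Finset.sum_comm (γ := Fin n)]
      refine Finset.sum_congr rfl fun j _ => ?_
      split_ifs
      · simp_rw [Finset.mul_sum, Finset.sum_mul]
        rw [Finset.sum_comm]
        refine Finset.sum_congr rfl fun m _ => Finset.sum_congr rfl fun i _ => ?_
        ring
      · simp
    simp_rw [h2]
    rw [lintegral_exp_linear_mat]
    congr 2
    rw [Finset.sum_comm,
      ← Finset.sum_filter_add_sum_filter_not Finset.univ (fun j => j ∈ A)]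
    rw [Finset.sum_eq_zero (s := Finset.univ.filter fun j => j ∉ A)
      (fun j hj => by simp [(Finset.mem_filter.1 hj).2])]
    rw [add_zero, Finset.filter_mem_eq_inter, Finset.univ_inter, Finset.mul_sum, Finset.sum_div]
    refine Finset.sum_congr rfl fun j hj => ?_
    simp_rw [if_pos hj, mul_pow, hs2]
    rw [← Finset.mul_sum, sum_sq_mulVec_orth L hL]; ring
  · refine Measurable.aemeasurable ?_
    unfold Function.uncurry
    refine ENNReal.measurable_ofReal.comp (Real.measurable_exp.comp ?_)
    refine Finset.measurable_sum _ fun j _ => Finset.measurable_sum _ fun i _ => ?_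
    split_ifs <;> fun_prop

lemma log_le_half_sub_inv {v : ℝ} (hv : 1 ≤ v) : Real.log v ≤ (v - v⁻¹) / 2 := by
  have h0 : 0 < v := by linarith
  have h := Real.self_le_sinh_iff.2 (Real.log_nonneg hv)
  rwa [Real.sinh_log h0] at h

lemma rpow_neg_half_le {u : ℝ} (h0 : 0 ≤ u) (h1 : u < 1) :
    (1 - u) ^ (-(1 / 2) : ℝ) ≤ Real.exp (u / 2 + u ^ 2 / (4 * (1 - u))) := by
  have hu : 0 < 1 - u := by linarith
  rw [Real.rpow_def_of_pos hu]
  apply Real.exp_le_exp.2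
  have h := log_le_half_sub_inv (v := (1 - u)⁻¹) ((one_le_inv₀ hu).2 (by linarith))
  rw [Real.log_inv, inv_inv] at h
  have : u / 2 + u ^ 2 / (4 * (1 - u)) = (((1 - u)⁻¹ - (1 - u)) / 2) * (1 / 2) := by
    field_simp; ring
  rw [this]; linarith

lemma chernoff_chi {d x θ : ℝ} (hd : 0 < d) (hx : 0 < x) (hθ : θ = √x / (√d + 2 * √x)) :
    d * (2 * θ / 2 + (2 * θ) ^ 2 / (4 * (1 - 2 * θ))) - θ * (d + 2 * √(d * x) + 2 * x) = -x := by
  obtain ⟨a, ha, rfl⟩ : ∃ a, 0 < a ∧ d = a ^ 2 := ⟨√d, Real.sqrt_pos.2 hd, (Real.sq_sqrt hd.le).symm⟩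
  obtain ⟨b, hb, rfl⟩ : ∃ a, 0 < a ∧ x = a ^ 2 := ⟨√x, Real.sqrt_pos.2 hx, (Real.sq_sqrt hx.le).symm⟩
  rw [← mul_pow, Real.sqrt_sq (by positivity)]
  rw [Real.sqrt_sq ha.le, Real.sqrt_sq hb.le] at hθ
  have h1 : 1 - 2 * θ = a / (a + 2 * b) := by rw [hθ]; field_simp; ring
  rw [h1, hθ]
  field_simp
  ring

/-- positive part of a chi-square excess -/
lemma lintegral_excess {n p r : ℕ} (L : Matrix (Fin n) (Fin r) ℝ) (hL : Lᵀ * L = 1)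
    (A : Finset (Fin p)) (hA : 0 < A.card) (hr : 0 < r) {x t : ℝ} (hx : 0 < x)
    (ht : (A.card * r : ℝ) + 2 * √((A.card * r : ℝ) * x) + 2 * x ≤ t) :
    ∫⁻ W, ENNReal.ofReal (projSq L A W - t) ∂(gaussianMatrix n p)
      ≤ ENNReal.ofReal ((2 + √((A.card * r : ℝ) / x)) * Real.exp (-x)) := by
  set d : ℝ := A.card * r with hd
  have hd0 : 0 < d := by positivity
  set θ := √x / (√d + 2 * √x) with hθ
  have hsx : 0 < √x := Real.sqrt_pos.2 hx
  have hsd : 0 < √d := Real.sqrt_pos.2 hd0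
  have hθ0 : 0 < θ := by positivity
  have hθ1 : θ < 1 / 2 := by
    rw [hθ, div_lt_iff₀ (by positivity)]; linarith
  have hinv : θ⁻¹ = 2 + √(d / x) := by
    rw [hθ, Real.sqrt_div hd0.le]; field_simp; ring
  have h1 : ∀ W : Fin n → Fin p → ℝ, ENNReal.ofReal (projSq L A W - t)
      ≤ ENNReal.ofReal (θ⁻¹ * Real.exp (-(θ * t))) *
        ENNReal.ofReal (Real.exp (θ * projSq L A W)) := by
    intro W
    rw [← ENNReal.ofReal_mul (by positivity)]
    apply ENNReal.ofReal_le_ofReal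
    rw [mul_assoc, ← Real.exp_add, inv_mul_eq_div, le_div_iff₀ hθ0]
    have := Real.add_one_le_exp (-(θ * t) + θ * projSq L A W)
    nlinarith
  refine (lintegral_mono h1).trans ?_
  rw [lintegral_const_mul _ (by unfold projSq; fun_prop), lintegral_exp_proj L hL A hθ0.le hθ1,
    ← ENNReal.ofReal_pow (Real.rpow_nonneg (by linarith) _), ← ENNReal.ofReal_mul (by positivity)]
  apply ENNReal.ofReal_le_ofReal
  rw [hinv, mul_assoc]
  refine mul_le_mul_of_nonneg_left ?_ (by positivity)
  have h2 : ((1 - 2 * θ) ^ (-(1 / 2) : ℝ)) ^ (A.card * r)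
      ≤ Real.exp (d * (2 * θ / 2 + (2 * θ) ^ 2 / (4 * (1 - 2 * θ)))) := by
    refine (pow_le_pow_left₀ (Real.rpow_nonneg (by linarith) _)
      (rpow_neg_half_le (by linarith) (by linarith)) _).trans ?_
    rw [← Real.exp_nat_mul, hd]
    push_cast
    exact le_rfl
  refine (mul_le_mul_of_nonneg_left h2 (Real.exp_pos _).le).trans ?_
  rw [← Real.exp_add]
  apply Real.exp_le_exp.2
  have h3 := chernoff_chi hd0 hx hθ
  nlinarith [mul_le_mul_of_nonneg_left ht hθ0.le]

/-- `log (ep/k)`. -/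
def ell (p k : ℕ) : ℝ := Real.log (Real.exp 1 * p / k)

lemma ell_eq {p k : ℕ} (hk : 1 ≤ k) (hp : 1 ≤ p) :
    ell p k = 1 + Real.log p - Real.log k := by
  have hk' : (0 : ℝ) < k := by exact_mod_cast hk
  have hp' : (0 : ℝ) < p := by exact_mod_cast hp
  rw [ell, Real.log_div (by positivity) (by positivity), Real.log_mul (by positivity)
    (by positivity), Real.log_exp]

lemma ell_anti {p i k : ℕ} (hi : 1 ≤ i) (hik : i ≤ k) (hp : 1 ≤ p) : ell p k ≤ ell p i := by
  rw [ell_eq hi hp, ell_eq (hi.trans hik) hp]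
  have : Real.log i ≤ Real.log k :=
    Real.log_le_log (by exact_mod_cast hi) (by exact_mod_cast hik)
  linarith

lemma one_le_ell {p k : ℕ} (hk : 1 ≤ k) (hkp : k ≤ p) : 1 ≤ ell p k := by
  have h := ell_anti hk hkp (hk.trans hkp)
  rw [ell_eq (hk.trans hkp) (hk.trans hkp)] at h
  linarith

lemma choose_le_exp_ell {p k : ℕ} (hk : 1 ≤ k) (hkp : k ≤ p) :
    (p.choose k : ℝ) ≤ Real.exp (k * ell p k) := by
  have hk' : (0 : ℝ) < k := by exact_mod_cast hk
  have hp' : (0 : ℝ) < p := by exact_mod_cast hk.trans hkp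
  have h1 : (p.choose k : ℝ) ≤ (p : ℝ) ^ k / (k.factorial : ℝ) := Nat.choose_le_pow_div k p
  have h2 : (k : ℝ) ^ k / (k.factorial : ℝ) ≤ Real.exp k :=
    Real.pow_div_factorial_le_exp k hk'.le k
  have h3 : Real.exp (k * ell p k) = (p : ℝ) ^ k * Real.exp k / (k : ℝ) ^ k := by
    rw [Real.exp_nat_mul, ell, Real.exp_log (by positivity), div_pow, mul_pow, ← Real.exp_nat_mul,
      mul_one, mul_comm]
  rw [h3]
  refine h1.trans ?_
  have hf : (0 : ℝ) < k.factorial := by exact_mod_cast k.factorial_pos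
  rw [div_le_iff₀ hf] at h2
  rw [div_le_div_iff₀ hf (by positivity)]
  nlinarith [pow_pos hp' k]

lemma tpen_nonneg' {β : ℝ} (hβ : 2 < β) {p r k : ℕ} (hk : 1 ≤ k) (hkp : k ≤ p) :
    0 ≤ tpen β p r k := by
  have := one_le_ell hk hkp
  unfold ell at this
  unfold tpen
  have h2 : 0 ≤ β * Real.log (Real.exp 1 * p / k) := by nlinarith
  positivity

lemma tpen_anti {β : ℝ} (hβ : 2 < β) {p r i k : ℕ} (hi : 1 ≤ i) (hik : i ≤ k) (hkp : k ≤ p) :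
    tpen β p r k ≤ tpen β p r i := by
  have h := ell_anti hi hik ((hi.trans hik).trans hkp)
  unfold ell at h
  unfold tpen
  have h1 : 0 ≤ 2 * (r : ℝ) * β := by have := r.cast_nonneg (α := ℝ); nlinarith
  gcongr

/-- `∑_{i ≤ k} t_i`. -/
def Tsum (β : ℝ) (p r k : ℕ) : ℝ := ∑ i ∈ Finset.Icc 1 k, tpen β p r i

lemma mul_tpen_le_Tsum {β : ℝ} (hβ : 2 < β) {p r k : ℕ} (hkp : k ≤ p) :
    k * tpen β p r k ≤ Tsum β p r k := by
  have h := Finset.card_nsmul_le_sum (Finset.Icc 1 k) (fun i => tpen β p r i) (tpen β p r k)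
    (fun i hi => tpen_anti hβ (Finset.mem_Icc.1 hi).1 (Finset.mem_Icc.1 hi).2 hkp)
  simpa [Tsum] using h

lemma Tsum_mono {β : ℝ} (hβ : 2 < β) {p r j k : ℕ} (hjk : j ≤ k) (hkp : k ≤ p) :
    Tsum β p r j ≤ Tsum β p r k := by
  unfold Tsum
  refine Finset.sum_le_sum_of_subset_of_nonneg (Finset.Icc_subset_Icc_right hjk) ?_
  intro i hi _
  exact tpen_nonneg' hβ (Finset.mem_Icc.1 hi).1 ((Finset.mem_Icc.1 hi).2.trans hkp)

lemma Tsum_nonneg {β : ℝ} (hβ : 2 < β) {p r k : ℕ} (hkp : k ≤ p) :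
    0 ≤ Tsum β p r k := by
  have := Tsum_mono hβ (r := r) (Nat.zero_le k) hkp
  simpa [Tsum] using this

lemma sum_ell_le {p : ℕ} (hp : 1 ≤ p) (k : ℕ) (hk : 1 ≤ k) :
    ∑ i ∈ Finset.Icc 1 k, ell p i ≤ k * ell p k + k := by
  induction k, hk using Nat.le_induction with
  | base => simp
  | succ k hk ih =>
    rw [Finset.sum_Icc_succ_top (by omega)]
    have hk' : (0 : ℝ) < k := by exact_mod_cast hk
    have h : (k : ℝ) * (ell p k - ell p (k + 1)) ≤ 1 := by
      rw [ell_eq hk hp, ell_eq (by omega) hp]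
      have h2 : Real.log ((k + 1 : ℕ) : ℝ) - Real.log k ≤ 1 / k := by
        rw [← Real.log_div (by positivity) (by positivity)]
        refine (Real.log_le_sub_one_of_pos (by positivity)).trans (le_of_eq ?_)
        push_cast; field_simp; ring
      have h3 := mul_le_mul_of_nonneg_left h2 hk'.le
      rw [mul_one_div_cancel hk'.ne'] at h3
      linarith
    push_cast
    linarith

lemma Tsum_le {β : ℝ} (hβ : 2 < β) {p r k : ℕ} (hk : 1 ≤ k) (hkp : k ≤ p) :
    Tsum β p r k ≤ 4 * β * (r * k + k * ell p k) := by
  have h1 : ∀ i ∈ Finset.Icc 1 k, tpen β p r i ≤ 2 * r + 2 * β * ell p i := by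
    intro i hi
    have hl := one_le_ell (Finset.mem_Icc.1 hi).1 ((Finset.mem_Icc.1 hi).2.trans hkp)
    have hr := r.cast_nonneg (α := ℝ)
    have hb : 0 ≤ β * ell p i := by nlinarith
    have : √(2 * r * β * ell p i) ≤ r + β * ell p i := by
      rw [Real.sqrt_le_left (by positivity)]
      nlinarith [sq_nonneg ((r : ℝ)), sq_nonneg (β * ell p i)]
    unfold tpen
    change (r : ℝ) + √(2 * r * β * ell p i) + β * ell p i ≤ _
    linarith
  refine (Finset.sum_le_sum h1).trans ?_
  rw [Finset.sum_add_distrib, ← Finset.mul_sum (Finset.Icc 1 k) (fun i => ell p i)]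
  have h2 := sum_ell_le (hk.trans hkp) k hk
  have h3 := one_le_ell hk hkp
  have hr := r.cast_nonneg (α := ℝ)
  have hk' : (1 : ℝ) ≤ k := by exact_mod_cast hk
  simp only [Finset.sum_const, Nat.card_Icc, nsmul_eq_mul]
  have h4 : (k : ℝ) ≤ k * ell p k := by nlinarith
  have h5 : (0 : ℝ) ≤ r * k := by positivity
  have h6 : β * ∑ i ∈ Finset.Icc 1 k, ell p i ≤ β * (k * ell p k + k * ell p k) :=
    mul_le_mul_of_nonneg_left (by linarith) (by linarith)
  push_cast [Nat.add_sub_cancel]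
  nlinarith

/-- The constant in the bound on the excess. -/
def gconst (β : ℝ) : ℝ := ∑' k : ℕ, (Real.exp (-(β / 2 - 1))) ^ k

lemma gconst_nonneg (β : ℝ) : 0 ≤ gconst β := tsum_nonneg fun k => by positivity

lemma lintegral_excess_pen {β : ℝ} (hβ : 2 < β) {n p r : ℕ} (hr : 1 ≤ r)
    (L : Matrix (Fin n) (Fin r) ℝ) (hL : Lᵀ * L = 1)
    (A : Finset (Fin p)) (hA : 1 ≤ A.card) :
    ∫⁻ W, ENNReal.ofReal (projSq L A W - Tsum β p r A.card) ∂(gaussianMatrix n p)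
      ≤ ENNReal.ofReal (3 * r * Real.exp (-(A.card * (β / 2) * ell p A.card))) := by
  set k := A.card with hk
  have hkp : k ≤ p := by simpa using A.card_le_univ
  have hl := one_le_ell hA hkp
  have hk1 : (1 : ℝ) ≤ k := by exact_mod_cast hA
  have hr1 : (1 : ℝ) ≤ r := by exact_mod_cast hr
  have hbl : 1 ≤ β / 2 * ell p k := by nlinarith
  set x := k * (β / 2) * ell p k with hx
  have hx0 : 0 < x := by rw [hx]; nlinarith
  refine (lintegral_excess L hL A (by omega) (by omega) hx0 (t := Tsum β p r A.card) ?_).trans ?_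
  · refine le_trans (le_of_eq ?_) (mul_tpen_le_Tsum hβ hkp)
    rw [← hk]
    have h1 : (k * r : ℝ) * x = (k : ℝ) ^ 2 * (r * (β / 2) * ell p k) := by rw [hx]; ring
    have h2 : √(2 * r * β * ell p k) = 2 * √(r * (β / 2) * ell p k) := by
      rw [show 2 * r * β * ell p k = 2 ^ 2 * (r * (β / 2) * ell p k) by ring,
        Real.sqrt_mul (by positivity), Real.sqrt_sq (by norm_num)]
    unfold tpen
    change _ = (k : ℝ) * (r + √(2 * r * β * ell p k) + β * ell p k)
    rw [h1, Real.sqrt_mul (by positivity), Real.sqrt_sq (by positivity), h2, hx]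
    ring
  · apply ENNReal.ofReal_le_ofReal
    refine mul_le_mul_of_nonneg_right ?_ (Real.exp_pos _).le
    rw [← hk]
    have h3 : √(k * r / x) ≤ r := by
      rw [Real.sqrt_le_left (by positivity), div_le_iff₀ hx0, hx]
      have e1 : (k : ℝ) * r ≤ k * r * (β / 2 * ell p k) :=
        le_mul_of_one_le_right (by positivity) hbl
      have e2 : (k * r * (β / 2 * ell p k) : ℝ) ≤ r * (k * r * (β / 2 * ell p k)) :=
        le_mul_of_one_le_left (by positivity) hr1
      nlinarith
    linarith

lemma lintegral_excess_total {β : ℝ} (hβ : 2 < β) {n p r : ℕ} (hr : 1 ≤ r)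
    (L : Matrix (Fin n) (Fin r) ℝ) (hL : Lᵀ * L = 1) :
    ∫⁻ W, ∑ A : Finset (Fin p), ENNReal.ofReal (projSq L A W - Tsum β p r A.card)
        ∂(gaussianMatrix n p)
      ≤ ENNReal.ofReal (3 * r * gconst β) := by
  classical
  rw [lintegral_finsetSum _ (fun A _ => by unfold projSq; fun_prop)]
  have h1 : ∀ A : Finset (Fin p),
      ∫⁻ W, ENNReal.ofReal (projSq L A W - Tsum β p r A.card) ∂(gaussianMatrix n p)
      ≤ ENNReal.ofReal (if A.card = 0 then 0 else
          3 * r * Real.exp (-(A.card * (β / 2) * ell p A.card))) := by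
    intro A
    split_ifs with h
    · rw [Finset.card_eq_zero] at h
      subst h
      simp [projSq, Tsum]
    · exact lintegral_excess_pen hβ hr L hL A (by omega)
  refine (Finset.sum_le_sum fun A _ => h1 A).trans ?_
  rw [← ENNReal.ofReal_sum_of_nonneg (fun A _ => by split_ifs <;> positivity)]
  apply ENNReal.ofReal_le_ofReal
  have h2 := Finset.sum_powerset_apply_card (fun k => if k = 0 then (0 : ℝ) else
          3 * r * Real.exp (-(k * (β / 2) * ell p k))) (x := (Finset.univ : Finset (Fin p)))
  rw [Finset.powerset_univ] at h2
  rw [h2]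
  have h3 : ∀ k ∈ Finset.range ((Finset.univ : Finset (Fin p)).card + 1),
      (Finset.univ : Finset (Fin p)).card.choose k • (if k = 0 then (0 : ℝ) else
          3 * r * Real.exp (-(k * (β / 2) * ell p k)))
      ≤ 3 * r * (Real.exp (-(β / 2 - 1))) ^ k := by
    intro k hk
    simp only [Finset.card_univ, Fintype.card_fin, Finset.mem_range] at hk ⊢
    split_ifs with h0
    · simp; positivity
    · have hk1 : 1 ≤ k := by omega
      have hkp : k ≤ p := by omega
      rw [nsmul_eq_mul]
      have hc := choose_le_exp_ell hk1 hkp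
      have hl := one_le_ell hk1 hkp
      rw [← Real.exp_nat_mul]
      calc (p.choose k : ℝ) * (3 * r * Real.exp (-(k * (β / 2) * ell p k)))
          ≤ Real.exp (k * ell p k) * (3 * r * Real.exp (-(k * (β / 2) * ell p k))) := by gcongr
        _ = 3 * r * Real.exp (-((β / 2 - 1) * k * ell p k)) := by
            rw [mul_left_comm, ← Real.exp_add]; congr 2; ring
        _ ≤ _ := by
            gcongr
            have : 0 ≤ (β / 2 - 1) * (k : ℝ) := by
              have : (0 : ℝ) ≤ k := k.cast_nonneg
              nlinarith
            nlinarith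
  refine (Finset.sum_le_sum h3).trans ?_
  rw [← Finset.mul_sum]
  refine mul_le_mul_of_nonneg_left ?_ (by positivity)
  refine Summable.sum_le_tsum _ (fun _ _ => by positivity) ?_
  exact summable_geometric_of_lt_one (by positivity) (by rw [Real.exp_lt_one_iff]; linarith)

lemma isGaussian_pi {ι : Type*} [Fintype ι] {E : Type*} [NormedAddCommGroup E] [NormedSpace ℝ E]
    [MeasurableSpace E] [BorelSpace E] [SecondCountableTopology E] [CompleteSpace E]
    (μ : Measure E) [IsGaussian μ] :
    IsGaussian (Measure.pi fun _ : ι => μ) := by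
  have h := iIndepFun.hasGaussianLaw (P := Measure.pi fun _ : ι => μ)
    (X := fun i x => x i) (fun i => ⟨by
      rw [(measurePreserving_eval (fun _ : ι => μ) i).map_eq]; infer_instance⟩)
    (iIndepFun_pi (μ := fun _ : ι => μ) (X := fun _ x => x) (fun _ => aemeasurable_id))
  have h2 := h.isGaussian_map
  exact (Measure.map_id (μ := Measure.pi fun _ : ι => μ)) ▸ h2

instance isGaussian_gaussianMatrix (n m : ℕ) : IsGaussian (gaussianMatrix n m) := by
  unfold gaussianMatrix
  have : IsGaussian (stdGaussian (Fin m)) := isGaussian_pi _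
  exact isGaussian_pi _

lemma integral_id_gaussianMatrix (n m : ℕ) : (gaussianMatrix n m)[id] = 0 := by
  have hI : Integrable (fun x => x) (gaussianMatrix n m) := IsGaussian.integrable_id
  ext i j
  have h1 : (∫ x, x ∂(gaussianMatrix n m)) i j = ∫ x, x i j ∂(gaussianMatrix n m) := by
    rw [eval_integral (fun k => Integrable.eval hI k),
      eval_integral (fun k => Integrable.eval (Integrable.eval hI i) k)]
  have h2 : ∫ x, x i j ∂(gaussianMatrix n m) = ∫ y, y j ∂(stdGaussian (Fin m)) := by
    unfold gaussianMatrix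
    exact integral_comp_eval (μ := fun _ : Fin n => stdGaussian (Fin m)) (i := i)
      (f := fun y => y j) (measurable_pi_apply j).aestronglyMeasurable
  have h3 : ∫ y, y j ∂(stdGaussian (Fin m)) = ∫ y, y ∂(gaussianReal 0 1) := by
    unfold stdGaussian
    exact integral_comp_eval (μ := fun _ : Fin m => gaussianReal 0 1) (i := j)
      (f := fun y => y) (by fun_prop)
  simp only [id]
  rw [h1, h2, h3]
  simp

/-- The rotation `(a,b) ↦ ((a+b)/√2, (a-b)/√2)`. -/
def rotE (E : Type*) [NormedAddCommGroup E] [NormedSpace ℝ E] [MeasurableSpace E] [BorelSpace E]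
    [SecondCountableTopology E] : (E × E) ≃ᵐ (E × E) where
  toFun x := ((√2)⁻¹ • (x.1 + x.2), (√2)⁻¹ • (x.1 - x.2))
  invFun x := ((√2)⁻¹ • (x.1 + x.2), (√2)⁻¹ • (x.1 - x.2))
  left_inv x := by
    have h : (√2)⁻¹ * (√2)⁻¹ * 2 = (1 : ℝ) := by
      rw [← mul_inv, Real.mul_self_sqrt (by norm_num)]; norm_num
    ext
    · simp only [smul_add, smul_sub, smul_smul]
      rw [add_add_sub_cancel, ← two_smul ℝ, smul_smul, mul_comm 2, h, one_smul]
    · simp only [smul_add, smul_sub, smul_smul]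
      rw [add_sub_sub_cancel, ← two_smul ℝ, smul_smul, mul_comm 2, h, one_smul]
  right_inv x := by
    have h : (√2)⁻¹ * (√2)⁻¹ * 2 = (1 : ℝ) := by
      rw [← mul_inv, Real.mul_self_sqrt (by norm_num)]; norm_num
    ext
    · simp only [smul_add, smul_sub, smul_smul]
      rw [add_add_sub_cancel, ← two_smul ℝ, smul_smul, mul_comm 2, h, one_smul]
    · simp only [smul_add, smul_sub, smul_smul]
      rw [add_sub_sub_cancel, ← two_smul ℝ, smul_smul, mul_comm 2, h, one_smul]
  measurable_toFun := by simp only [Equiv.coe_fn_mk]; fun_prop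
  measurable_invFun := by simp only [Equiv.coe_fn_symm_mk]; fun_prop

lemma measurePreserving_rotE {E : Type*} [NormedAddCommGroup E] [NormedSpace ℝ E]
    [MeasurableSpace E] [BorelSpace E] [SecondCountableTopology E] [CompleteSpace E]
    (μ : Measure E) [IsGaussian μ] (h : μ[id] = 0) :
    MeasurePreserving (rotE E) (μ.prod μ) (μ.prod μ) := by
  have h1 : MeasurePreserving (ContinuousLinearMap.rotation (E := E) (-(π / 4)))
      (μ.prod μ) (μ.prod μ) :=
    ⟨by fun_prop, IsGaussian.map_rotation_eq_self h _⟩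
  have h2 := (Measure.measurePreserving_swap (μ := μ) (ν := μ)).comp h1
  have h3 : (rotE E : E × E → E × E) = Prod.swap ∘ (ContinuousLinearMap.rotation (-(π / 4))) := by
    funext x
    have hs : (√2 : ℝ) / 2 = (√2)⁻¹ := by
      rw [Real.sqrt_div_self', one_div]
    ext <;> simp [rotE, ContinuousLinearMap.rotation_apply, hs, smul_add, sub_eq_add_neg]
  rw [h3]
  exact h2

/-- the change of variables on the sample space -/
def rotW (n p r : ℕ) : (((Fin n → Fin r → ℝ) × (Fin n → Fin p → ℝ)) × (Fin n → Fin p → ℝ)) ≃ᵐ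
    (((Fin n → Fin r → ℝ) × (Fin n → Fin p → ℝ)) × (Fin n → Fin p → ℝ)) :=
  (MeasurableEquiv.prodAssoc.trans
    ((MeasurableEquiv.refl _).prodCongr (rotE (Fin n → Fin p → ℝ)))).trans
      MeasurableEquiv.prodAssoc.symm

lemma measurePreserving_rotW (n p r : ℕ) :
    MeasurePreserving (rotW n p r) (reductionMeasure n p r) (reductionMeasure n p r) := by
  have h1 := measurePreserving_prodAssoc (gaussianMatrix n r) (gaussianMatrix n p)
    (gaussianMatrix n p)
  have h2 := (MeasurePreserving.id (gaussianMatrix n r)).prod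
    (measurePreserving_rotE (gaussianMatrix n p) (integral_id_gaussianMatrix n p))
  exact (h1.symm _).comp (h2.comp h1)

lemma rotW_apply (n p r : ℕ) (u : Fin n → Fin r → ℝ) (a b : Fin n → Fin p → ℝ) :
    rotW n p r ((u, a), b) = ((u, (√2)⁻¹ • (a + b)), (√2)⁻¹ • (a - b)) := rfl

instance instProbRed (n p r : ℕ) : IsProbabilityMeasure (reductionMeasure n p r) := by
  unfold reductionMeasure; infer_instance

/-- `UDVᵀ` -/
def sig {n p r : ℕ} (Λ : Fin r → ℝ) (V : Matrix (Fin p) (Fin r) ℝ) (u : Fin n → Fin r → ℝ) :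
    Matrix (Fin n) (Fin p) ℝ :=
  Matrix.of u * Matrix.diagonal (fun k => √(Λ k)) * Vᵀ

lemma sig_apply {n p r : ℕ} (Λ : Fin r → ℝ) (V : Matrix (Fin p) (Fin r) ℝ) (u : Fin n → Fin r → ℝ)
    (i : Fin n) (j : Fin p) : sig Λ V u i j = ∑ k, u i k * √(Λ k) * V j k := by
  rw [sig, Matrix.mul_apply]; simp [Matrix.mul_diagonal]

lemma X0w_rot {n p r : ℕ} (Λ : Fin r → ℝ) (V : Matrix (Fin p) (Fin r) ℝ)
    (u : Fin n → Fin r → ℝ) (a b : Fin n → Fin p → ℝ) :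
    X0w Λ V (rotW n p r ((u, a), b)) = sig Λ V u + √2 • Matrix.of a := by
  rw [rotW_apply]
  ext i j
  have hs : (√2)⁻¹ * 2 = √2 := by
    rw [inv_mul_eq_div, Real.div_sqrt]
  simp only [X0w, sig_apply, Matrix.of_apply, Matrix.add_apply, Matrix.smul_apply, Pi.smul_apply, Pi.add_apply, Pi.sub_apply, smul_eq_mul,
    Matrix.transpose_apply]
  linear_combination (a i j) * hs

lemma X1w_rot {n p r : ℕ} (Λ : Fin r → ℝ) (V : Matrix (Fin p) (Fin r) ℝ)
    (u : Fin n → Fin r → ℝ) (a b : Fin n → Fin p → ℝ) :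
    X1w Λ V (rotW n p r ((u, a), b)) = sig Λ V u + √2 • Matrix.of b := by
  rw [rotW_apply]
  ext i j
  have hs : (√2)⁻¹ * 2 = √2 := by
    rw [inv_mul_eq_div, Real.div_sqrt]
  simp only [X1w, sig_apply, Matrix.of_apply, Matrix.add_apply, Matrix.smul_apply, Pi.smul_apply, Pi.add_apply, Pi.sub_apply, smul_eq_mul,
    Matrix.transpose_apply]
  linear_combination (b i j) * hs

lemma frobSq_nonneg {m k : Type*} [Fintype m] [Fintype k] (A : Matrix m k ℝ) : 0 ≤ frobSq A :=
  Finset.sum_nonneg fun _ _ => Finset.sum_nonneg fun _ _ => sq_nonneg _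

lemma frobSq_eq_trace {m k : Type*} [Fintype m] [Fintype k] (A : Matrix m k ℝ) :
    frobSq A = (Aᵀ * A).trace := by
  rw [frobSq, Finset.sum_comm]
  simp [Matrix.trace, Matrix.mul_apply, sq]

lemma frobSq_sub_proj {p r k : ℕ} (Q : Matrix (Fin p) (Fin r) ℝ) (hQ : Qᵀ * Q = 1)
    (A : Matrix (Fin p) (Fin k) ℝ) :
    frobSq (A - Q * Qᵀ * A) = frobSq A - frobSq (Qᵀ * A) := by
  simp only [frobSq_eq_trace, Matrix.transpose_sub, Matrix.transpose_mul, Matrix.transpose_transpose]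
  have : (Aᵀ - Aᵀ * (Q * Qᵀ)) * (A - Q * Qᵀ * A) =
      Aᵀ * A - Aᵀ * Q * (Qᵀ * A) - (Aᵀ * Q * (Qᵀ * A) - Aᵀ * Q * (Qᵀ * Q) * (Qᵀ * A)) := by
    simp only [Matrix.sub_mul, Matrix.mul_sub, Matrix.mul_assoc]
  rw [this, hQ, Matrix.mul_one, sub_self, sub_zero, Matrix.trace_sub]

lemma loss_eq {p r : ℕ} (Q V : Matrix (Fin p) (Fin r) ℝ) (hQ : Qᵀ * Q = 1) (hV : Vᵀ * V = 1) :
    loss Q V = 2 * r - 2 * frobSq (Qᵀ * V) := by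
  simp only [loss, frobSq_eq_trace, Matrix.transpose_sub, Matrix.transpose_mul,
    Matrix.transpose_transpose]
  have : (Q * Qᵀ - V * Vᵀ) * (Q * Qᵀ - V * Vᵀ) =
      Q * (Qᵀ * Q) * Qᵀ - Q * (Qᵀ * V * Vᵀ) - V * (Vᵀ * Q * Qᵀ) + V * (Vᵀ * V) * Vᵀ := by
    simp only [Matrix.sub_mul, Matrix.mul_sub, Matrix.mul_assoc]; abel
  rw [this, hQ, hV]
  simp only [Matrix.mul_one, Matrix.trace_add, Matrix.trace_sub]
  rw [Matrix.trace_mul_comm Q Qᵀ, Matrix.trace_mul_comm V Vᵀ, hQ, hV]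
  have e1 : (V * (Vᵀ * Q * Qᵀ)).trace = (Vᵀ * Q * (Qᵀ * V)).trace := by
    rw [Matrix.trace_mul_comm V, Matrix.mul_assoc]
  have e2 : (Q * (Qᵀ * V * Vᵀ)).trace = (Vᵀ * Q * (Qᵀ * V)).trace := by
    rw [← Matrix.mul_assoc, Matrix.trace_mul_comm, ← Matrix.mul_assoc]
  rw [e1, e2]
  simp only [Matrix.trace_one, Fintype.card_fin]
  ring

lemma loss_eq' {p r : ℕ} (Q V : Matrix (Fin p) (Fin r) ℝ) (hQ : Qᵀ * Q = 1) (hV : Vᵀ * V = 1) :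
    loss Q V = 2 * frobSq (V - Q * Qᵀ * V) := by
  rw [loss_eq Q V hQ hV, frobSq_sub_proj Q hQ, frobSq_eq_trace V, hV]
  simp; ring

lemma loss_nonneg {p r : ℕ} (Q V : Matrix (Fin p) (Fin r) ℝ) : 0 ≤ loss Q V := frobSq_nonneg _

lemma loss_le_r {p r : ℕ} (Q V : Matrix (Fin p) (Fin r) ℝ) (hQ : Qᵀ * Q = 1) (hV : Vᵀ * V = 1) :
    loss Q V ≤ 2 * r := by
  rw [loss_eq Q V hQ hV]; linarith [frobSq_nonneg (Qᵀ * V)]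

lemma loss_le_pr {p r : ℕ} (Q V : Matrix (Fin p) (Fin r) ℝ) (hQ : Qᵀ * Q = 1) (hV : Vᵀ * V = 1) :
    loss Q V ≤ 2 * ((p : ℝ) - r) := by
  rw [loss_eq Q V hQ hV]
  have h1 := frobSq_nonneg ((1 - V * Vᵀ) - Q * Qᵀ * (1 - V * Vᵀ))
  rw [frobSq_sub_proj Q hQ] at h1
  have e1 : frobSq (1 - V * Vᵀ) = p - r := by
    have := frobSq_sub_proj V hV (1 : Matrix (Fin p) (Fin p) ℝ)
    rw [Matrix.mul_one, Matrix.mul_one] at this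
    rw [this, frobSq_eq_trace, frobSq_eq_trace, Matrix.transpose_transpose,
      Matrix.trace_mul_comm V Vᵀ, hV]
    simp
  have e2 : frobSq (Qᵀ * (1 - V * Vᵀ)) = r - frobSq (Qᵀ * V) := by
    have h3 : frobSq (Qᵀ * (1 - V * Vᵀ)) = frobSq (Q - V * Vᵀ * Q) := by
      have : (Qᵀ * (1 - V * Vᵀ)) = (Q - V * Vᵀ * Q)ᵀ := by
        simp [Matrix.mul_sub, Matrix.mul_assoc]
      rw [this]
      unfold frobSq
      rw [Finset.sum_comm]; rfl
    rw [h3, frobSq_sub_proj V hV, frobSq_eq_trace Q, hQ]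
    have : frobSq (Vᵀ * Q) = frobSq (Qᵀ * V) := by
      have : (Qᵀ * V) = (Vᵀ * Q)ᵀ := by simp
      rw [this]; unfold frobSq; rw [Finset.sum_comm]; rfl
    rw [this]; simp
  rw [e1, e2] at h1
  linarith

lemma exists_qr {p r : ℕ} (hrp : r ≤ p) (T : Matrix (Fin p) (Fin r) ℝ) :
    ∃ Q : Matrix (Fin p) (Fin r) ℝ, IsOrthonormalCols Q ∧ ∃ Rt : Matrix (Fin r) (Fin r) ℝ,
      (∀ i j : Fin r, j < i → Rt i j = 0) ∧ T = Q * Rt := by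
  let f : Fin p → EuclideanSpace ℝ (Fin p) := fun j =>
    if h : (j : ℕ) < r then WithLp.toLp 2 (fun i => T i ⟨j, h⟩) else 0
  let b := InnerProductSpace.gramSchmidtOrthonormalBasis (𝕜 := ℝ)
    (E := EuclideanSpace ℝ (Fin p)) (ι := Fin p) (by simp) f
  have hz : ∀ i j : Fin p, j < i → inner ℝ (b i) (f j) = 0 := fun i j hij =>
    InnerProductSpace.gramSchmidtOrthonormalBasis_inv_triangular (by simp) f hij
  let c : Fin r → Fin p := Fin.castLE hrp
  refine ⟨Matrix.of fun i j => b (c j) i, ?_, Matrix.of fun i j => inner ℝ (b (c i)) (f (c j)),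
    ?_, ?_⟩
  · ext i j
    have := orthonormal_iff_ite.1 b.orthonormal (c i) (c j)
    rw [Matrix.mul_apply, Matrix.one_apply]
    simp only [Matrix.transpose_apply, Matrix.of_apply]
    have h2 : (c i = c j) ↔ i = j := (Fin.castLE_injective hrp).eq_iff
    simp only [h2] at this
    rw [← this]
    simp [PiLp.inner_apply, mul_comm]
  · intro i j hij
    exact hz _ _ (by simpa [c] using hij)
  · ext i j
    have h1 := b.sum_repr' (f (c j))
    have h2 : f (c j) i = T i j := by
      simp [f, c]
    rw [← h2, ← h1]
    rw [Matrix.mul_apply]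
    simp only [Matrix.of_apply, WithLp.ofLp_sum, Finset.sum_apply, WithLp.ofLp_smul, Pi.smul_apply,
      smul_eq_mul]
    symm
    rw [← Finset.sum_image (s := Finset.univ) (g := c)
      (f := fun k => b k i * inner ℝ (b k) (f (c j))) (fun x _ y _ h => Fin.castLE_injective hrp h)]
    rw [← Finset.sum_subset (Finset.subset_univ (Finset.univ.image c))]
    · exact Finset.sum_congr rfl fun k _ => mul_comm _ _
    · intro k _ hk
      rw [hz, zero_mul]
      have : r ≤ k := by
        by_contra hlt
        push Not at hlt
        exact hk (Finset.mem_image.2 ⟨⟨k, hlt⟩, Finset.mem_univ _, by ext; simp [c]⟩)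
      exact Fin.lt_def.2 (lt_of_lt_of_le j.2 this)

lemma orthonormalize_spec {p r : ℕ} (hrp : r ≤ p) (T : Matrix (Fin p) (Fin r) ℝ) :
    IsOrthonormalCols (orthonormalize T) ∧ ∃ Rt : Matrix (Fin r) (Fin r) ℝ,
      (∀ i j : Fin r, j < i → Rt i j = 0) ∧ T = orthonormalize T * Rt :=
  Classical.epsilon_spec (exists_qr hrp T)

/-- Euclidean norm of a coordinate vector. -/
def nrm {ι : Type*} [Fintype ι] (v : ι → ℝ) : ℝ := √(∑ i, v i ^ 2)

lemma nrm_eq {ι : Type*} [Fintype ι] (v : ι → ℝ) : nrm v = ‖WithLp.toLp 2 v‖ := by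
  rw [EuclideanSpace.norm_eq]; simp [nrm]

lemma nrm_nonneg {ι : Type*} [Fintype ι] (v : ι → ℝ) : 0 ≤ nrm v := Real.sqrt_nonneg _

lemma nrm_sq {ι : Type*} [Fintype ι] (v : ι → ℝ) : nrm v ^ 2 = ∑ i, v i ^ 2 :=
  Real.sq_sqrt (Finset.sum_nonneg fun _ _ => sq_nonneg _)

lemma nrm_add_le {ι : Type*} [Fintype ι] (v w : ι → ℝ) : nrm (v + w) ≤ nrm v + nrm w := by
  simp only [nrm_eq, WithLp.toLp_add]; exact norm_add_le _ _

lemma nrm_sub_le {ι : Type*} [Fintype ι] (v w : ι → ℝ) : nrm v - nrm w ≤ nrm (v - w) := by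
  simp only [nrm_eq, WithLp.toLp_sub]; exact norm_sub_norm_le _ _

lemma nrm_le_add {ι : Type*} [Fintype ι] (v w : ι → ℝ) : nrm v - nrm w ≤ nrm (v + w) := by
  have h := nrm_sub_le (v + w) w
  have h2 := nrm_add_le (v + w) (-w)
  have h3 : nrm (-w) = nrm w := by simp [nrm]
  rw [add_neg_cancel_right, h3] at h2; linarith

lemma nrm_smul {ι : Type*} [Fintype ι] (c : ℝ) (v : ι → ℝ) : nrm (c • v) = |c| * nrm v := by
  simp only [nrm_eq, WithLp.toLp_smul, norm_smul, Real.norm_eq_abs]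

lemma nrm_eq_zero {ι : Type*} [Fintype ι] {v : ι → ℝ} : nrm v = 0 ↔ v = 0 := by
  rw [nrm_eq, norm_eq_zero]
  constructor
  · intro h; have := congrArg WithLp.ofLp h; simpa using this
  · rintro rfl; simp

lemma nrm_zero {ι : Type*} [Fintype ι] : nrm (0 : ι → ℝ) = 0 := nrm_eq_zero.2 rfl

lemma nrm_dot {ι : Type*} [Fintype ι] (v : ι → ℝ) : nrm v ^ 2 = v ⬝ᵥ v := by
  rw [nrm_sq]; simp [dotProduct, sq]

lemma nrm_orth {ι κ : Type*} [Fintype ι] [Fintype κ] [DecidableEq κ] (L : Matrix ι κ ℝ)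
    (hL : Lᵀ * L = 1) (v : κ → ℝ) :
    nrm (L *ᵥ v) = nrm v := by
  have : nrm (L *ᵥ v) ^ 2 = nrm v ^ 2 := by
    rw [nrm_dot, nrm_dot, Matrix.dotProduct_mulVec, Matrix.vecMul_mulVec, hL, Matrix.vecMul_one]
  exact (pow_left_inj₀ (nrm_nonneg _) (nrm_nonneg _) two_ne_zero).1 this

lemma nrm_orth_transpose {ι κ : Type*} [Fintype ι] [Fintype κ] [DecidableEq κ] (L : Matrix ι κ ℝ)
    (hL : Lᵀ * L = 1) (w : ι → ℝ) :
    nrm (Lᵀ *ᵥ w) ≤ nrm w := by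
  have h1 : nrm (w - L *ᵥ (Lᵀ *ᵥ w)) ^ 2 = nrm w ^ 2 - nrm (Lᵀ *ᵥ w) ^ 2 := by
    have e : (L *ᵥ (Lᵀ *ᵥ w)) ⬝ᵥ (L *ᵥ (Lᵀ *ᵥ w)) = nrm (Lᵀ *ᵥ w) ^ 2 := by
      rw [← nrm_dot, nrm_orth L hL]
    have e2 : w ⬝ᵥ (L *ᵥ (Lᵀ *ᵥ w)) = nrm (Lᵀ *ᵥ w) ^ 2 := by
      rw [nrm_dot, Matrix.dotProduct_mulVec, Matrix.mulVec_transpose]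
    rw [nrm_dot, sub_dotProduct, dotProduct_sub, dotProduct_sub, e, e2, dotProduct_comm (L *ᵥ (Lᵀ *ᵥ w)) w, e2,
      ← nrm_dot]
    ring
  nlinarith [sq_nonneg (nrm (w - L *ᵥ (Lᵀ *ᵥ w))), nrm_nonneg w, nrm_nonneg (Lᵀ *ᵥ w)]

lemma exists_svd {n r : ℕ} (B : Matrix (Fin n) (Fin r) ℝ) (hB : ∀ v, B *ᵥ v = 0 → v = 0) :
    ∃ CR : Matrix (Fin r) (Fin r) ℝ × Matrix (Fin r) (Fin r) ℝ, ∃ L, IsThinSVD B L CR.1 CR.2 := by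
  have hP : (Bᵀ * B).PosDef := by
    refine Matrix.PosDef.of_dotProduct_mulVec_pos ?_ ?_
    · simp [Matrix.IsHermitian]
    · intro x hx
      have h1 : star x ⬝ᵥ (Bᵀ * B) *ᵥ x = nrm (B *ᵥ x) ^ 2 := by
        rw [nrm_dot, Matrix.dotProduct_mulVec (B *ᵥ x), Matrix.vecMul_mulVec,
          Matrix.dotProduct_mulVec]; simp
      rw [h1]
      have : nrm (B *ᵥ x) ≠ 0 := fun h => hx (hB x (nrm_eq_zero.1 h))
      positivity
  have hH := hP.isHermitian
  set d := hH.eigenvalues with hd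
  have hdpos : ∀ i, 0 < d i := hP.eigenvalues_pos
  set R : Matrix (Fin r) (Fin r) ℝ := (hH.eigenvectorUnitary : Matrix (Fin r) (Fin r) ℝ) with hR
  have hRR : Rᵀ * R = 1 := by
    have := Unitary.coe_star_mul_self hH.eigenvectorUnitary
    simpa [Matrix.star_eq_conjTranspose] using this
  have hRR' : R * Rᵀ = 1 := by
    have := Unitary.coe_mul_star_self hH.eigenvectorUnitary
    simpa [Matrix.star_eq_conjTranspose] using this
  have hspec : Rᵀ * (Bᵀ * B) * R = Matrix.diagonal d := by
    have := hH.conjStarAlgAut_star_eigenvectorUnitary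
    rw [Unitary.conjStarAlgAut_apply] at this
    simpa [Matrix.star_eq_conjTranspose, Function.comp_def] using this
  refine ⟨(Matrix.diagonal fun i => √(d i), R),
    B * R * Matrix.diagonal (fun i => (√(d i))⁻¹), ?_, ?_, hRR, fun i => √(d i),
      fun i => Real.sqrt_nonneg _, rfl⟩
  · have : Matrix.diagonal (fun i => (√(d i))⁻¹) * Matrix.diagonal (fun i => √(d i)) = 1 := by
      rw [Matrix.diagonal_mul_diagonal, ← Matrix.diagonal_one]
      congr 1; funext i
      exact inv_mul_cancel₀ (Real.sqrt_pos.2 (hdpos i)).ne'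
    rw [Matrix.mul_assoc (B * R), this, Matrix.mul_one, Matrix.mul_assoc, hRR', Matrix.mul_one]
  · have : (B * R * Matrix.diagonal (fun i => (√(d i))⁻¹))ᵀ *
        (B * R * Matrix.diagonal (fun i => (√(d i))⁻¹)) =
        Matrix.diagonal (fun i => (√(d i))⁻¹) * (Rᵀ * (Bᵀ * B) * R) *
          Matrix.diagonal (fun i => (√(d i))⁻¹) := by
      simp only [Matrix.transpose_mul, Matrix.diagonal_transpose, Matrix.mul_assoc]
    rw [this, hspec, Matrix.diagonal_mul_diagonal, Matrix.diagonal_mul_diagonal,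
      ← Matrix.diagonal_one]
    congr 1; funext i
    have h0 := (Real.sqrt_pos.2 (hdpos i)).ne'
    have h2 := Real.mul_self_sqrt (hdpos i).le
    field_simp
    nlinarith

lemma svd_spec {n r : ℕ} (B : Matrix (Fin n) (Fin r) ℝ) (hB : ∀ v, B *ᵥ v = 0 → v = 0) :
    ∃ L : Matrix (Fin n) (Fin r) ℝ, ∃ K : Matrix (Fin r) (Fin r) ℝ, Lᵀ * L = 1 ∧
      B * (svdCR B).2 * (svdCR B).1⁻¹ = L ∧ B = L * K := by
  obtain ⟨L, h1, h2, h3, d, hd0, hC⟩ : ∃ L, IsThinSVD B L (svdCR B).1 (svdCR B).2 :=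
    Classical.epsilon_spec (exists_svd B hB)
  refine ⟨L, (svdCR B).1 * (svdCR B).2ᵀ, h2, ?_, by rw [← Matrix.mul_assoc]; exact h1⟩
  generalize (svdCR B).1 = C at *
  generalize (svdCR B).2 = R at *
  have hBR : B * R = L * C := by rw [h1, Matrix.mul_assoc, h3, Matrix.mul_one]
  have hdne : ∀ i, d i ≠ 0 := by
    intro i hi
    have h4 : B *ᵥ (R *ᵥ Pi.single i 1) = 0 := by
      rw [Matrix.mulVec_mulVec, hBR, ← Matrix.mulVec_mulVec, hC]
      have : Matrix.diagonal d *ᵥ Pi.single i 1 = 0 := by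
        ext j; simp [hi]
      rw [this, Matrix.mulVec_zero]
    have h5 := hB _ h4
    have h6 : nrm (R *ᵥ Pi.single i 1) = nrm (Pi.single i (1 : ℝ)) := nrm_orth R h3 _
    rw [h5, nrm_zero] at h6
    have := congrFun (nrm_eq_zero.1 h6.symm) i
    simp at this
  have hdet : IsUnit C.det := by
    rw [hC, Matrix.det_diagonal, isUnit_iff_ne_zero]
    exact Finset.prod_ne_zero_iff.2 fun i _ => hdne i
  rw [hBR, Matrix.mul_assoc, Matrix.mul_nonsing_inv _ hdet, Matrix.mul_one]

lemma sigmaMin_le {r : ℕ} (A : Matrix (Fin r) (Fin r) ℝ) (v : Fin r → ℝ) :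
    sigmaMin A * nrm v ≤ nrm (A *ᵥ v) := by
  by_cases hv : nrm v = 0
  · rw [hv, mul_zero]; exact nrm_nonneg _
  have hpos : 0 < nrm v := lt_of_le_of_ne (nrm_nonneg _) (Ne.symm hv)
  have h1 : sigmaMin A ≤ nrm (A *ᵥ ((nrm v)⁻¹ • v)) := by
    refine csInf_le ⟨0, ?_⟩ ⟨(nrm v)⁻¹ • v, ?_, rfl⟩
    · rintro c ⟨w, _, rfl⟩; exact Real.sqrt_nonneg _
    · rw [← nrm_sq, nrm_smul, abs_of_pos (inv_pos.2 hpos), inv_mul_cancel₀ hv, one_pow]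
  rw [Matrix.mulVec_smul, nrm_smul, abs_of_pos (inv_pos.2 hpos)] at h1
  calc sigmaMin A * nrm v ≤ ((nrm v)⁻¹ * nrm (A *ᵥ v)) * nrm v := by gcongr
    _ = nrm (A *ᵥ v) := by field_simp

lemma nrm_diag_ge {r : ℕ} (Λ : Fin r → ℝ) {lam : ℝ} (hlam : 0 ≤ lam) (h : ∀ i, lam ≤ Λ i)
    (v : Fin r → ℝ) :
    √lam * nrm v ≤ nrm (Matrix.diagonal (fun i => √(Λ i)) *ᵥ v) := by
  unfold nrm
  rw [← Real.sqrt_mul hlam]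
  apply Real.sqrt_le_sqrt
  rw [Finset.mul_sum]
  apply Finset.sum_le_sum
  intro i _
  rw [Matrix.mulVec_diagonal, mul_pow, Real.sq_sqrt (hlam.trans (h i))]
  exact mul_le_mul_of_nonneg_right (h i) (sq_nonneg _)

lemma good_det {n p r k : ℕ} (Λ : Fin r → ℝ) (V V0 : Matrix (Fin p) (Fin r) ℝ)
    (u : Fin n → Fin r → ℝ) (a : Fin n → Fin p → ℝ) {lam α γ : ℝ} (hlam : 0 < lam)
    (hΛ : ∀ i, lam ≤ Λ i) (hα : 0 < α) (hγ : 0 ≤ γ)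
    (hV0 : V0ᵀ * V0 = 1) (hsupp : suppCard V0 ≤ k) (hσ : 1 / 2 ≤ sigmaMin (Vᵀ * V0))
    (hU : ∀ x : Fin r → ℝ, α * nrm x ≤ nrm (Matrix.of u *ᵥ x))
    (hW : ∀ x : Fin p → ℝ, Nat.card {j // x j ≠ 0} ≤ k → nrm (Matrix.of a *ᵥ x) ≤ γ * nrm x)
    (hc : 8 * √2 * γ ≤ α * √lam) :
    ∃ L : Matrix (Fin n) (Fin r) ℝ, Lᵀ * L = 1 ∧
      ((sig Λ V u + √2 • Matrix.of a) * V0) * (svdCR ((sig Λ V u + √2 • Matrix.of a) * V0)).2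
        * (svdCR ((sig Λ V u + √2 • Matrix.of a) * V0)).1⁻¹ = L ∧
      ∀ y, (α / 2) * √lam * nrm y ≤
        nrm ((Lᵀ * Matrix.of u * Matrix.diagonal (fun k => √(Λ k))) *ᵥ y) := by
  set D : Matrix (Fin r) (Fin r) ℝ := Matrix.diagonal (fun k => √(Λ k)) with hD
  set G : Matrix (Fin r) (Fin r) ℝ := D * (Vᵀ * V0) with hG
  set N : Matrix (Fin n) (Fin r) ℝ := √2 • (Matrix.of a * V0) with hN
  set B := (sig Λ V u + √2 • Matrix.of a) * V0 with hBdef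
  have hBe : B = Matrix.of u * G + N := by
    rw [hBdef, sig, Matrix.add_mul, Matrix.smul_mul, hG, hN]
    simp only [Matrix.mul_assoc, hD]
  have hsl : 0 < √lam := Real.sqrt_pos.2 hlam
  have hGl : ∀ v, √lam / 2 * nrm v ≤ nrm (G *ᵥ v) := by
    intro v
    have h1 := sigmaMin_le (Vᵀ * V0) v
    have h2 := nrm_diag_ge Λ hlam.le hΛ ((Vᵀ * V0) *ᵥ v)
    rw [hG, ← Matrix.mulVec_mulVec]
    refine le_trans ?_ h2
    have h3 : 1 / 2 * nrm v ≤ nrm ((Vᵀ * V0) *ᵥ v) :=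
      (mul_le_mul_of_nonneg_right hσ (nrm_nonneg _)).trans h1
    nlinarith
  have hNl : ∀ v, nrm (N *ᵥ v) ≤ √2 * γ * nrm v := by
    intro v
    rw [hN, Matrix.smul_mulVec, nrm_smul, abs_of_nonneg (Real.sqrt_nonneg _),
      ← Matrix.mulVec_mulVec, mul_assoc]
    have h1 : Nat.card {j // (V0 *ᵥ v) j ≠ 0} ≤ k := by
      refine le_trans ?_ hsupp
      unfold suppCard
      refine Nat.card_le_card_of_injective (fun j => ⟨j.1, fun h => j.2 ?_⟩) ?_
      · rw [Matrix.mulVec, h]; simp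
      · intro x y h; exact Subtype.ext (by simpa using h)
    have h2 := hW _ h1
    rw [nrm_orth V0 hV0] at h2
    gcongr
  have hNG : ∀ v, nrm (N *ᵥ v) ≤ α / 4 * nrm (G *ᵥ v) := by
    intro v
    have h1 := hNl v
    have h2 := hGl v
    have h3 : √2 * γ * nrm v ≤ α / 4 * (√lam / 2 * nrm v) := by nlinarith [nrm_nonneg v]
    have h4 : α / 4 * (√lam / 2 * nrm v) ≤ α / 4 * nrm (G *ᵥ v) := by gcongr
    linarith
  have hGinj : ∀ v, G *ᵥ v = 0 → v = 0 := by
    intro v hv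
    have := hGl v
    rw [hv, nrm_zero] at this
    have h0 := nrm_nonneg v
    refine nrm_eq_zero.1 (le_antisymm ?_ h0)
    by_contra hlt
    push Not at hlt
    have : 0 < √lam / 2 * nrm v := by positivity
    linarith
  have hBv : ∀ v, B *ᵥ v = Matrix.of u *ᵥ (G *ᵥ v) + N *ᵥ v := by
    intro v; rw [hBe, Matrix.add_mulVec, Matrix.mulVec_mulVec]
  have hBinj : ∀ v, B *ᵥ v = 0 → v = 0 := by
    intro v hv
    apply hGinj
    have h1 := nrm_le_add (Matrix.of u *ᵥ (G *ᵥ v)) (N *ᵥ v)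
    rw [← hBv, hv, nrm_zero] at h1
    have h2 := hU (G *ᵥ v)
    have h3 := hNG v
    refine nrm_eq_zero.1 (le_antisymm ?_ (nrm_nonneg _))
    by_contra hlt
    push Not at hlt
    nlinarith
  obtain ⟨L, K, hL, hL2, hBK⟩ := svd_spec B hBinj
  refine ⟨L, hL, hL2, ?_⟩
  intro y
  have hsurj : Function.Surjective G.mulVec := by
    have hi : Function.Injective G.mulVecLin := by
      rw [injective_iff_map_eq_zero]; exact hGinj
    exact LinearMap.injective_iff_surjective.1 hi
  obtain ⟨v, hv⟩ := hsurj (D *ᵥ y)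
  change G *ᵥ v = D *ᵥ y at hv
  rw [← Matrix.mulVec_mulVec, ← Matrix.mulVec_mulVec, ← hv]
  have e1 : Lᵀ *ᵥ (Matrix.of u *ᵥ (G *ᵥ v)) = Lᵀ *ᵥ (B *ᵥ v) - Lᵀ *ᵥ (N *ᵥ v) := by
    rw [hBv, Matrix.mulVec_add, add_sub_cancel_right]
  have e2 : nrm (Lᵀ *ᵥ (B *ᵥ v)) = nrm (B *ᵥ v) := by
    rw [hBK, Matrix.mulVec_mulVec, ← Matrix.mul_assoc, hL, Matrix.one_mul, ← Matrix.mulVec_mulVec,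
      nrm_orth L hL]
  have h1 := nrm_sub_le (Lᵀ *ᵥ (B *ᵥ v)) (Lᵀ *ᵥ (N *ᵥ v))
  rw [← e1, e2] at h1
  have h2 := nrm_orth_transpose L hL (N *ᵥ v)
  have h3 := nrm_le_add (Matrix.of u *ᵥ (G *ᵥ v)) (N *ᵥ v)
  rw [← hBv] at h3
  have h4 := hU (G *ᵥ v)
  have h5 := hNG v
  have h6 := nrm_diag_ge Λ hlam.le hΛ y
  rw [← hD, ← hv] at h6
  have h7 : α / 2 * (√lam * nrm y) ≤ α / 2 * nrm (G *ᵥ v) := by gcongr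
  linarith

/-- row-wise lower bound for a product -/
lemma frobSq_mul_ge {p r : ℕ} (A : Matrix (Fin p) (Fin r) ℝ) (M : Matrix (Fin r) (Fin r) ℝ) {m : ℝ}
    (hm : 0 ≤ m) (hM : ∀ y, m * nrm y ≤ nrm (Mᵀ *ᵥ y)) :
    m ^ 2 * frobSq A ≤ frobSq (A * M) := by
  unfold frobSq
  rw [Finset.mul_sum]
  apply Finset.sum_le_sum
  intro i _
  have h := hM (A i)
  have h2 : (m * nrm (A i)) ^ 2 ≤ nrm (Mᵀ *ᵥ (A i)) ^ 2 := by
    have := nrm_nonneg (A i)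
    gcongr
  rw [mul_pow, nrm_sq, nrm_sq] at h2
  refine h2.trans (le_of_eq ?_)
  apply Finset.sum_congr rfl
  intro j _
  rw [Matrix.mul_apply]
  simp [Matrix.mulVec, dotProduct, mul_comm]

lemma loss_orth_le {p r : ℕ} (hrp : r ≤ p) (V T : Matrix (Fin p) (Fin r) ℝ) (hV : Vᵀ * V = 1)
    (M : Matrix (Fin r) (Fin r) ℝ) {m : ℝ}
    (hm : 0 ≤ m) (hM : ∀ y, m * nrm y ≤ nrm (Mᵀ *ᵥ y)) :
    m ^ 2 * loss (orthonormalize T) V ≤ 2 * frobSq (V * M - T) := by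
  obtain ⟨hQ, Rt, -, hT⟩ := orthonormalize_spec hrp T
  set Q := orthonormalize T
  rw [loss_eq' Q V hQ hV]
  have h1 := frobSq_mul_ge (V - Q * Qᵀ * V) M hm hM
  have hQ' : Qᵀ * Q = 1 := hQ
  have h2 : (V - Q * Qᵀ * V) * M = (V * M - T) - Q * Qᵀ * (V * M - T) := by
    have : Q * Qᵀ * T = T := by
      conv_lhs => rw [hT]
      rw [Matrix.mul_assoc, ← Matrix.mul_assoc Qᵀ, hQ', Matrix.one_mul, ← hT]
    rw [Matrix.mul_sub, this, Matrix.sub_mul, Matrix.mul_assoc _ V]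
    abel
  rw [h2, frobSq_sub_proj Q hQ (V * M - T)] at h1
  have h3 := frobSq_nonneg (Qᵀ * (V * M - T))
  linarith

/-- squared Frobenius norm of the rows in `S` -/
def rowSq {p r : ℕ} (A : Matrix (Fin p) (Fin r) ℝ) (S : Finset (Fin p)) : ℝ :=
  ∑ j ∈ S, ∑ i, A j i ^ 2

lemma rowSq_nonneg {p r : ℕ} (A : Matrix (Fin p) (Fin r) ℝ) (S : Finset (Fin p)) :
    0 ≤ rowSq A S := Finset.sum_nonneg fun _ _ => Finset.sum_nonneg fun _ _ => sq_nonneg _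

/-- keep only the rows in `S` -/
def restr {p r : ℕ} (S : Finset (Fin p)) (A : Matrix (Fin p) (Fin r) ℝ) :
    Matrix (Fin p) (Fin r) ℝ := Matrix.of fun j i => if j ∈ S then A j i else 0

/-- the support of a matrix, as a finset of rows -/
def suppF {p r : ℕ} (T : Matrix (Fin p) (Fin r) ℝ) : Finset (Fin p) :=
  by classical exact Finset.univ.filter fun j => T j ≠ 0

lemma suppCard_eq {p r : ℕ} (T : Matrix (Fin p) (Fin r) ℝ) : suppCard T = (suppF T).card := by
  classical
  unfold suppCard suppF
  rw [Nat.card_eq_fintype_card, Fintype.card_subtype]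

lemma not_mem_suppF {p r : ℕ} {T : Matrix (Fin p) (Fin r) ℝ} {j : Fin p} (h : j ∉ suppF T)
    (i : Fin r) : T j i = 0 := by
  classical
  have : T j = 0 := by simpa [suppF] using h
  rw [this]; rfl

lemma suppCard_restr_le {p r : ℕ} (S : Finset (Fin p)) (A : Matrix (Fin p) (Fin r) ℝ) :
    suppCard (restr S A) ≤ S.card := by
  classical
  rw [suppCard_eq]
  apply Finset.card_le_card
  intro j hj
  by_contra h
  have : restr S A j ≠ 0 := by simpa [suppF] using hj
  apply this
  funext i
  simp [restr, h]

lemma pen_eq (β δ : ℝ) (p r k : ℕ) : pen β δ p r k = (1 + δ) ^ 2 * Tsum β p r k := rfl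

lemma pen_mono {β δ : ℝ} {p r j k : ℕ} (hβ : 2 < β) (hjk : j ≤ k) (hkp : k ≤ p) :
    pen β δ p r j ≤ pen β δ p r k := by
  rw [pen_eq, pen_eq]
  exact mul_le_mul_of_nonneg_left (Tsum_mono (by linarith) hjk hkp) (sq_nonneg _)

lemma penEst_spec {β δ : ℝ} {p r : ℕ} (hβ : 2 < β) (Y : Matrix (Fin p) (Fin r) ℝ) :
    ∀ T' : Matrix (Fin p) (Fin r) ℝ,
      frobSq (Y - penEst β δ Y) + pen β δ p r (suppCard (penEst β δ Y)) ≤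
        frobSq (Y - T') + pen β δ p r (suppCard T') := by
  have hex : ∃ T : Matrix (Fin p) (Fin r) ℝ, ∀ T' : Matrix (Fin p) (Fin r) ℝ,
      frobSq (Y - T) + pen β δ p r (suppCard T) ≤
        frobSq (Y - T') + pen β δ p r (suppCard T') := by
    obtain ⟨S, -, hS⟩ := Finset.exists_min_image (Finset.univ : Finset (Finset (Fin p)))
      (fun S => frobSq (Y - restr S Y) + pen β δ p r S.card) ⟨∅, Finset.mem_univ _⟩
    refine ⟨restr S Y, fun T' => ?_⟩
    have h1 : pen β δ p r (suppCard (restr S Y)) ≤ pen β δ p r S.card :=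
      pen_mono hβ (suppCard_restr_le _ _) (by simpa using Finset.card_le_univ S)
    have h2 := hS (suppF T') (Finset.mem_univ _)
    have h3 : frobSq (Y - restr (suppF T') Y) ≤ frobSq (Y - T') := by
      unfold frobSq
      apply Finset.sum_le_sum; intro j _
      apply Finset.sum_le_sum; intro i _
      simp only [Matrix.sub_apply, restr, Matrix.of_apply]
      split_ifs with h
      · rw [sub_self, zero_pow two_ne_zero]; exact sq_nonneg _
      · rw [not_mem_suppF h]
    rw [← suppCard_eq] at h2
    linarith
  exact Classical.epsilon_spec hex

lemma oracle_pointwise {δ : ℝ} (hδ0 : 0 < δ) (hδ1 : δ < 1) (x y e : ℝ) :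
    -x ^ 2 + y ^ 2 + 2 * e * (y - x) ≤ -(δ / 4) * x ^ 2 + (4 / δ) * y ^ 2 + (1 + δ) * e ^ 2 := by
  have h1 : 2 * e * (y - x) ≤ (1 + δ) * e ^ 2 + (y - x) ^ 2 / (1 + δ) := by
    have : (1 + δ) * e ^ 2 + (y - x) ^ 2 / (1 + δ) - 2 * e * (y - x)
        = ((1 + δ) * e - (y - x)) ^ 2 / (1 + δ) := by field_simp; ring
    have h2 : 0 ≤ ((1 + δ) * e - (y - x)) ^ 2 / (1 + δ) := by positivity
    linarith
  have h2 : (y - x) ^ 2 ≤ (1 + δ / 2) * x ^ 2 + (1 + 2 / δ) * y ^ 2 := by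
    have : (1 + δ / 2) * x ^ 2 + (1 + 2 / δ) * y ^ 2 - (y - x) ^ 2 =
      (δ * x + 2 * y) ^ 2 / (2 * δ) := by field_simp; ring
    have h2 : 0 ≤ (δ * x + 2 * y) ^ 2 / (2 * δ) := by positivity
    linarith
  have h3 : (y - x) ^ 2 / (1 + δ) ≤ (1 - δ / 4) * x ^ 2 + (1 + 2 / δ) * y ^ 2 := by
    rw [div_le_iff₀ (by linarith)]
    refine h2.trans ?_
    have a1 : (1 + δ / 2) ≤ (1 - δ / 4) * (1 + δ) := by nlinarith
    have a2 : (1 + 2 / δ) ≤ (1 + 2 / δ) * (1 + δ) := by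
      have : 0 < 2 / δ := by positivity
      nlinarith
    nlinarith [sq_nonneg x, sq_nonneg y]
  have h4 : 2 + 2 / δ ≤ 4 / δ := by
    have : 2 ≤ 2 / δ := by rw [le_div_iff₀ hδ0]; linarith
    have e : 4 / δ = 2 / δ + 2 / δ := by ring
    linarith
  nlinarith [sq_nonneg y]

lemma pen_oracle {β δ : ℝ} {p r : ℕ} (hβ : 2 < β) (hδ0 : 0 < δ) (hδ1 : δ < 1)
    (Th E : Matrix (Fin p) (Fin r) ℝ) (S : Finset (Fin p)) (X : ℝ)
    (hX : ∀ A : Finset (Fin p), rowSq E A - Tsum β p r A.card ≤ X) :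
    frobSq (Th - penEst β δ (Th + E)) ≤
      (4 / δ) * ((4 / δ) * rowSq Th Sᶜ + 4 * X + 6 * Tsum β p r S.card) := by
  classical
  have hmin := penEst_spec (β := β) (δ := δ) hβ (Th + E) (restr S Th)
  set T := penEst β δ (Th + E) with hT
  have h1 : pen β δ p r (suppCard (restr S Th)) ≤ pen β δ p r S.card :=
    pen_mono hβ (suppCard_restr_le _ _) (by simpa using Finset.card_le_univ S)
  rw [suppCard_eq T] at hmin
  have hmain : frobSq (Th + E - restr S Th) - frobSq (Th + E - T) ≤
      -(δ / 4) * frobSq (Th - T) + (4 / δ) * rowSq Th Sᶜ +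
        (1 + δ) * (rowSq E S + rowSq E (suppF T)) := by
    have e1 : ∀ (A : Matrix (Fin p) (Fin r) ℝ) (S : Finset (Fin p)), rowSq A S =
        ∑ j, ∑ i, if j ∈ S then A j i ^ 2 else 0 := by
      intro A S
      unfold rowSq
      rw [← Finset.sum_filter_add_sum_filter_not Finset.univ (fun j => j ∈ S)]
      rw [Finset.sum_congr rfl (g := fun j => ∑ i, A j i ^ 2) (s₁ := Finset.univ.filter (· ∈ S))
        (fun j hj => by simp [(Finset.mem_filter.1 hj).2])]
      rw [Finset.sum_eq_zero (s := Finset.univ.filter (fun j => ¬ j ∈ S))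
        (fun j hj => by simp [(Finset.mem_filter.1 hj).2])]
      simp
    rw [e1, e1, e1]
    unfold frobSq
    simp only [Finset.mul_sum, ← Finset.sum_add_distrib, ← Finset.sum_sub_distrib]
    apply Finset.sum_le_sum; intro j _
    apply Finset.sum_le_sum; intro i _
    simp only [Matrix.sub_apply, Matrix.add_apply, restr, Matrix.of_apply, Finset.mem_compl]
    have hp := oracle_pointwise hδ0 hδ1 (Th j i - T j i)
      (Th j i - if j ∈ S then Th j i else 0) (E j i)
    by_cases hS : j ∈ S
    · simp only [hS, if_true, not_true, if_false] at hp ⊢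
      have : 0 ≤ (1 + δ) * (if j ∈ suppF T then E j i ^ 2 else 0) := by
        split_ifs <;> positivity
      nlinarith
    · simp only [hS, if_false, not_false_eq_true, if_true] at hp ⊢
      by_cases hT2 : j ∈ suppF T
      · simp only [hT2, if_true]; nlinarith
      · simp only [hT2, if_false]
        rw [not_mem_suppF hT2]
        have h4 : 4 ≤ 4 / δ := by rw [le_div_iff₀ hδ0]; linarith
        nlinarith [sq_nonneg (Th j i), mul_nonneg (sub_nonneg.2 h4) (sq_nonneg (Th j i))]
  have hS1 := hX S
  have hT1 := hX (suppF T)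
  have h0 := hX ∅
  have hX0 : 0 ≤ X := by simpa [rowSq, Tsum] using h0
  have hTs : 0 ≤ Tsum β p r S.card :=
    Tsum_nonneg (by linarith) (by simpa using Finset.card_le_univ S)
  have hTt : 0 ≤ Tsum β p r (suppF T).card :=
    Tsum_nonneg (by linarith) (by simpa using Finset.card_le_univ (suppF T))
  rw [pen_eq, pen_eq] at *
  have hfin : δ / 4 * frobSq (Th - T) ≤ (4 / δ) * rowSq Th Sᶜ + 4 * X + 6 * Tsum β p r S.card := by
    have b1 : (1 + δ) * rowSq E S ≤ (1 + δ) * (X + Tsum β p r S.card) := by gcongr; linarith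
    have b2 : (1 + δ) * rowSq E (suppF T) ≤ (1 + δ) * (X + Tsum β p r (suppF T).card) := by
      gcongr; linarith
    have b3 : (1 + δ) * Tsum β p r (suppF T).card ≤ (1 + δ) ^ 2 * Tsum β p r (suppF T).card := by
      gcongr; nlinarith
    have b4 : (1 + δ) ^ 2 * Tsum β p r S.card ≤ 4 * Tsum β p r S.card := by gcongr; nlinarith
    have b5 : (1 + δ) * X ≤ 2 * X := by gcongr; linarith
    have b6 : (1 + δ) * Tsum β p r S.card ≤ 2 * Tsum β p r S.card := by gcongr; linarith
    linarith
  calc frobSq (Th - T) = (4 / δ) * (δ / 4 * frobSq (Th - T)) := by field_simp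
    _ ≤ _ := by gcongr

lemma exists_half_net (E : Type*) [NormedAddCommGroup E] [NormedSpace ℝ E] [FiniteDimensional ℝ E] :
    ∃ N : Finset E, N.card ≤ 5 ^ Module.finrank ℝ E ∧
      ∀ x : E, ‖x‖ ≤ 1 → ∃ y ∈ N, ‖x - y‖ ≤ 1 / 2 := by
  classical
  let P : ℕ → Prop := fun k => ∃ s : Finset E, s.card = k ∧ (∀ c ∈ s, ‖c‖ ≤ 2) ∧
    ∀ c ∈ s, ∀ d ∈ s, c ≠ d → 1 ≤ ‖c - d‖
  have hbd : ∀ k, P k → k ≤ 5 ^ Module.finrank ℝ E := by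
    rintro k ⟨s, rfl, h1, h2⟩
    exact Besicovitch.card_le_of_separated s h1 h2
  have hP0 : P 0 := ⟨∅, by simp, by simp, by simp⟩
  have hspec : P (Nat.findGreatest P (5 ^ Module.finrank ℝ E)) :=
    Nat.findGreatest_spec (Nat.zero_le _) hP0
  obtain ⟨s, hs, h1, h2⟩ := hspec
  refine ⟨s.image fun y => (1 / 2 : ℝ) • y, ?_, ?_⟩
  · exact Finset.card_image_le.trans (hbd _ ⟨s, rfl, h1, h2⟩)
  intro x hx
  by_contra hcon
  push Not at hcon
  have hfar : ∀ y ∈ s, 1 < ‖(2 : ℝ) • x - y‖ := by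
    intro y hy
    have := hcon ((1 / 2 : ℝ) • y) (Finset.mem_image_of_mem _ hy)
    have e : (2 : ℝ) • x - y = (2 : ℝ) • (x - (1 / 2 : ℝ) • y) := by
      rw [smul_sub, smul_smul]; norm_num
    rw [e, norm_smul]; norm_num; linarith
  have hns : (2 : ℝ) • x ∉ s := fun h => by
    have := hfar _ h; simp at this; linarith
  have hPs : P (s.card + 1) := by
    refine ⟨insert ((2 : ℝ) • x) s, Finset.card_insert_of_notMem hns, ?_, ?_⟩
    · intro c hc
      rcases Finset.mem_insert.1 hc with rfl | hc
      · rw [norm_smul]; norm_num; linarith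
      · exact h1 c hc
    · intro c hc d hd hcd
      rcases Finset.mem_insert.1 hc with rfl | hc <;> rcases Finset.mem_insert.1 hd with rfl | hd
      · exact absurd rfl hcd
      · exact (hfar d hd).le
      · rw [norm_sub_rev]; exact (hfar c hc).le
      · exact h2 c hc d hd hcd
  have := Nat.le_findGreatest (hbd _ hPs) hPs
  omega

/-- an `1/8`-net with at most `5^(3 * d)` points. -/
lemma exists_eighth_net (E : Type*) [NormedAddCommGroup E] [NormedSpace ℝ E]
    [FiniteDimensional ℝ E] :
    ∃ N : Finset E, N.card ≤ (5 ^ Module.finrank ℝ E) ^ 3 ∧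
      ∀ x : E, ‖x‖ ≤ 1 → ∃ y ∈ N, ‖x - y‖ ≤ 1 / 8 := by
  classical
  obtain ⟨N, hN, hnet⟩ := exists_half_net E
  refine ⟨(N ×ˢ N ×ˢ N).image fun y => y.1 + (1 / 2 : ℝ) • (y.2.1 + (1 / 2 : ℝ) • y.2.2), ?_, ?_⟩
  · refine Finset.card_image_le.trans ?_
    rw [Finset.card_product, Finset.card_product]
    calc N.card * (N.card * N.card) = N.card ^ 3 := by ring
      _ ≤ _ := Nat.pow_le_pow_left hN 3
  intro x hx
  obtain ⟨y1, hy1, h1⟩ := hnet x hx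
  obtain ⟨y2, hy2, h2⟩ := hnet ((2 : ℝ) • (x - y1)) (by rw [norm_smul]; norm_num; linarith)
  obtain ⟨y3, hy3, h3⟩ := hnet ((2 : ℝ) • ((2 : ℝ) • (x - y1) - y2))
    (by rw [norm_smul]; norm_num; linarith)
  refine ⟨_, Finset.mem_image_of_mem _ (Finset.mk_mem_product hy1
    (Finset.mk_mem_product hy2 hy3)), ?_⟩
  have e : x - (y1 + (1 / 2 : ℝ) • (y2 + (1 / 2 : ℝ) • y3)) =
      (1 / 4 : ℝ) • ((2 : ℝ) • ((2 : ℝ) • (x - y1) - y2) - y3) := by module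
  simp only
  rw [e, norm_smul]
  norm_num
  linarith

/-- an `1/64`-net with at most `5^(6 * d)` points. -/
lemma exists_net64 (E : Type*) [NormedAddCommGroup E] [NormedSpace ℝ E]
    [FiniteDimensional ℝ E] :
    ∃ N : Finset E, N.card ≤ 5 ^ (6 * Module.finrank ℝ E) ∧
      ∀ x : E, ‖x‖ ≤ 1 → ∃ y ∈ N, ‖x - y‖ ≤ 1 / 64 := by
  classical
  obtain ⟨N, hN, hnet⟩ := exists_eighth_net E
  refine ⟨(N ×ˢ N).image fun y => y.1 + (1 / 8 : ℝ) • y.2, ?_, ?_⟩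
  · refine Finset.card_image_le.trans ?_
    rw [Finset.card_product]
    calc N.card * N.card ≤ (5 ^ Module.finrank ℝ E) ^ 3 * (5 ^ Module.finrank ℝ E) ^ 3 :=
          Nat.mul_le_mul hN hN
      _ = _ := by rw [← pow_mul, ← pow_add]; congr 1; ring
  intro x hx
  obtain ⟨y1, hy1, h1⟩ := hnet x hx
  obtain ⟨y2, hy2, h2⟩ := hnet ((8 : ℝ) • (x - y1)) (by rw [norm_smul]; norm_num; linarith)
  refine ⟨_, Finset.mem_image_of_mem _ (Finset.mk_mem_product hy1 hy2), ?_⟩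
  have e : x - (y1 + (1 / 8 : ℝ) • y2) =
      (1 / 8 : ℝ) • ((8 : ℝ) • (x - y1) - y2) := by module
  simp only
  rw [e, norm_smul]
  norm_num
  linarith

lemma opNorm_le_of_net {E F : Type*} [NormedAddCommGroup E] [NormedSpace ℝ E]
    [NormedAddCommGroup F] [NormedSpace ℝ F] (f : E →L[ℝ] F) (N : Finset E)
    (hnet : ∀ x : E, ‖x‖ ≤ 1 → ∃ y ∈ N, ‖x - y‖ ≤ 1 / 2) {K : ℝ} (hK : 0 ≤ K)
    (h : ∀ y ∈ N, ‖f y‖ ≤ K * ‖y‖) : ‖f‖ ≤ 3 * K := by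
  have h1 : ‖f‖ ≤ (3 / 2) * K + ‖f‖ / 2 := by
    refine ContinuousLinearMap.opNorm_le_of_unit_norm (by positivity) fun x hx => ?_
    obtain ⟨y, hy, hxy⟩ := hnet x hx.le
    have e : f x = f y + f (x - y) := by rw [← map_add, add_sub_cancel]
    have hyn : ‖y‖ ≤ 3 / 2 := by
      have : ‖y‖ ≤ ‖x‖ + ‖x - y‖ := by rw [← norm_neg (x - y)]; simpa using norm_add_le x (-(x - y))
      linarith
    calc ‖f x‖ ≤ ‖f y‖ + ‖f (x - y)‖ := by rw [e]; exact norm_add_le _ _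
      _ ≤ K * ‖y‖ + ‖f‖ * ‖x - y‖ := add_le_add (h y hy) (f.le_opNorm _)
      _ ≤ K * (3 / 2) + ‖f‖ * (1 / 2) := by gcongr
      _ = _ := by ring
  linarith

lemma lower_of_net {E F : Type*} [NormedAddCommGroup E] [NormedSpace ℝ E]
    [NormedAddCommGroup F] [NormedSpace ℝ F] (f : E →L[ℝ] F) (N : Finset E)
    (hnet : ∀ x : E, ‖x‖ ≤ 1 → ∃ y ∈ N, ‖x - y‖ ≤ 1 / 64) {m K : ℝ} (hm : 0 ≤ m)
    (hK : ‖f‖ ≤ K) (h : ∀ y ∈ N, m * ‖y‖ ≤ ‖f y‖) (x : E) :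
    (m * (63 / 64) - K / 64) * ‖x‖ ≤ ‖f x‖ := by
  by_cases hx : x = 0
  · simp [hx]
  have hpos : 0 < ‖x‖ := norm_pos_iff.2 hx
  obtain ⟨y, hy, hxy⟩ := hnet (‖x‖⁻¹ • x) (by rw [norm_smul]; simp [hpos.ne'])
  set z := ‖x‖⁻¹ • x with hz
  have hzn : ‖z‖ = 1 := by rw [hz, norm_smul]; simp [hpos.ne']
  have e : f y = f z - f (z - y) := by rw [← map_sub, sub_sub_cancel]
  have h1 : ‖f y‖ ≤ ‖f z‖ + ‖f (z - y)‖ := by rw [e]; exact norm_sub_le _ _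
  have h2 : ‖f (z - y)‖ ≤ K * (1 / 64) := (f.le_opNorm _).trans (by
    have := (norm_nonneg f).trans hK
    gcongr)
  have hyn : 63 / 64 ≤ ‖y‖ := by
    have := norm_sub_norm_le z y
    rw [hzn] at this; linarith
  have h3 := h y hy
  have h4 : m * (63 / 64) ≤ m * ‖y‖ := by gcongr
  have h5 : ‖f z‖ = ‖x‖⁻¹ * ‖f x‖ := by rw [hz, map_smul, norm_smul]; simp
  have h6 : (m * (63 / 64) - K / 64) ≤ ‖x‖⁻¹ * ‖f x‖ := by rw [← h5]; linarith
  calc _ ≤ (‖x‖⁻¹ * ‖f x‖) * ‖x‖ := by gcongr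
    _ = ‖f x‖ := by field_simp


lemma markov_exp {Ω : Type*} [MeasurableSpace Ω] (μ : Measure Ω) (g : Ω → ℝ) (hg : Measurable g)
    (s : Set Ω) (c d : ℝ) (hs : ∀ ω ∈ s, c ≤ g ω)
    (hd : ∫⁻ ω, ENNReal.ofReal (Real.exp (g ω)) ∂μ ≤ ENNReal.ofReal (Real.exp d)) :
    μ s ≤ ENNReal.ofReal (Real.exp (d - c)) := by
  have h1 : s ⊆ {ω | ENNReal.ofReal (Real.exp c) ≤ ENNReal.ofReal (Real.exp (g ω))} := by
    intro ω hω
    exact ENNReal.ofReal_le_ofReal (Real.exp_le_exp.2 (hs ω hω))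
  have h0 : ENNReal.ofReal (Real.exp c) ≠ 0 := by
    simpa using Real.exp_pos c
  have h2 := meas_ge_le_lintegral_div (μ := μ) (f := fun ω => ENNReal.ofReal (Real.exp (g ω)))
    (by fun_prop) h0 ENNReal.ofReal_ne_top
  refine (measure_mono h1).trans (h2.trans ?_)
  rw [Real.exp_sub, ENNReal.ofReal_div_of_pos (Real.exp_pos _)]
  exact ENNReal.div_le_div_right hd _

lemma tail_upper_unit {n m : ℕ} (y : Fin m → ℝ) (hy : ∑ i, y i ^ 2 = 1) :
    gaussianMatrix n m {U | 16 * (n : ℝ) < ∑ i, (∑ j, y j * U i j) ^ 2}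
      ≤ ENNReal.ofReal (Real.exp (-3 * n)) := by
  have h := markov_exp (gaussianMatrix n m) (fun U => ∑ i, (1 / 4 : ℝ) * (∑ j, y j * U i j) ^ 2)
    (by fun_prop) {U | 16 * (n : ℝ) < ∑ i, (∑ j, y j * U i j) ^ 2} (4 * n) n ?_ ?_
  · convert h using 3; ring
  · intro U hU
    simp only [Set.mem_ofPred_eq] at hU
    simp only [← Finset.mul_sum]
    linarith
  · rw [lintegral_exp_mulVec y hy (by norm_num), ← ENNReal.ofReal_pow (by positivity)]
    apply ENNReal.ofReal_le_ofReal
    rw [show (n : ℝ) = n * 1 by ring, Real.exp_nat_mul]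
    gcongr
    rw [show (1 - 2 * (1 / 4) : ℝ) = 2⁻¹ by norm_num, Real.rpow_neg (by norm_num),
      Real.inv_rpow (by norm_num), inv_inv]
    have : (2 : ℝ) ^ (1 / 2 : ℝ) ≤ 2 ^ (1 : ℝ) :=
      Real.rpow_le_rpow_of_exponent_le (by norm_num) (by norm_num)
    rw [Real.rpow_one] at this
    have := Real.add_one_le_exp 1
    linarith

lemma tail_lower_unit {n m : ℕ} (y : Fin m → ℝ) (hy : ∑ i, y i ^ 2 = 1) :
    gaussianMatrix n m {U | ∑ i, (∑ j, y j * U i j) ^ 2 < n / 2}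
      ≤ ENNReal.ofReal (Real.exp (-(n / 20))) := by
  have h := markov_exp (gaussianMatrix n m) (fun U => ∑ i, (-(1 / 2) : ℝ) * (∑ j, y j * U i j) ^ 2)
    (by fun_prop) {U | ∑ i, (∑ j, y j * U i j) ^ 2 < n / 2} (-(n / 4)) (n * (-0.3)) ?_ ?_
  · convert h using 3; ring
  · intro U hU
    simp only [Set.mem_ofPred_eq] at hU
    simp only [← Finset.mul_sum]
    linarith
  · rw [lintegral_exp_mulVec y hy (by norm_num), ← ENNReal.ofReal_pow (by positivity)]
    apply ENNReal.ofReal_le_ofReal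
    rw [Real.exp_nat_mul]
    gcongr
    rw [show (1 - 2 * -(1 / 2) : ℝ) = 2 by norm_num, Real.rpow_def_of_pos (by norm_num)]
    apply Real.exp_le_exp.2
    have := Real.log_two_gt_d9
    linarith

lemma exists_unit {m : ℕ} (y : Fin m → ℝ) (hy : y ≠ 0) :
    ∃ z : Fin m → ℝ, ∃ c : ℝ, 0 < c ∧ ∑ i, z i ^ 2 = 1 ∧ (∀ j, y j = c * z j) ∧
      ∑ i, y i ^ 2 = c ^ 2 := by
  have h0 : nrm y ≠ 0 := fun h => hy (nrm_eq_zero.1 h)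
  have hpos : 0 < nrm y := lt_of_le_of_ne (nrm_nonneg _) (Ne.symm h0)
  refine ⟨(nrm y)⁻¹ • y, nrm y, hpos, ?_, ?_, (nrm_sq y).symm⟩
  · rw [← nrm_sq, nrm_smul, abs_of_pos (inv_pos.2 hpos), inv_mul_cancel₀ h0, one_pow]
  · intro j; simp; field_simp

lemma tail_upper {n m : ℕ} (y : Fin m → ℝ) :
    gaussianMatrix n m {U | 16 * (n : ℝ) * ∑ i, y i ^ 2 < ∑ i, (∑ j, y j * U i j) ^ 2}
      ≤ ENNReal.ofReal (Real.exp (-3 * n)) := by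
  by_cases hy : y = 0
  · subst hy; simp
  obtain ⟨z, c, hc, hz, hyz, hs⟩ := exists_unit y hy
  refine le_trans (measure_mono ?_) (tail_upper_unit (n := n) z hz)
  intro U hU
  simp only [Set.mem_ofPred_eq] at hU ⊢
  simp only [hyz, mul_assoc, ← Finset.mul_sum, mul_pow] at hU
  rw [hz, mul_one] at hU
  have : 0 < c ^ 2 := by positivity
  nlinarith

lemma tail_lower {n m : ℕ} (y : Fin m → ℝ) :
    gaussianMatrix n m {U | ∑ i, (∑ j, y j * U i j) ^ 2 < n / 2 * ∑ i, y i ^ 2}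
      ≤ ENNReal.ofReal (Real.exp (-(n / 20))) := by
  by_cases hy : y = 0
  · subst hy; simp
  obtain ⟨z, c, hc, hz, hyz, hs⟩ := exists_unit y hy
  refine le_trans (measure_mono ?_) (tail_lower_unit (n := n) z hz)
  intro U hU
  simp only [Set.mem_ofPred_eq] at hU ⊢
  simp only [hyz, mul_assoc, ← Finset.mul_sum, mul_pow] at hU
  rw [hz, mul_one] at hU
  have : 0 < c ^ 2 := by positivity
  nlinarith

/-- The matrix as a continuous linear map between Euclidean spaces. -/
def matCLM {n m : ℕ} (U : Fin n → Fin m → ℝ) :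
    EuclideanSpace ℝ (Fin m) →L[ℝ] EuclideanSpace ℝ (Fin n) :=
  LinearMap.toContinuousLinearMap (Matrix.toEuclideanLin (Matrix.of U))

lemma norm_matCLM {n m : ℕ} (U : Fin n → Fin m → ℝ) (x : EuclideanSpace ℝ (Fin m)) :
    ‖matCLM U x‖ = nrm (Matrix.of U *ᵥ x.ofLp) := by
  rw [nrm_eq]; rfl

lemma norm_matCLM_sq {n m : ℕ} (U : Fin n → Fin m → ℝ) (x : EuclideanSpace ℝ (Fin m)) :
    ‖matCLM U x‖ ^ 2 = ∑ i, (∑ j, x.ofLp j * U i j) ^ 2 := by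
  rw [norm_matCLM, nrm_sq]
  simp [Matrix.mulVec, dotProduct, mul_comm]

lemma norm_sq_ofLp {m : ℕ} (x : EuclideanSpace ℝ (Fin m)) : ‖x‖ ^ 2 = ∑ j, x.ofLp j ^ 2 := by
  rw [EuclideanSpace.norm_sq_eq]; simp

lemma upper_unif {n m : ℕ} {E : Type*} [NormedAddCommGroup E] [NormedSpace ℝ E]
    [FiniteDimensional ℝ E] (J : E →ₗᵢ[ℝ] EuclideanSpace ℝ (Fin m)) :
    gaussianMatrix n m {U | ∃ x : E, 12 * √n * ‖x‖ < ‖matCLM U (J x)‖} ≤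
      (5 : ℝ≥0∞) ^ Module.finrank ℝ E * ENNReal.ofReal (Real.exp (-3 * n)) := by
  obtain ⟨N, hN, hnet⟩ := exists_half_net E
  have hsub : {U : Fin n → Fin m → ℝ | ∃ x : E, 12 * √n * ‖x‖ < ‖matCLM U (J x)‖} ⊆
      ⋃ y ∈ N, {U | 16 * (n : ℝ) * ∑ i, (J y).ofLp i ^ 2 <
        ∑ i, (∑ j, (J y).ofLp j * U i j) ^ 2} := by
    rintro U ⟨x, hx⟩
    by_contra hcon
    simp only [Set.mem_iUnion, Set.mem_ofPred_eq, exists_prop, not_exists, not_and, not_lt] at hcon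
    have h1 : ‖(matCLM U).comp J.toContinuousLinearMap‖ ≤ 3 * (4 * √n) := by
      refine opNorm_le_of_net _ N hnet (by positivity) fun y hy => ?_
      have h2 := hcon y hy
      rw [← norm_matCLM_sq, ← norm_sq_ofLp, J.norm_map] at h2
      refine abs_le_of_sq_le_sq' ?_ (by positivity) |>.2
      simp only [ContinuousLinearMap.coe_comp, Function.comp_apply,
        LinearIsometry.coe_toContinuousLinearMap]
      rw [mul_pow, mul_pow, Real.sq_sqrt (by positivity)]
      linarith
    have h3 := ((matCLM U).comp J.toContinuousLinearMap).le_opNorm x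
    simp only [ContinuousLinearMap.coe_comp, Function.comp_apply,
        LinearIsometry.coe_toContinuousLinearMap] at h3
    have h4 := mul_le_mul_of_nonneg_right h1 (norm_nonneg x)
    linarith
  refine (measure_mono hsub).trans ((measure_biUnion_finset_le _ _).trans ?_)
  refine (Finset.sum_le_sum fun y _ => tail_upper (J y).ofLp).trans ?_
  rw [Finset.sum_const, nsmul_eq_mul]
  gcongr
  exact_mod_cast hN

lemma lower_unif {n m : ℕ} :
    gaussianMatrix n m {U | ¬ ∀ x : Fin m → ℝ, √n / 4 * nrm x ≤ nrm (Matrix.of U *ᵥ x)} ≤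
      (5 : ℝ≥0∞) ^ m * ENNReal.ofReal (Real.exp (-3 * n)) +
      (5 : ℝ≥0∞) ^ (6 * m) * ENNReal.ofReal (Real.exp (-(n / 20))) := by
  obtain ⟨N, hN, hnet⟩ := exists_net64 (EuclideanSpace ℝ (Fin m))
  have hup := upper_unif (n := n) (LinearIsometry.id (R := ℝ) (E := EuclideanSpace ℝ (Fin m)))
  have hfr : Module.finrank ℝ (EuclideanSpace ℝ (Fin m)) = m := by simp
  rw [hfr] at hN hup
  have hsub : {U : Fin n → Fin m → ℝ |
        ¬ ∀ x : Fin m → ℝ, √n / 4 * nrm x ≤ nrm (Matrix.of U *ᵥ x)} ⊆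
      {U | ∃ x : EuclideanSpace ℝ (Fin m), 12 * √n * ‖x‖ <
          ‖matCLM U ((LinearIsometry.id (R := ℝ) (E := EuclideanSpace ℝ (Fin m))) x)‖} ∪
      ⋃ y ∈ N, {U | ∑ i, (∑ j, y.ofLp j * U i j) ^ 2 < n / 2 * ∑ i, y.ofLp i ^ 2} := by
    intro U hU
    by_contra hcon
    rw [Set.mem_union, not_or] at hcon
    obtain ⟨hc1, hc2⟩ := hcon
    simp only [Set.mem_iUnion, Set.mem_ofPred_eq, exists_prop, not_exists, not_and, not_lt,
      LinearIsometry.id_apply] at hc1 hc2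
    apply hU
    intro x
    have h1 : ‖matCLM U‖ ≤ 12 * √n :=
      ContinuousLinearMap.opNorm_le_bound _ (by positivity) hc1
    have h2 := lower_of_net (matCLM U) N hnet (m := 0.7 * √n) (by positivity) h1 ?_
      (WithLp.toLp 2 x)
    · rw [norm_matCLM, ← nrm_eq] at h2
      refine le_trans ?_ h2
      have := nrm_nonneg x
      gcongr
      have := Real.sqrt_nonneg (n : ℝ)
      linarith
    · intro y hy
      have h3 := hc2 y hy
      rw [← norm_matCLM_sq, ← norm_sq_ofLp] at h3
      refine abs_le_of_sq_le_sq' ?_ (norm_nonneg _) |>.2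
      rw [mul_pow, mul_pow, Real.sq_sqrt (by positivity)]
      refine le_trans ?_ h3
      gcongr
      have : (0 : ℝ) ≤ n := by positivity
      linarith
  refine (measure_mono hsub).trans ((measure_union_le _ _).trans (add_le_add hup ?_))
  refine (measure_biUnion_finset_le _ _).trans ?_
  refine (Finset.sum_le_sum fun y _ => tail_lower y.ofLp).trans ?_
  rw [Finset.sum_const, nsmul_eq_mul]
  gcongr
  exact_mod_cast hN

lemma sparse_unif {n p k : ℕ} (hkp : k ≤ p) :
    gaussianMatrix n p {a | ¬ ∀ x : Fin p → ℝ, Nat.card {j // x j ≠ 0} ≤ k →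
        nrm (Matrix.of a *ᵥ x) ≤ 12 * √n * nrm x} ≤
      (p.choose k : ℝ≥0∞) * ((5 : ℝ≥0∞) ^ k * ENNReal.ofReal (Real.exp (-3 * n))) := by
  classical
  let W : Finset (Fin p) → Submodule ℝ (EuclideanSpace ℝ (Fin p)) := fun A =>
    Submodule.span ℝ ((A.image fun j => EuclideanSpace.single j (1 : ℝ) : Finset _) : Set _)
  have hW : ∀ A : Finset (Fin p), Module.finrank ℝ (W A) ≤ A.card := fun A =>
    (finrank_span_finset_le_card _).trans Finset.card_image_le
  have hsub : {a : Fin n → Fin p → ℝ | ¬ ∀ x : Fin p → ℝ, Nat.card {j // x j ≠ 0} ≤ k →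
        nrm (Matrix.of a *ᵥ x) ≤ 12 * √n * nrm x} ⊆
      ⋃ A ∈ Finset.powersetCard k (Finset.univ : Finset (Fin p)),
        {a | ∃ x : W A, 12 * √n * ‖x‖ < ‖matCLM a ((W A).subtypeₗᵢ x)‖} := by
    intro a ha
    simp only [Set.mem_ofPred_eq, not_forall, not_le] at ha
    obtain ⟨x, hx, hlt⟩ := ha
    rw [Nat.card_eq_fintype_card, Fintype.card_subtype] at hx
    obtain ⟨A, hA, hAc⟩ := Finset.exists_superset_card_eq hx (by simpa using hkp)
    simp only [Set.mem_iUnion, exists_prop]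
    refine ⟨A, Finset.mem_powersetCard.2 ⟨Finset.subset_univ _, hAc⟩, ?_⟩
    have hxW : WithLp.toLp 2 x ∈ W A := by
      have : WithLp.toLp 2 x = ∑ j ∈ A, x j • EuclideanSpace.single j (1 : ℝ) := by
        ext i
        by_cases hi : i ∈ A
        · simp [Finset.sum_apply, Pi.single_apply, hi]
        · have : x i = 0 := by
            by_contra h
            exact hi (hA (by simp [h]))
          simp [Finset.sum_apply, Pi.single_apply, this]
      rw [this]
      refine Submodule.sum_mem _ fun j hj => Submodule.smul_mem _ _ (Submodule.subset_span ?_)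
      exact_mod_cast Finset.mem_image_of_mem _ hj
    refine ⟨⟨_, hxW⟩, ?_⟩
    simp only [Submodule.coe_subtypeₗᵢ, Submodule.subtype_apply, Submodule.coe_norm]
    rw [norm_matCLM, ← nrm_eq]
    exact hlt
  refine (measure_mono hsub).trans ((measure_biUnion_finset_le _ _).trans ?_)
  refine (Finset.sum_le_card_nsmul _ _ ((5 : ℝ≥0∞) ^ k * ENNReal.ofReal (Real.exp (-3 * n)))
    fun A hA => ?_).trans ?_
  · refine (upper_unif (n := n) (W A).subtypeₗᵢ).trans ?_
    gcongr
    · norm_num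
    · exact (hW A).trans (Finset.mem_powersetCard.1 hA).2.le
  · rw [Finset.card_powersetCard, nsmul_eq_mul]
    simp

lemma five_pow_le (m : ℕ) : (5 : ℝ≥0∞) ^ m ≤ ENNReal.ofReal (Real.exp (2 * m)) := by
  have h5 : (5 : ℝ) ≤ Real.exp 2 := by
    have := Real.quadratic_le_exp_of_nonneg (x := 2) (by norm_num)
    linarith
  have : (5 : ℝ≥0∞) = ENNReal.ofReal 5 := by norm_num
  rw [this, ← ENNReal.ofReal_pow (by norm_num)]
  apply ENNReal.ofReal_le_ofReal
  rw [mul_comm, Real.exp_nat_mul]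
  gcongr

/-- bad event for `U` -/
def badU (n r : ℕ) : Set (Fin n → Fin r → ℝ) :=
  {U | ¬ ∀ x : Fin r → ℝ, √n / 4 * nrm x ≤ nrm (Matrix.of U *ᵥ x)}

/-- bad event for `W` -/
def badW (n p k : ℕ) : Set (Fin n → Fin p → ℝ) :=
  {a | ¬ ∀ x : Fin p → ℝ, Nat.card {j // x j ≠ 0} ≤ k →
        nrm (Matrix.of a *ᵥ x) ≤ 12 * √n * nrm x}

lemma tail_rate {n : ℕ} {lam : ℝ} (hn : 1 ≤ n) (hlam : 1 < lam) (hlog : 1000 * Real.log lam ≤ n) :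
    Real.exp (-(n / 30)) ≤ 50 / (n * hfun lam) := by
  have hn' : (1 : ℝ) ≤ n := by exact_mod_cast hn
  have hh : hfun lam ≤ lam := by
    unfold hfun; rw [div_le_iff₀ (by linarith)]; nlinarith
  have hhp : 0 < hfun lam := by unfold hfun; positivity
  have hle : lam ≤ Real.exp (n / 1000) := by
    rw [← Real.log_le_iff_le_exp (by linarith)]; linarith
  rw [le_div_iff₀ (by positivity)]
  have h1 : (n : ℝ) ≤ 50 * Real.exp (n / 50) := by
    have := Real.add_one_le_exp ((n : ℝ) / 50)
    linarith
  calc Real.exp (-(n / 30)) * (n * hfun lam)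
      ≤ Real.exp (-(n / 30)) * ((50 * Real.exp (n / 50)) * Real.exp (n / 1000)) := by
        gcongr; exact hh.trans hle
    _ = 50 * Real.exp (-(n / 30) + n / 50 + n / 1000) := by
        rw [Real.exp_add, Real.exp_add]; ring
    _ ≤ 50 * 1 := by
        gcongr; rw [Real.exp_le_one_iff]; linarith
    _ = 50 := by norm_num

lemma badU_le {n r : ℕ} (hr : 1000 * (r : ℝ) ≤ n) :
    gaussianMatrix n r (badU n r) ≤ ENNReal.ofReal (2 * Real.exp (-(n / 30))) := by
  refine lower_unif.trans ?_
  rw [two_mul, ENNReal.ofReal_add (by positivity) (by positivity)]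
  have hr0 : (0 : ℝ) ≤ r := by positivity
  apply add_le_add
  · refine (mul_le_mul_left (five_pow_le r) _).trans ?_
    rw [← ENNReal.ofReal_mul (by positivity), ← Real.exp_add]
    apply ENNReal.ofReal_le_ofReal; apply Real.exp_le_exp.2
    linarith
  · refine (mul_le_mul_left (five_pow_le (6 * r)) _).trans ?_
    rw [← ENNReal.ofReal_mul (by positivity), ← Real.exp_add]
    apply ENNReal.ofReal_le_ofReal; apply Real.exp_le_exp.2
    push_cast
    linarith

lemma badW_le {n p k : ℕ} (hk : 1 ≤ k) (hkp : k ≤ p) (hn : 1000 * (k * ell p k) ≤ n) :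
    gaussianMatrix n p (badW n p k) ≤ ENNReal.ofReal (Real.exp (-(n / 30))) := by
  refine (sparse_unif hkp).trans ?_
  have h1 : (p.choose k : ℝ≥0∞) ≤ ENNReal.ofReal (Real.exp (k * ell p k)) := by
    rw [← ENNReal.ofReal_natCast]
    exact ENNReal.ofReal_le_ofReal (choose_le_exp_ell hk hkp)
  refine (mul_le_mul' h1 (mul_le_mul_left (five_pow_le k) _)).trans ?_
  rw [← ENNReal.ofReal_mul (by positivity), ← ENNReal.ofReal_mul (by positivity), ← Real.exp_add,
    ← Real.exp_add]
  apply ENNReal.ofReal_le_ofReal; apply Real.exp_le_exp.2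
  have h2 := one_le_ell hk hkp
  have h3 : (k : ℝ) ≤ k * ell p k := by
    have : (0 : ℝ) ≤ k := by positivity
    nlinarith
  have : (0 : ℝ) ≤ k := by positivity
  linarith

lemma xq_le (q s : ℝ) (p r n : ℕ) (lam : ℝ) : xq q s p r n lam ≤ p :=
  Real.sSup_le (fun _ hx => hx.2.1) (by positivity)

lemma kq_le (q s : ℝ) (p r n : ℕ) (lam : ℝ) : kq q s p r n lam ≤ p :=
  Nat.ceil_le.2 (xq_le q s p r n lam)

lemma lt_of_gt_xq {q s : ℝ} {p r n : ℕ} {lam x : ℝ} (hx : xq q s p r n lam < x) (hx0 : 0 ≤ x)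
    (hxp : x ≤ p) :
    s * (n * hfun lam / ((r : ℝ) + Real.log (Real.exp 1 * p / x))) ^ (q / 2) < x := by
  by_contra hcon
  push Not at hcon
  have : x ≤ xq q s p r n lam := le_csSup ⟨p, fun _ hy => hy.2.1⟩ ⟨hx0, hxp, hcon⟩
  linarith

lemma xq_pos {q s : ℝ} {p r n : ℕ} {lam : ℝ} (hq0 : 0 ≤ q) (hq2 : q < 2) (hs : 0 < s)
    (hp : 1 ≤ p) (hc : 0 < n * hfun lam) : 0 < xq q s p r n lam := by
  set c := n * hfun lam with hcdef
  have hp0 : (0 : ℝ) < p := by exact_mod_cast hp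
  set c' := c / ((r + 1) * p) with hc'
  have hc'0 : 0 < c' := by positivity
  set z := (s * c' ^ (q / 2)) ^ (1 / (1 - q / 2)) with hz
  have hz0 : 0 < z := by positivity
  set x := min (p : ℝ) z with hx
  have hx0 : 0 < x := lt_min hp0 hz0
  have hxp : x ≤ p := min_le_left _ _
  refine lt_of_lt_of_le hx0 (le_csSup ⟨p, fun _ hy => hy.2.1⟩ ⟨hx0.le, hxp, ?_⟩)
  have h1 : Real.log (Real.exp 1 * p / x) ≤ p / x := by
    rw [mul_div_assoc, Real.log_mul (Real.exp_pos 1).ne' (by positivity), Real.log_exp]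
    have := Real.log_le_sub_one_of_pos (x := p / x) (by positivity)
    linarith
  have hpx : 1 ≤ p / x := by rw [le_div_iff₀ hx0]; linarith
  have hl0 : 0 < Real.log (Real.exp 1 * p / x) := by
    apply Real.log_pos
    rw [mul_div_assoc]
    have := Real.add_one_le_exp 1
    nlinarith
  have h2 : (r : ℝ) + Real.log (Real.exp 1 * p / x) ≤ (r + 1) * (p / x) := by
    have : (0 : ℝ) ≤ r := by positivity
    nlinarith
  have h3 : c' * x ≤ c / ((r : ℝ) + Real.log (Real.exp 1 * p / x)) := by
    rw [le_div_iff₀ (by positivity)]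
    calc c' * x * ((r : ℝ) + Real.log (Real.exp 1 * p / x)) ≤ c' * x * ((r + 1) * (p / x)) := by
          gcongr
      _ = c := by rw [hc']; field_simp
  have h4 : x ≤ s * (c' * x) ^ (q / 2) := by
    have hq' : 0 < 1 - q / 2 := by linarith
    have h5 : x ^ (1 - q / 2) ≤ s * c' ^ (q / 2) := by
      calc x ^ (1 - q / 2) ≤ z ^ (1 - q / 2) :=
            Real.rpow_le_rpow hx0.le (min_le_right _ _) hq'.le
        _ = s * c' ^ (q / 2) := by
            rw [hz, ← Real.rpow_mul (by positivity), one_div, inv_mul_cancel₀ hq'.ne',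
              Real.rpow_one]
    calc x = x ^ (1 - q / 2) * x ^ (q / 2) := by
          rw [← Real.rpow_add hx0]; simp
      _ ≤ s * c' ^ (q / 2) * x ^ (q / 2) := by gcongr
      _ = s * (c' * x) ^ (q / 2) := by rw [Real.mul_rpow hc'0.le hx0.le]; ring
  refine h4.trans ?_
  gcongr

lemma block_sum {a : ℝ} (ha : 1 < a) (K P : ℕ) (hK : 1 ≤ K) :
    ∑ m ∈ Finset.Icc K P, ((K : ℝ) / m) ^ a ≤ K * ∑' b : ℕ, ((b : ℝ) ^ a)⁻¹ := by
  have hsum : Summable fun b : ℕ => ((b : ℝ) ^ a)⁻¹ := Real.summable_nat_rpow_inv.2 ha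
  have hK0 : (0 : ℝ) < K := by exact_mod_cast hK
  have h1 : ∀ m ∈ Finset.Icc K P, ((K : ℝ) / m) ^ a ≤ (((m / K : ℕ) : ℝ) ^ a)⁻¹ := by
    intro m hm
    have hKm := (Finset.mem_Icc.1 hm).1
    have hb : 1 ≤ m / K := (Nat.one_le_div_iff (by omega)).2 hKm
    have hb0 : (0 : ℝ) < ((m / K : ℕ) : ℝ) := by exact_mod_cast hb
    have hm0 : (0 : ℝ) < m := by exact_mod_cast (by omega : 0 < m)
    rw [← Real.inv_rpow hb0.le]
    apply Real.rpow_le_rpow (by positivity) _ (by linarith)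
    rw [div_le_iff₀ hm0, inv_mul_eq_div, le_div_iff₀ hb0]
    have := Nat.mul_div_le m K
    exact_mod_cast this
  calc ∑ m ∈ Finset.Icc K P, ((K : ℝ) / m) ^ a
      ≤ ∑ m ∈ Finset.Icc K P, (((m / K : ℕ) : ℝ) ^ a)⁻¹ := Finset.sum_le_sum h1
    _ = ∑ b ∈ Finset.range (P + 1), ∑ m ∈ Finset.Icc K P with m / K = b,
          (((m / K : ℕ) : ℝ) ^ a)⁻¹ := by
        refine (Finset.sum_fiberwise_of_maps_to ?_ _).symm
        intro m hm
        have := Nat.div_le_self m K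
        have := (Finset.mem_Icc.1 hm).2
        simp; omega
    _ ≤ ∑ b ∈ Finset.range (P + 1), (K : ℝ) * ((b : ℝ) ^ a)⁻¹ := by
        apply Finset.sum_le_sum
        intro b _
        have hcard : ((Finset.Icc K P).filter fun m => m / K = b).card ≤ K := by
          have : ((Finset.Icc K P).filter fun m => m / K = b) ⊆ Finset.Ico (b * K) (b * K + K) := by
            intro m hm
            have hm2 := (Finset.mem_filter.1 hm).2
            have h3 := Nat.div_add_mod m K
            have h4 := Nat.mod_lt m (by omega : K > 0)
            rw [hm2, mul_comm] at h3
            simp; omega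
          simpa using Finset.card_le_card this
        rw [Finset.sum_congr rfl (g := fun _ => ((b : ℝ) ^ a)⁻¹)
          (fun m hm => by rw [(Finset.mem_filter.1 hm).2]), Finset.sum_const, nsmul_eq_mul]
        gcongr
    _ = K * ∑ b ∈ Finset.range (P + 1), ((b : ℝ) ^ a)⁻¹ := by rw [Finset.mul_sum]
    _ ≤ _ := by
        gcongr
        exact hsum.sum_le_tsum _ fun b _ => by positivity

lemma sorted_nonneg {p r : ℕ} (V : Matrix (Fin p) (Fin r) ℝ) (j : Fin p) :
    0 ≤ sortedRowNorm V j := Real.sqrt_nonneg _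

lemma weak_term_le {q s : ℝ} {p r : ℕ} {V : Matrix (Fin p) (Fin r) ℝ} (h : weakLq q V ≤ s)
    (j : Fin p) (hj : sortedRowNorm V j ≠ 0) :
    ((j : ℕ) + 1 : ℝ) * (sortedRowNorm V j) ^ q ≤ s := by
  refine le_trans ?_ h
  have := le_ciSup (f := fun j : Fin p => ((j : ℕ) + 1 : ℝ) *
    (if sortedRowNorm V j = 0 then 0 else (sortedRowNorm V j) ^ q)) (Set.finite_range _).bddAbove j
  simpa [weakLq, hj] using this

lemma s_pos {q s : ℝ} {p r : ℕ} {V : Matrix (Fin p) (Fin r) ℝ} (hr : 1 ≤ r)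
    (hV : IsOrthonormalCols V) (h : weakLq q V ≤ s) : 0 < s := by
  by_cases hall : ∀ j, sortedRowNorm V j = 0
  · exfalso
    have h0 : ∀ j i, V j i = 0 := by
      intro j i
      have := hall ((Tuple.sort (fun i => - rowNorm V i)).symm j)
      unfold sortedRowNorm rowNorm at this
      rw [Equiv.apply_symm_apply] at this
      have := nrm_eq_zero.1 this
      exact congrFun this i
    have hV0 : V = 0 := by ext j i; exact h0 j i
    have := congrFun (congrFun hV ⟨0, hr⟩) ⟨0, hr⟩
    rw [hV0] at this
    simp at this
  · push Not at hall
    obtain ⟨j, hj⟩ := hall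
    have h1 := weak_term_le h j hj
    have : 0 < sortedRowNorm V j := lt_of_le_of_ne (sorted_nonneg _ _) (Ne.symm hj)
    have : 0 < ((j : ℕ) + 1 : ℝ) * (sortedRowNorm V j) ^ q := by positivity
    linarith

/-- exponent used in the tail sum -/
def aq (q : ℝ) : ℝ := if q = 0 then 2 else 2 / q

lemma one_lt_aq {q : ℝ} (hq0 : 0 ≤ q) (hq2 : q < 2) : 1 < aq q := by
  unfold aq
  split_ifs with h
  · norm_num
  · have : 0 < q := lt_of_le_of_ne hq0 (Ne.symm h)
    rw [lt_div_iff₀ this]; linarith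

lemma sorted_tail {q s : ℝ} {p r n k : ℕ} {lam : ℝ} (hq0 : 0 ≤ q)
    {V : Matrix (Fin p) (Fin r) ℝ} (h : weakLq q V ≤ s) (hc : 0 < n * hfun lam)
    (hk : kq q s p r n lam = k) (j : Fin p) (hj : k ≤ j) :
    sortedRowNorm V j ^ 2 ≤
      ((r + ell p (k + 1 : ℕ)) / (n * hfun lam)) *
        (((k + 1 : ℕ) : ℝ) / ((j + 1 : ℕ) : ℝ)) ^ (aq q) := by
  have hkp : k + 1 ≤ p := by have := j.2; omega
  have hl := one_le_ell (by omega : 1 ≤ k + 1) hkp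
  have hr0 : (0 : ℝ) ≤ r := by positivity
  set τ2 := (r + ell p (k + 1 : ℕ)) / (n * hfun lam) with hτ
  have hτ0 : 0 < τ2 := by positivity
  by_cases hz : sortedRowNorm V j = 0
  · rw [hz]; norm_num; positivity
  have hpos : 0 < sortedRowNorm V j := lt_of_le_of_ne (sorted_nonneg _ _) (Ne.symm hz)
  have h1 := weak_term_le h j hz
  have h2 : s * (τ2⁻¹) ^ (q / 2) < ((k + 1 : ℕ) : ℝ) := by
    have hx : xq q s p r n lam < ((k + 1 : ℕ) : ℝ) := by
      have : xq q s p r n lam ≤ k := by rw [← hk]; exact Nat.le_ceil _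
      push_cast; linarith
    have := lt_of_gt_xq hx (by positivity) (by exact_mod_cast hkp)
    rw [hτ, inv_div]; exact this
  have hj0 : (0 : ℝ) < ((j + 1 : ℕ) : ℝ) := by positivity
  have hk0 : (0 : ℝ) < ((k + 1 : ℕ) : ℝ) := by positivity
  have hτq : 0 < τ2 ^ (q / 2) := by positivity
  have h3 : sortedRowNorm V j ^ q < (((k + 1 : ℕ) : ℝ) / ((j + 1 : ℕ) : ℝ)) * τ2 ^ (q / 2) := by
    rw [Real.inv_rpow hτ0.le, ← div_eq_mul_inv, div_lt_iff₀ hτq] at h2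
    rw [div_mul_eq_mul_div, lt_div_iff₀ hj0]
    push_cast at h2 ⊢
    linarith
  by_cases hq : q = 0
  · exfalso
    rw [hq] at h3
    simp only [Real.rpow_zero, zero_div, mul_one] at h3
    rw [lt_div_iff₀ hj0] at h3
    have : ((k + 1 : ℕ) : ℝ) ≤ ((j + 1 : ℕ) : ℝ) := by exact_mod_cast (by omega)
    linarith
  have hqpos : 0 < q := lt_of_le_of_ne hq0 (Ne.symm hq)
  have h4 : (sortedRowNorm V j ^ q) ^ (2 / q) ≤
      ((((k + 1 : ℕ) : ℝ) / ((j + 1 : ℕ) : ℝ)) * τ2 ^ (q / 2)) ^ (2 / q) :=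
    Real.rpow_le_rpow (by positivity) h3.le (by positivity)
  rw [← Real.rpow_mul hpos.le, Real.mul_rpow (by positivity) hτq.le, ← Real.rpow_mul hτ0.le,
    show q * (2 / q) = ((2 : ℕ) : ℝ) by field_simp; norm_num,
    show q / 2 * (2 / q) = 1 by field_simp, Real.rpow_one, Real.rpow_natCast] at h4
  have e : aq q = 2 / q := by simp [aq, hq]
  rw [e, mul_comm τ2]
  exact h4

/-- the constant in the weak `ℓ_q` tail bound -/
def Zq (q : ℝ) : ℝ := 2 * ∑' b : ℕ, ((b : ℝ) ^ aq q)⁻¹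

lemma Zq_nonneg (q : ℝ) : 0 ≤ Zq q :=
  mul_nonneg (by norm_num) (tsum_nonneg fun b => by positivity)

lemma weak_tail {q s : ℝ} {p r n k : ℕ} {lam : ℝ} (hq0 : 0 ≤ q) (hq2 : q < 2)
    {V : Matrix (Fin p) (Fin r) ℝ} (h : weakLq q V ≤ s) (hc : 0 < n * hfun lam)
    (hk : kq q s p r n lam = k) (hk1 : 1 ≤ k) :
    ∃ S : Finset (Fin p), S.card = k ∧ rowSq V Sᶜ ≤ Zq q * Psi k p r n lam := by
  have hkp : k ≤ p := hk ▸ kq_le _ _ _ _ _ _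
  set sg := Tuple.sort (fun i => - rowNorm V i) with hsg
  refine ⟨(Finset.univ.filter fun j : Fin p => (j : ℕ) < k).map sg.toEmbedding, ?_, ?_⟩
  · rw [Finset.card_map]
    have : (Finset.univ.filter fun j : Fin p => (j : ℕ) < k) =
        (Finset.univ : Finset (Fin k)).map (Fin.castLEEmb hkp) := by
      ext j
      simp only [Finset.mem_filter, Finset.mem_univ, true_and, Finset.mem_map,
        Fin.castLEEmb_apply]
      exact ⟨fun h => ⟨⟨j, h⟩, rfl⟩, by rintro ⟨i, rfl⟩; exact i.2⟩
    rw [this, Finset.card_map, Finset.card_univ, Fintype.card_fin]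
  have hcompl : ((Finset.univ.filter fun j : Fin p => (j : ℕ) < k).map sg.toEmbedding)ᶜ =
      (Finset.univ.filter fun j : Fin p => k ≤ (j : ℕ)).map sg.toEmbedding := by
    ext j
    simp only [Finset.mem_compl, Finset.mem_map_equiv, Finset.mem_filter, Finset.mem_univ, true_and,
      not_lt]
  rw [hcompl, rowSq, Finset.sum_map]
  set τ2 := (r + ell p (k + 1 : ℕ)) / (n * hfun lam) with hτ
  have e1 : ∀ j : Fin p, ∑ i, V (sg.toEmbedding j) i ^ 2 = sortedRowNorm V j ^ 2 := by
    intro j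
    unfold sortedRowNorm rowNorm
    rw [Real.sq_sqrt (Finset.sum_nonneg fun _ _ => sq_nonneg _)]; rfl
  simp only [e1]
  have hnum : 0 ≤ Psi k p r n lam := by
    unfold Psi
    have := one_le_ell hk1 hkp
    unfold ell at this
    positivity
  by_cases hkp' : k + 1 ≤ p
  swap
  · have : (Finset.univ.filter fun j : Fin p => k ≤ (j : ℕ)) = ∅ := by
      ext j; have := j.2; simp; omega
    rw [this, Finset.sum_empty]
    exact mul_nonneg (Zq_nonneg q) hnum
  have hl := one_le_ell (by omega : 1 ≤ k + 1) hkp'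
  have hτ0 : 0 ≤ τ2 := by positivity
  have h1 : ∑ j ∈ Finset.univ.filter (fun j : Fin p => k ≤ (j : ℕ)), sortedRowNorm V j ^ 2 ≤
      ∑ j ∈ Finset.univ.filter (fun j : Fin p => k ≤ (j : ℕ)), τ2 * (((k + 1 : ℕ) : ℝ) / ((j + 1 : ℕ) : ℝ)) ^ (aq q) :=
    Finset.sum_le_sum fun j hj => sorted_tail hq0 h hc hk j (Finset.mem_filter.1 hj).2
  have h2 : ∑ j ∈ Finset.univ.filter (fun j : Fin p => k ≤ (j : ℕ)), (((k + 1 : ℕ) : ℝ) / ((j + 1 : ℕ) : ℝ)) ^ (aq q) ≤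
      ∑ m ∈ Finset.Icc (k + 1) p, (((k + 1 : ℕ) : ℝ) / m) ^ (aq q) := by
    let e : Fin p ↪ ℕ := ⟨fun j => (j : ℕ) + 1, fun a b hab => Fin.ext (by simpa using hab)⟩
    have := Finset.sum_map (Finset.univ.filter fun j : Fin p => k ≤ (j : ℕ)) e
      (fun m : ℕ => (((k + 1 : ℕ) : ℝ) / m) ^ (aq q))
    rw [show (∑ j ∈ Finset.univ.filter (fun j : Fin p => k ≤ (j : ℕ)), (((k + 1 : ℕ) : ℝ) / ((j + 1 : ℕ) : ℝ)) ^ (aq q)) =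
      ∑ x ∈ Finset.map e (Finset.univ.filter fun j : Fin p => k ≤ (j : ℕ)),
        (((k + 1 : ℕ) : ℝ) / x) ^ (aq q) from this.symm]
    refine Finset.sum_le_sum_of_subset_of_nonneg ?_ fun _ _ _ => by positivity
    intro m hm
    obtain ⟨j, hj, rfl⟩ := Finset.mem_map.1 hm
    have := (Finset.mem_filter.1 hj).2
    have := j.2
    have he : e j = (j : ℕ) + 1 := rfl
    rw [he, Finset.mem_Icc]; omega
  have h3 := block_sum (one_lt_aq hq0 hq2) (k + 1) p (by omega)
  have hZ : 0 ≤ ∑' b : ℕ, ((b : ℝ) ^ aq q)⁻¹ := tsum_nonneg fun b => by positivity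
  have hell : ell p (k + 1) ≤ ell p k := by
    apply ell_anti <;> omega
  calc _ ≤ τ2 * (((k + 1 : ℕ) : ℝ) * ∑' b : ℕ, ((b : ℝ) ^ aq q)⁻¹) := by
        refine h1.trans ?_
        rw [← Finset.mul_sum]
        gcongr
        exact h2.trans h3
    _ ≤ Zq q * Psi k p r n lam := by
        rw [hτ, Zq, Psi]
        change _ ≤ _ * ((r * k + k * ell p k) / _)
        rw [div_mul_eq_mul_div, mul_div_assoc', div_le_div_iff_of_pos_right hc]
        have h5 : ((k + 1 : ℕ) : ℝ) ≤ 2 * k := by exact_mod_cast (by omega)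
        calc (r + ell p (k + 1)) * (((k + 1 : ℕ) : ℝ) * ∑' b : ℕ, ((b : ℝ) ^ aq q)⁻¹)
            ≤ (r + ell p k) * ((2 * k) * ∑' b : ℕ, ((b : ℝ) ^ aq q)⁻¹) := by
              have : 0 ≤ (r : ℝ) + ell p (k + 1) := by positivity
              have : 0 ≤ (r : ℝ) + ell p k := by linarith
              gcongr
          _ = _ := by ring

/-- energy of the signal outside the support `S` -/
def sigTail {n p r : ℕ} (Λ : Fin r → ℝ) (V : Matrix (Fin p) (Fin r) ℝ) (S : Finset (Fin p))
    (u : Fin n → Fin r → ℝ) : ℝ :=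
  ∑ j ∈ Sᶜ, ∑ i, (∑ k, V j k * √(Λ k) * u i k) ^ 2

lemma sigTail_nonneg {n p r : ℕ} (Λ : Fin r → ℝ) (V : Matrix (Fin p) (Fin r) ℝ)
    (S : Finset (Fin p)) (u : Fin n → Fin r → ℝ) : 0 ≤ sigTail Λ V S u :=
  Finset.sum_nonneg fun _ _ => Finset.sum_nonneg fun _ _ => sq_nonneg _

lemma lintegral_sigTail {n p r : ℕ} (Λ : Fin r → ℝ) (V : Matrix (Fin p) (Fin r) ℝ)
    (S : Finset (Fin p)) {K : ℝ} (hΛ : ∀ i, Λ i ≤ K) (hΛ0 : ∀ i, 0 ≤ Λ i) :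
    ∫⁻ u, ENNReal.ofReal (sigTail Λ V S u) ∂(gaussianMatrix n r) ≤
      ENNReal.ofReal (n * K * rowSq V Sᶜ) := by
  have hm : ∀ (j : Fin p) (i : Fin n), Measurable fun u : Fin n → Fin r → ℝ =>
      ENNReal.ofReal ((∑ k, V j k * √(Λ k) * u i k) ^ 2) := by
    intro j i; fun_prop
  have e : ∀ u : Fin n → Fin r → ℝ, ENNReal.ofReal (sigTail Λ V S u) =
      ∑ j ∈ Sᶜ, ∑ i, ENNReal.ofReal ((∑ k, V j k * √(Λ k) * u i k) ^ 2) := by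
    intro u
    unfold sigTail
    rw [ENNReal.ofReal_sum_of_nonneg fun _ _ => Finset.sum_nonneg fun _ _ => sq_nonneg _]
    refine Finset.sum_congr rfl fun j _ => ?_
    rw [ENNReal.ofReal_sum_of_nonneg fun _ _ => sq_nonneg _]
  simp only [e]
  rw [lintegral_finsetSum _ fun j _ => Finset.measurable_sum _ fun i _ => hm j i]
  have e2 : ∀ (j : Fin p) (i : Fin n), ∫⁻ u : Fin n → Fin r → ℝ,
      ENNReal.ofReal ((∑ k, V j k * √(Λ k) * u i k) ^ 2) ∂(gaussianMatrix n r) =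
      ENNReal.ofReal (∑ k, (V j k * √(Λ k)) ^ 2) := by
    intro j i
    rw [← lintegral_linear_sq]
    have hmp : MeasurePreserving (Function.eval i) (gaussianMatrix n r) (stdGaussian (Fin r)) :=
      measurePreserving_eval (fun _ : Fin n => stdGaussian (Fin r)) i
    have := hmp.lintegral_comp (f := fun x : Fin r → ℝ =>
      ENNReal.ofReal ((∑ k, V j k * √(Λ k) * x k) ^ 2)) (by fun_prop)
    exact this
  calc _ = ∑ j ∈ Sᶜ, ∑ i : Fin n, ENNReal.ofReal (∑ k, (V j k * √(Λ k)) ^ 2) := by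
        refine Finset.sum_congr rfl fun j _ => ?_
        rw [lintegral_finsetSum _ fun i _ => hm j i]
        exact Finset.sum_congr rfl fun i _ => e2 j i
    _ = ENNReal.ofReal (∑ j ∈ Sᶜ, ∑ i : Fin n, ∑ k, (V j k * √(Λ k)) ^ 2) := by
        rw [ENNReal.ofReal_sum_of_nonneg fun _ _ => Finset.sum_nonneg fun _ _ =>
          Finset.sum_nonneg fun _ _ => sq_nonneg _]
        refine Finset.sum_congr rfl fun j _ => ?_
        rw [ENNReal.ofReal_sum_of_nonneg fun _ _ => Finset.sum_nonneg fun _ _ => sq_nonneg _]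
    _ ≤ _ := by
        apply ENNReal.ofReal_le_ofReal
        unfold rowSq
        rw [Finset.mul_sum]
        refine Finset.sum_le_sum fun j _ => ?_
        rw [Finset.sum_const, Finset.card_univ, Fintype.card_fin, nsmul_eq_mul, mul_assoc,
          Finset.mul_sum _ _ K]
        refine mul_le_mul_of_nonneg_left (Finset.sum_le_sum fun k _ => ?_) (Nat.cast_nonneg n)
        rw [mul_pow, Real.sq_sqrt (hΛ0 k), mul_comm]
        exact mul_le_mul_of_nonneg_right (hΛ k) (sq_nonneg _)

lemma good_bound {n p r k : ℕ} {lam β δ : ℝ} (hβ : 2 < β) (hδ0 : 0 < δ) (hδ1 : δ < 1)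
    (hrp : r ≤ p) (hn : 1 ≤ n)
    (V0est : (Fin n → Fin p → ℝ) → (Fin p → Fin r → ℝ))
    (hV0 : ∀ x, IsOrthonormalCols (Matrix.of (V0est x)))
    (Λ : Fin r → ℝ) (V : Matrix (Fin p) (Fin r) ℝ) (hV : IsOrthonormalCols V)
    (hlam : 10 ^ 6 ≤ lam) (hΛ : ∀ i, lam ≤ Λ i)
    (u : Fin n → Fin r → ℝ) (a : Fin n → Fin p → ℝ)
    (hsupp : suppCard (Matrix.of (V0est (fun i j => (sig Λ V u + √2 • of a) i j))) ≤ k)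
    (hσ : 1 / 2 ≤ sigmaMin (Vᵀ * Matrix.of (V0est (fun i j => (sig Λ V u + √2 • of a) i j))))
    (hU : u ∉ badU n r) (hW : a ∉ badW n p k) :
    ∃ L : Matrix (Fin n) (Fin r) ℝ, Lᵀ * L = 1 ∧ ∀ (b : Fin n → Fin p → ℝ) (X : ℝ)
      (S : Finset (Fin p)),
      (∀ A, projSq L A b - Tsum β p r A.card ≤ X) →
      (n * lam / 128) * loss (adaptiveEst n p r β δ V0est (sig Λ V u + √2 • of a)
        (sig Λ V u + √2 • of b)) V ≤
      2 * ((4 / δ) * ((4 / δ) * ((1 / 2) * sigTail Λ V S u) + 4 * X + 6 * Tsum β p r S.card)) := by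
  have hlam0 : 0 < lam := by linarith
  have hn0 : (0 : ℝ) < n := by exact_mod_cast hn
  have hsn : 0 < √(n : ℝ) := Real.sqrt_pos.2 hn0
  simp only [badU, badW, Set.mem_ofPred_eq, not_not] at hU hW
  have hc : 8 * √2 * (12 * √(n : ℝ)) ≤ √(n : ℝ) / 4 * √lam := by
    have h1 : (1000 : ℝ) ≤ √lam := by
      apply Real.le_sqrt_of_sq_le; linarith
    have h2 : √2 ≤ (2 : ℝ) := by
      rw [Real.sqrt_le_left (by norm_num)]; norm_num
    nlinarith [mul_le_mul_of_nonneg_left h1 hsn.le, mul_le_mul_of_nonneg_left h2 hsn.le]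
  obtain ⟨L, hL, hBL, hM⟩ := good_det Λ V
    (Matrix.of (V0est (fun i j => (sig Λ V u + √2 • of a) i j))) u a hlam0 hΛ
    (by positivity) (by positivity) (hV0 _) hsupp hσ hU hW hc
  refine ⟨L, hL, fun b X S hX => ?_⟩
  set M : Matrix (Fin r) (Fin r) ℝ :=
    (√2)⁻¹ • (Lᵀ * of u * diagonal (fun k => √(Λ k)))ᵀ with hMdef
  set E : Matrix (Fin p) (Fin r) ℝ := (of b)ᵀ * L with hE
  have h2 : (√2)⁻¹ * √2 = (1 : ℝ) := inv_mul_cancel₀ (by positivity)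
  have hY : (√2)⁻¹ • ((sig Λ V u + √2 • of b)ᵀ * (sig Λ V u + √2 • of a) *
      Matrix.of (V0est (fun i j => (sig Λ V u + √2 • of a) i j)) *
      (svdCR ((sig Λ V u + √2 • of a) *
        Matrix.of (V0est (fun i j => (sig Λ V u + √2 • of a) i j)))).2 *
      (svdCR ((sig Λ V u + √2 • of a) *
        Matrix.of (V0est (fun i j => (sig Λ V u + √2 • of a) i j)))).1⁻¹) = V * M + E := by
    have : ∀ (A : Matrix (Fin p) (Fin n) ℝ) (B : Matrix (Fin n) (Fin p) ℝ)
        (C : Matrix (Fin p) (Fin r) ℝ) (D F : Matrix (Fin r) (Fin r) ℝ),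
        A * B * C * D * F = A * (B * C * D * F) := by
      intros; simp only [Matrix.mul_assoc]
    rw [this, hBL, transpose_add, Matrix.add_mul, smul_add, transpose_smul, Matrix.smul_mul,
      smul_smul, h2, one_smul, hMdef, hE, Matrix.mul_smul]
    congr 2
    simp only [sig, transpose_mul, transpose_transpose, diagonal_transpose, Matrix.mul_assoc]
  have hadapt : adaptiveEst n p r β δ V0est (sig Λ V u + √2 • of a) (sig Λ V u + √2 • of b) =
      orthonormalize (penEst β δ (V * M + E)) := by
    rw [← hY]; rfl
  rw [hadapt]
  have hm0 : 0 ≤ (√2)⁻¹ * ((√(n : ℝ) / 4) / 2 * √lam) := by positivity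
  have hMt : ∀ y, (√2)⁻¹ * ((√(n : ℝ) / 4) / 2 * √lam) * nrm y ≤ nrm (Mᵀ *ᵥ y) := by
    intro y
    rw [hMdef, transpose_smul, transpose_transpose, smul_mulVec, nrm_smul,
      abs_of_nonneg (by positivity), mul_assoc]
    exact mul_le_mul_of_nonneg_left (hM y) (by positivity)
  have h3 := loss_orth_le hrp V (penEst β δ (V * M + E)) hV M hm0 hMt
  have hsq : ((√2)⁻¹ * ((√(n : ℝ) / 4) / 2 * √lam)) ^ 2 = n * lam / 128 := by
    rw [mul_pow, inv_pow, Real.sq_sqrt (by norm_num), mul_pow, div_pow, div_pow,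
      Real.sq_sqrt hn0.le, Real.sq_sqrt hlam0.le]
    ring
  rw [hsq] at h3
  refine h3.trans ?_
  have hEX : ∀ A, rowSq E A - Tsum β p r A.card ≤ X := by
    intro A
    refine le_trans (le_of_eq ?_) (hX A)
    simp [rowSq, projSq, hE, Matrix.mul_apply]
  have h4 := pen_oracle hβ hδ0 hδ1 (V * M) E S X hEX
  have h5 : rowSq (V * M) Sᶜ ≤ (1 / 2) * sigTail Λ V S u := by
    unfold rowSq sigTail
    rw [Finset.mul_sum]
    refine Finset.sum_le_sum fun j _ => ?_
    set w : Fin n → ℝ := fun i => ∑ k, V j k * √(Λ k) * u i k with hw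
    have h6 : ∀ i, (V * M) j i = (√2)⁻¹ * (Lᵀ *ᵥ w) i := by
      intro i
      rw [hMdef, Matrix.mul_smul, Matrix.smul_apply, smul_eq_mul]
      congr 1
      simp only [transpose_mul, transpose_transpose, diagonal_transpose, ← Matrix.mul_assoc]
      rw [Matrix.mul_apply, mulVec, dotProduct]
      refine Finset.sum_congr rfl fun m _ => ?_
      rw [hw, mul_comm, transpose_apply]
      congr 1
      rw [Matrix.mul_apply]
      refine Finset.sum_congr rfl fun k _ => ?_
      rw [mul_diagonal, transpose_apply, of_apply]
    simp only [h6, mul_pow]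
    rw [← Finset.mul_sum, inv_pow, Real.sq_sqrt (by norm_num), ← nrm_sq]
    have h7 := nrm_orth_transpose L hL w
    have h8 : nrm (Lᵀ *ᵥ w) ^ 2 ≤ nrm w ^ 2 := pow_le_pow_left₀ (nrm_nonneg _) h7 2
    rw [nrm_sq w] at h8
    rw [one_div]
    exact mul_le_mul_of_nonneg_left h8 (by norm_num)
  have : (0 : ℝ) < 4 / δ := by positivity
  refine mul_le_mul_of_nonneg_left (h4.trans ?_) (by norm_num)
  gcongr

lemma continuous_nrm {ι : Type*} [Fintype ι] : Continuous (nrm : (ι → ℝ) → ℝ) := by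
  unfold nrm; fun_prop

lemma half_le_sigmaMin_iff {r : ℕ} (hr : 1 ≤ r) (A : Matrix (Fin r) (Fin r) ℝ) :
    1 / 2 ≤ sigmaMin A ↔ ∀ v : Fin r → ℝ, 1 / 2 * nrm v ≤ nrm (A *ᵥ v) := by
  constructor
  · intro h v
    exact (mul_le_mul_of_nonneg_right h (nrm_nonneg _)).trans (sigmaMin_le A v)
  · intro h
    refine le_csInf ?_ ?_
    · refine ⟨_, Pi.single ⟨0, hr⟩ 1, ?_, rfl⟩
      rw [Finset.sum_eq_single ⟨0, hr⟩]
      · simp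
      · intro b _ hb; simp [Pi.single_eq_of_ne hb]
      · simp
    · rintro c ⟨v, hv, rfl⟩
      have := h v
      have h1 : nrm v = 1 := by unfold nrm; rw [hv, Real.sqrt_one]
      rw [h1, mul_one] at this
      exact this

/-- the good values of the initial estimator -/
def goodV {p r : ℕ} (k : ℕ) (V : Matrix (Fin p) (Fin r) ℝ) : Set (Fin p → Fin r → ℝ) :=
  {v | suppCard (Matrix.of v) ≤ k ∧ 1 / 2 ≤ sigmaMin (Vᵀ * Matrix.of v)}

lemma measurableSet_goodV {p r : ℕ} (hr : 1 ≤ r) (k : ℕ) (V : Matrix (Fin p) (Fin r) ℝ) :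
    MeasurableSet (goodV k V) := by
  have h1 : MeasurableSet {v : Fin p → Fin r → ℝ | suppCard (Matrix.of v) ≤ k} := by
    have e : {v : Fin p → Fin r → ℝ | suppCard (Matrix.of v) ≤ k} =
        ⋃ S : Finset (Fin p), ⋃ (_ : S.card ≤ k), {v | ∀ j ∉ S, v j = 0} := by
      ext v
      simp only [Set.mem_ofPred_eq, Set.mem_iUnion, exists_prop, suppCard_eq]
      constructor
      · intro h
        refine ⟨_, h, fun j hj => ?_⟩
        classical
        simp only [suppF, Finset.mem_filter, Finset.mem_univ, true_and, not_not] at hj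
        exact hj
      · rintro ⟨S, hS, h⟩
        refine (Finset.card_le_card fun j hj => ?_).trans hS
        classical
        simp only [suppF, Finset.mem_filter, Finset.mem_univ, true_and] at hj
        by_contra hjS
        exact hj (h j hjS)
    rw [e]
    refine MeasurableSet.iUnion fun S => MeasurableSet.iUnion fun _ => ?_
    have e2 : {v : Fin p → Fin r → ℝ | ∀ j ∉ S, v j = 0} =
        ⋂ j, ⋂ (_ : j ∉ S), {v | v j = 0} := by ext; simp
    rw [e2]
    refine MeasurableSet.iInter fun j => MeasurableSet.iInter fun _ => ?_
    exact (isClosed_eq (continuous_apply j) continuous_const).measurableSet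
  have h2 : MeasurableSet {v : Fin p → Fin r → ℝ | 1 / 2 ≤ sigmaMin (Vᵀ * Matrix.of v)} := by
    have e : {v : Fin p → Fin r → ℝ | 1 / 2 ≤ sigmaMin (Vᵀ * Matrix.of v)} =
        ⋂ x : Fin r → ℝ, {v | 1 / 2 * nrm x ≤ nrm ((Vᵀ * Matrix.of v) *ᵥ x)} := by
      ext v
      simp only [Set.mem_ofPred_eq, Set.mem_iInter, half_le_sigmaMin_iff hr]
    rw [e]
    refine (isClosed_iInter fun x => ?_).measurableSet
    refine isClosed_le continuous_const (continuous_nrm.comp ?_)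
    refine continuous_pi fun i => ?_
    simp only [mulVec, dotProduct, Matrix.mul_apply, Matrix.of_apply]
    fun_prop
  exact h1.inter h2

/-- the good pairs `(u,a)` -/
def goodUA {n p r : ℕ} (k : ℕ) (V0est : (Fin n → Fin p → ℝ) → (Fin p → Fin r → ℝ))
    (Λ : Fin r → ℝ) (V : Matrix (Fin p) (Fin r) ℝ) :
    Set ((Fin n → Fin r → ℝ) × (Fin n → Fin p → ℝ)) :=
  {x | V0est (fun i j => (sig Λ V x.1 + √2 • of x.2) i j) ∈ goodV k V}

lemma measurableSet_goodUA {n p r : ℕ} (hr : 1 ≤ r) (k : ℕ)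
    (V0est : (Fin n → Fin p → ℝ) → (Fin p → Fin r → ℝ)) (hm : Measurable V0est)
    (Λ : Fin r → ℝ) (V : Matrix (Fin p) (Fin r) ℝ) : MeasurableSet (goodUA k V0est Λ V) := by
  refine (hm.comp ?_) (measurableSet_goodV hr k V)
  simp only [Matrix.add_apply, sig_apply, Matrix.smul_apply, of_apply]
  fun_prop

lemma measure_goodUA {n p r : ℕ} (hr : 1 ≤ r) (k : ℕ)
    (V0est : (Fin n → Fin p → ℝ) → (Fin p → Fin r → ℝ)) (hm : Measurable V0est)
    (Λ : Fin r → ℝ) (V : Matrix (Fin p) (Fin r) ℝ) :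
    reductionMeasure n p r {w |
        suppCard (Matrix.of (V0est (fun i j => X0w Λ V w i j))) ≤ k ∧
        1 / 2 ≤ sigmaMin (Vᵀ * Matrix.of (V0est (fun i j => X0w Λ V w i j)))} =
      ((gaussianMatrix n r).prod (gaussianMatrix n p)) (goodUA k V0est Λ V) := by
  set G : Set (((Fin n → Fin r → ℝ) × (Fin n → Fin p → ℝ)) × (Fin n → Fin p → ℝ)) := {w |
        suppCard (Matrix.of (V0est (fun i j => X0w Λ V w i j))) ≤ k ∧
        1 / 2 ≤ sigmaMin (Vᵀ * Matrix.of (V0est (fun i j => X0w Λ V w i j)))} with hG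
  rw [← (measurePreserving_rotW n p r).measure_preimage_equiv G]
  have e : rotW n p r ⁻¹' G = goodUA k V0est Λ V ×ˢ Set.univ := by
    ext ⟨⟨u, a⟩, b⟩
    simp only [hG, Set.mem_preimage, Set.mem_ofPred_eq, X0w_rot, Set.mem_prod, Set.mem_univ,
      and_true]
    rfl
  rw [e, reductionMeasure, Measure.prod_prod, measure_univ, mul_one]

lemma measure_compl_goodUA {n p r : ℕ} (hr : 1 ≤ r) (k : ℕ)
    (V0est : (Fin n → Fin p → ℝ) → (Fin p → Fin r → ℝ)) (hm : Measurable V0est)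
    (Λ : Fin r → ℝ) (V : Matrix (Fin p) (Fin r) ℝ) {ε : ℝ}
    (h : 1 - ε ≤ (reductionMeasure n p r {w |
        suppCard (Matrix.of (V0est (fun i j => X0w Λ V w i j))) ≤ k ∧
        1 / 2 ≤ sigmaMin (Vᵀ * Matrix.of (V0est (fun i j => X0w Λ V w i j)))}).toReal) :
    ((gaussianMatrix n r).prod (gaussianMatrix n p)) (goodUA k V0est Λ V)ᶜ ≤
      ENNReal.ofReal ε := by
  rw [measure_goodUA hr k V0est hm] at h
  have h1 := prob_compl_eq_one_sub (μ := (gaussianMatrix n r).prod (gaussianMatrix n p))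
    (measurableSet_goodUA hr k V0est hm Λ V)
  have h2 : (((gaussianMatrix n r).prod (gaussianMatrix n p)) (goodUA k V0est Λ V)ᶜ).toReal ≤ ε := by
    rw [h1, ENNReal.toReal_sub_of_le prob_le_one (by simp)]
    simp only [ENNReal.toReal_one]; linarith
  rw [← ENNReal.ofReal_toReal (measure_ne_top ((gaussianMatrix n r).prod (gaussianMatrix n p))
    (goodUA k V0est Λ V)ᶜ)]
  exact ENNReal.ofReal_le_ofReal h2

lemma inner_bound {n p r k : ℕ} {lam β δ : ℝ} (hβ : 2 < β) (hδ0 : 0 < δ) (hδ1 : δ < 1)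
    (hr : 1 ≤ r) (hrp : r ≤ p) (hn : 1 ≤ n)
    (V0est : (Fin n → Fin p → ℝ) → (Fin p → Fin r → ℝ))
    (hV0 : ∀ x, IsOrthonormalCols (Matrix.of (V0est x)))
    (Λ : Fin r → ℝ) (V : Matrix (Fin p) (Fin r) ℝ) (hV : IsOrthonormalCols V)
    (hlam : 10 ^ 6 ≤ lam) (hΛ : ∀ i, lam ≤ Λ i)
    (u : Fin n → Fin r → ℝ) (a : Fin n → Fin p → ℝ)
    (hg : (u, a) ∈ goodUA k V0est Λ V)
    (hU : u ∉ badU n r) (hW : a ∉ badW n p k) (S : Finset (Fin p)) :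
    ∫⁻ b, ENNReal.ofReal (loss (adaptiveEst n p r β δ V0est (sig Λ V u + √2 • of a)
        (sig Λ V u + √2 • of b)) V) ∂(gaussianMatrix n p) ≤
      ENNReal.ofReal (256 / (n * lam) * (4 / δ) * (2 / δ)) * ENNReal.ofReal (sigTail Λ V S u) +
      ENNReal.ofReal (256 / (n * lam) * (4 / δ) *
        (12 * r * gconst β + 6 * Tsum β p r S.card)) := by
  obtain ⟨L, hL, hbd⟩ := good_bound hβ hδ0 hδ1 hrp hn V0est hV0 Λ V hV hlam hΛ u a hg.1 hg.2 hU hW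
  have hlam0 : 0 < lam := by linarith
  have hn0 : (0 : ℝ) < n := by exact_mod_cast hn
  set c : ℝ := 256 / (n * lam) * (4 / δ) with hc
  have hc0 : 0 ≤ c := by positivity
  have hT : 0 ≤ Tsum β p r S.card := Tsum_nonneg hβ (by simpa using Finset.card_le_univ S)
  have hs := sigTail_nonneg Λ V S u
  have hpt : ∀ b, ENNReal.ofReal (loss (adaptiveEst n p r β δ V0est (sig Λ V u + √2 • of a)
        (sig Λ V u + √2 • of b)) V) ≤
      ENNReal.ofReal (c * (2 / δ) * sigTail Λ V S u + c * (6 * Tsum β p r S.card)) +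
      ENNReal.ofReal (4 * c) *
        ∑ A : Finset (Fin p), ENNReal.ofReal (projSq L A b - Tsum β p r A.card) := by
    intro b
    set X : ℝ := ∑ A : Finset (Fin p), max (projSq L A b - Tsum β p r A.card) 0 with hX
    have hX0 : 0 ≤ X := Finset.sum_nonneg fun _ _ => le_max_right _ _
    have hXe : ∑ A : Finset (Fin p), ENNReal.ofReal (projSq L A b - Tsum β p r A.card) =
        ENNReal.ofReal X := by
      rw [hX, ENNReal.ofReal_sum_of_nonneg fun _ _ => le_max_right _ _]
      refine Finset.sum_congr rfl fun A _ => ?_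
      rw [ENNReal.ofReal_max, ENNReal.ofReal_zero, max_eq_left (zero_le)]
    rw [hXe, ← ENNReal.ofReal_mul (by positivity), ← ENNReal.ofReal_add (by positivity)
      (by positivity)]
    apply ENNReal.ofReal_le_ofReal
    have h := hbd b X S fun A => (le_max_left _ _).trans
      (Finset.single_le_sum (f := fun A : Finset (Fin p) =>
        max (projSq L A b - Tsum β p r A.card) 0) (fun _ _ => le_max_right _ _)
        (Finset.mem_univ A))
    have hK : 0 < n * lam / 128 := by positivity
    rw [mul_comm, ← le_div_iff₀ hK] at h
    refine h.trans (le_of_eq ?_)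
    rw [hc]
    field_simp
    ring
  refine (lintegral_mono hpt).trans ?_
  rw [lintegral_add_left measurable_const, lintegral_const, measure_univ, mul_one,
    lintegral_const_mul' _ _ ENNReal.ofReal_ne_top]
  have h3 := lintegral_excess_total (p := p) hβ hr L hL
  have hg0 := gconst_nonneg β
  calc _ ≤ ENNReal.ofReal (c * (2 / δ) * sigTail Λ V S u + c * (6 * Tsum β p r S.card)) +
        ENNReal.ofReal (4 * c) * ENNReal.ofReal (3 * r * gconst β) := by gcongr
    _ = _ := by
      rw [← ENNReal.ofReal_mul (by positivity), ← ENNReal.ofReal_add (by positivity)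
        (by positivity), ← ENNReal.ofReal_mul (by positivity), ← ENNReal.ofReal_add (by positivity)
        (by positivity)]
      congr 1; ring

lemma loss_le_two_r {p r : ℕ} (hrp : r ≤ p) (T V : Matrix (Fin p) (Fin r) ℝ)
    (hV : IsOrthonormalCols V) : loss (orthonormalize T) V ≤ 2 * r :=
  loss_le_r _ V (orthonormalize_spec hrp T).1 hV

lemma risk_le {n p r k : ℕ} {lam κ β δ ε η : ℝ} (hβ : 2 < β) (hδ0 : 0 < δ) (hδ1 : δ < 1)
    (hr : 1 ≤ r) (hrp : r ≤ p) (hn : 1 ≤ n)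
    (V0est : (Fin n → Fin p → ℝ) → (Fin p → Fin r → ℝ)) (hm : Measurable V0est)
    (hV0 : ∀ x, IsOrthonormalCols (Matrix.of (V0est x)))
    (Λ : Fin r → ℝ) (V : Matrix (Fin p) (Fin r) ℝ) (hV : IsOrthonormalCols V)
    (hlam : 10 ^ 6 ≤ lam) (hΛ : ∀ i, lam ≤ Λ i) (hΛ' : ∀ i, Λ i ≤ κ * lam) (hκ : 0 ≤ κ)
    (hε : 0 ≤ ε) (hη : 0 ≤ η)
    (h : 1 - ε ≤ (reductionMeasure n p r {w |
        suppCard (Matrix.of (V0est (fun i j => X0w Λ V w i j))) ≤ k ∧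
        1 / 2 ≤ sigmaMin (Vᵀ * Matrix.of (V0est (fun i j => X0w Λ V w i j)))}).toReal)
    (hbU : gaussianMatrix n r (badU n r) ≤ ENNReal.ofReal (2 * η))
    (hbW : gaussianMatrix n p (badW n p k) ≤ ENNReal.ofReal η) (S : Finset (Fin p)) :
    ∫⁻ w, ENNReal.ofReal (loss (adaptiveEst n p r β δ V0est (X0w Λ V w) (X1w Λ V w)) V)
        ∂(reductionMeasure n p r) ≤
      ENNReal.ofReal (2 * r * (ε + 3 * η) +
        256 / (n * lam) * (4 / δ) * (2 / δ) * (n * (κ * lam) * rowSq V Sᶜ) +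
        256 / (n * lam) * (4 / δ) * (12 * r * gconst β + 6 * Tsum β p r S.card)) := by
  have hlam0 : 0 < lam := by linarith
  have hn0 : (0 : ℝ) < n := by exact_mod_cast hn
  have hT : 0 ≤ Tsum β p r S.card := Tsum_nonneg hβ (by simpa using Finset.card_le_univ S)
  have hg0 := gconst_nonneg β
  have hR := rowSq_nonneg V Sᶜ
  set c1 : ℝ := 256 / (n * lam) * (4 / δ) * (2 / δ) with hc1
  set c2 : ℝ := 256 / (n * lam) * (4 / δ) * (12 * r * gconst β + 6 * Tsum β p r S.card) with hc2
  have hc10 : 0 ≤ c1 := by positivity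
  have hc20 : 0 ≤ c2 := by positivity
  rw [← (measurePreserving_rotW n p r).lintegral_comp_emb (rotW n p r).measurableEmbedding]
  set B : Set ((Fin n → Fin r → ℝ) × (Fin n → Fin p → ℝ)) :=
    (goodUA k V0est Λ V)ᶜ ∪ (badU n r ×ˢ Set.univ) ∪ (Set.univ ×ˢ badW n p k) with hB
  have hPB : ((gaussianMatrix n r).prod (gaussianMatrix n p)) B ≤
      ENNReal.ofReal (ε + 3 * η) := by
    calc _ ≤ ENNReal.ofReal ε + ENNReal.ofReal (2 * η) + ENNReal.ofReal η := by
          refine (measure_union_le _ _).trans (add_le_add ((measure_union_le _ _).trans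
            (add_le_add (measure_compl_goodUA hr k V0est hm Λ V h) ?_)) ?_)
          · rw [Measure.prod_prod, measure_univ, mul_one]; exact hbU
          · rw [Measure.prod_prod, measure_univ, one_mul]; exact hbW
      _ = _ := by
          rw [← ENNReal.ofReal_add hε (by positivity), ← ENNReal.ofReal_add (by positivity) hη]
          congr 1; ring
  have hin : ∀ x : (Fin n → Fin r → ℝ) × (Fin n → Fin p → ℝ),
      ∫⁻ b, ENNReal.ofReal (loss (adaptiveEst n p r β δ V0est (X0w Λ V (rotW n p r (x, b)))
        (X1w Λ V (rotW n p r (x, b)))) V) ∂(gaussianMatrix n p) ≤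
      B.indicator (fun _ => ENNReal.ofReal (2 * r)) x +
        (ENNReal.ofReal c1 * ENNReal.ofReal (sigTail Λ V S x.1) + ENNReal.ofReal c2) := by
    rintro ⟨u, a⟩
    simp only [X0w_rot, X1w_rot]
    by_cases hx : (u, a) ∈ B
    · rw [Set.indicator_of_mem hx]
      refine le_trans ?_ le_self_add
      calc _ ≤ ∫⁻ _b, ENNReal.ofReal (2 * r) ∂(gaussianMatrix n p) :=
            lintegral_mono fun b => ENNReal.ofReal_le_ofReal (loss_le_two_r hrp _ V hV)
        _ = _ := by rw [lintegral_const, measure_univ, mul_one]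
    · rw [Set.indicator_of_notMem hx, zero_add]
      simp only [hB, Set.mem_union, not_or, Set.mem_compl_iff, not_not, Set.mem_prod, Set.mem_univ,
        and_true, true_and] at hx
      exact inner_bound hβ hδ0 hδ1 hr hrp hn V0est hV0 Λ V hV hlam hΛ u a hx.1.1 hx.1.2 hx.2 S
  have hsm : Measurable fun u : Fin n → Fin r → ℝ => ENNReal.ofReal (sigTail Λ V S u) := by
    unfold sigTail; fun_prop
  have hsi : ∫⁻ x, ENNReal.ofReal (sigTail Λ V S x.1)
      ∂((gaussianMatrix n r).prod (gaussianMatrix n p)) ≤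
      ENNReal.ofReal (n * (κ * lam) * rowSq V Sᶜ) := by
    have hfst : MeasurePreserving Prod.fst ((gaussianMatrix n r).prod (gaussianMatrix n p))
      (gaussianMatrix n r) := measurePreserving_fst
    rw [hfst.lintegral_comp hsm]
    exact lintegral_sigTail Λ V S hΛ' fun i => hlam0.le.trans (hΛ i)
  refine (lintegral_prod_le _).trans ((lintegral_mono hin).trans ?_)
  have hsm' : Measurable fun x : (Fin n → Fin r → ℝ) × (Fin n → Fin p → ℝ) =>
      ENNReal.ofReal (sigTail Λ V S x.1) := hsm.comp measurable_fst
  rw [lintegral_add_right _ ((hsm'.const_mul _).add_const _),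
    lintegral_add_right _ measurable_const, lintegral_const, measure_univ, mul_one,
    lintegral_const_mul _ hsm']
  calc _ ≤ ENNReal.ofReal (2 * r) * ENNReal.ofReal (ε + 3 * η) +
        (ENNReal.ofReal c1 * ENNReal.ofReal (n * (κ * lam) * rowSq V Sᶜ) + ENNReal.ofReal c2) := by
        refine add_le_add ((lintegral_indicator_const_le _ _).trans ?_) ?_
        · gcongr
        · gcongr
    _ = _ := by
        rw [← ENNReal.ofReal_mul (by positivity), ← ENNReal.ofReal_mul (by positivity),
          ← ENNReal.ofReal_add (by positivity) (by positivity),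
          ← ENNReal.ofReal_add (by positivity) (by positivity)]
        congr 1; ring

lemma r_le_suppCard {p r : ℕ} (V : Matrix (Fin p) (Fin r) ℝ) (hV : IsOrthonormalCols V) :
    r ≤ suppCard V := by
  have hrow : ∀ j, ∑ i, V j i ^ 2 ≤ 1 := by
    intro j
    have h := nrm_orth_transpose V hV (Pi.single j 1)
    have h1 : Vᵀ *ᵥ Pi.single j (1 : ℝ) = fun i => V j i := by
      ext i; simp
    have h2 : nrm (Pi.single j (1 : ℝ) : Fin p → ℝ) = 1 := by
      unfold nrm
      rw [Finset.sum_eq_single j]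
      · simp
      · intro b _ hb; simp [Pi.single_eq_of_ne hb]
      · simp
    rw [h1, h2] at h
    have h3 := pow_le_pow_left₀ (nrm_nonneg _) h 2
    rw [nrm_sq] at h3
    simpa using h3
  have htr : (r : ℝ) = ∑ j, ∑ i, V j i ^ 2 := by
    have h : (Vᵀ * V).trace = r := by
      rw [show Vᵀ * V = 1 from hV, Matrix.trace_one, Fintype.card_fin]
    rw [← h, Finset.sum_comm]
    simp [Matrix.trace, Matrix.mul_apply, sq]
  have h : (r : ℝ) ≤ (suppF V).card := by
    rw [htr, ← Finset.sum_subset (Finset.subset_univ (suppF V))]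
    · refine (Finset.sum_le_sum fun j _ => hrow j).trans ?_
      simp
    · intro j _ hj
      classical
      simp only [suppF, Finset.mem_filter, Finset.mem_univ, true_and, not_not] at hj
      simp [hj]
  rw [suppCard_eq]
  exact_mod_cast h

/-- the constant of the theorem -/
def Cmain (κ q β δ C' : ℝ) : ℝ :=
  2 * (C' + 150) + 256 * (4 / δ) * (2 / δ) * κ * Zq q +
    256 * (4 / δ) * (12 * gconst β + 24 * β)

lemma integral_le_of_le {Ω : Type*} [MeasurableSpace Ω] {μ : Measure Ω} [IsProbabilityMeasure μ]
    {f : Ω → ℝ} {c : ℝ} (hc : 0 ≤ c) (h : ∀ x, f x ≤ c) : ∫ x, f x ∂μ ≤ c := by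
  by_cases hf : Integrable f μ
  · refine (integral_mono hf (integrable_const c) h).trans ?_
    simp
  · rw [integral_undef hf]; exact hc

lemma integral_le_of_lintegral {Ω : Type*} [MeasurableSpace Ω] {μ : Measure Ω}
    {f : Ω → ℝ} {c : ℝ} (hc : 0 ≤ c) (hf0 : ∀ x, 0 ≤ f x)
    (h : ∫⁻ x, ENNReal.ofReal (f x) ∂μ ≤ ENNReal.ofReal c) : ∫ x, f x ∂μ ≤ c := by
  by_cases hf : Integrable f μ
  · rw [integral_eq_lintegral_of_nonneg_ae (Filter.Eventually.of_forall hf0)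
      hf.aestronglyMeasurable]
    exact ENNReal.toReal_le_of_le_ofReal hc h
  · rw [integral_undef hf]; exact hc

lemma main_bound {κ q β δ C' : ℝ} (hκ : 1 < κ) (hq0 : 0 ≤ q) (hq2 : q < 2) (hβ : 2 < β)
    (hδ0 : 0 < δ) (hδ1 : δ < 1) (hC' : 0 < C') {n p r : ℕ} {s lam : ℝ}
    (V0est : (Fin n → Fin p → ℝ) → (Fin p → Fin r → ℝ))
    (hr : 1 ≤ r) (hrp : r ≤ p) (hm : Measurable V0est)
    (hV0 : ∀ x, IsOrthonormalCols (Matrix.of (V0est x)))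
    (hlam : 10 ^ 6 ≤ lam)
    (hn : 10 ^ 6 * max ((kq q s p r n lam : ℝ) * ell p (kq q s p r n lam)) (Real.log lam) ≤ (n : ℝ))
    (V : Matrix (Fin p) (Fin r) ℝ) (Λ : Fin r → ℝ) (hTh : InTheta q s p r lam κ V Λ)
    (h : 1 - C' / ((n : ℝ) * hfun lam) ≤
      (reductionMeasure n p r {w |
        suppCard (Matrix.of (V0est (fun i j => X0w Λ V w i j))) ≤ kq q s p r n lam ∧
        1 / 2 ≤ sigmaMin (Vᵀ * Matrix.of (V0est (fun i j => X0w Λ V w i j)))}).toReal) :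
    ∫ w, loss (adaptiveEst n p r β δ V0est (X0w Λ V w) (X1w Λ V w)) V ∂reductionMeasure n p r ≤
      Cmain κ q β δ C' * Psi (kq q s p r n lam) p r n lam := by
  obtain ⟨hV, hw, -, hΛ⟩ := hTh
  have hlam0 : 0 < lam := by linarith
  have hlog : 0 < Real.log lam := Real.log_pos (by linarith)
  have hlogn : 10 ^ 6 * Real.log lam ≤ n :=
    (mul_le_mul_of_nonneg_left (le_max_right _ _) (by norm_num)).trans hn
  have hkn : 10 ^ 6 * ((kq q s p r n lam : ℝ) * ell p (kq q s p r n lam)) ≤ n :=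
    (mul_le_mul_of_nonneg_left (le_max_left _ _) (by norm_num)).trans hn
  have hn0 : (0 : ℝ) < n := by linarith
  have hn1 : 1 ≤ n := by
    have : 0 < n := by exact_mod_cast hn0
    omega
  have hh0 : 0 < hfun lam := by unfold hfun; positivity
  have hhl : hfun lam ≤ lam := by
    unfold hfun
    rw [div_le_iff₀ (by positivity)]; nlinarith
  have hc : 0 < n * hfun lam := by positivity
  have hp1 : 1 ≤ p := hr.trans hrp
  have hk1 : 1 ≤ kq q s p r n lam :=
    Nat.ceil_pos.2 (xq_pos hq0 hq2 (s_pos hr hV hw) hp1 hc)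
  have hkp := kq_le q s p r n lam
  obtain ⟨S, hS, hrow⟩ := weak_tail hq0 hq2 hw hc rfl hk1
  set k := kq q s p r n lam with hk
  have hell := one_le_ell hk1 hkp
  have hk1' : (1 : ℝ) ≤ k := by exact_mod_cast hk1
  have hr1' : (1 : ℝ) ≤ r := by exact_mod_cast hr
  have hPsi : Psi k p r n lam = (r * k + k * ell p k) / (n * hfun lam) := rfl
  have hQ0 : (r : ℝ) ≤ r * k + k * ell p k := by nlinarith
  have hPsi0 : 0 ≤ Psi k p r n lam := by rw [hPsi]; positivity
  have hrPsi : r / (n * hfun lam) ≤ Psi k p r n lam := by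
    rw [hPsi]; gcongr
  have hZ := Zq_nonneg q
  have hg := gconst_nonneg β
  have hC0 : 0 ≤ 256 * (4 / δ) * (2 / δ) * κ * Zq q +
    256 * (4 / δ) * (12 * gconst β + 24 * β) := by positivity
  have hCnn : 2 * (C' + 150) ≤ Cmain κ q β δ C' := by
    unfold Cmain; linarith
  by_cases hrk : r ≤ k
  swap
  · have hempty : {w : ((Fin n → Fin r → ℝ) × (Fin n → Fin p → ℝ)) × (Fin n → Fin p → ℝ) |
        suppCard (Matrix.of (V0est (fun i j => X0w Λ V w i j))) ≤ k ∧
        1 / 2 ≤ sigmaMin (Vᵀ * Matrix.of (V0est (fun i j => X0w Λ V w i j)))} = ∅ := by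
      ext w
      simp only [Set.mem_ofPred_eq, Set.mem_empty_iff_false, iff_false, not_and]
      intro h1
      exact absurd ((r_le_suppCard _ (hV0 _)).trans h1) hrk
    rw [hempty, measure_empty, ENNReal.toReal_zero] at h
    have h1 : 1 ≤ C' / (n * hfun lam) := by linarith
    refine integral_le_of_le (mul_nonneg (by linarith) hPsi0) fun w =>
      (loss_le_two_r hrp _ V hV).trans ?_
    calc 2 * (r : ℝ) ≤ 2 * r * (C' / (n * hfun lam)) := le_mul_of_one_le_right (by positivity) h1
      _ = 2 * C' * (r / (n * hfun lam)) := by ring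
      _ ≤ 2 * C' * Psi k p r n lam := by gcongr
      _ ≤ _ := mul_le_mul_of_nonneg_right (by linarith) hPsi0
  have hrn : 1000 * (r : ℝ) ≤ n := by
    have h1 : (r : ℝ) ≤ k := by exact_mod_cast hrk
    nlinarith
  set η : ℝ := 50 / (n * hfun lam) with hη
  have hη0 : 0 ≤ η := by positivity
  have htail : Real.exp (-(n / 30)) ≤ η := tail_rate hn1 (by linarith) (by linarith)
  have hbU : gaussianMatrix n r (badU n r) ≤ ENNReal.ofReal (2 * η) :=
    (badU_le hrn).trans (ENNReal.ofReal_le_ofReal (by linarith))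
  have hbW : gaussianMatrix n p (badW n p k) ≤ ENNReal.ofReal η :=
    (badW_le hk1 hkp (by nlinarith)).trans (ENNReal.ofReal_le_ofReal htail)
  have hrisk := risk_le (β := β) (δ := δ) hβ hδ0 hδ1 hr hrp hn1 V0est hm hV0 Λ V hV hlam
    (fun i => (hΛ i).2.1) (fun i => (hΛ i).2.2) (by linarith : (0 : ℝ) ≤ κ)
    (by positivity : 0 ≤ C' / ((n : ℝ) * hfun lam)) hη0 h hbU hbW S
  refine integral_le_of_lintegral (mul_nonneg (by linarith) hPsi0) (fun w => loss_nonneg _ _)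
    (hrisk.trans (ENNReal.ofReal_le_ofReal ?_))
  rw [hS]
  have hT := Tsum_le hβ (r := r) hk1 hkp
  have hT0 : 0 ≤ Tsum β p r k := Tsum_nonneg hβ hkp
  have e1 : 2 * r * (C' / (n * hfun lam) + 3 * η) ≤ 2 * (C' + 150) * Psi k p r n lam := by
    calc _ = 2 * (C' + 150) * (r / (n * hfun lam)) := by rw [hη]; ring
      _ ≤ _ := by gcongr
  have e2 : 256 / (n * lam) * (4 / δ) * (2 / δ) * (n * (κ * lam) * rowSq V Sᶜ) ≤
      256 * (4 / δ) * (2 / δ) * κ * Zq q * Psi k p r n lam := by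
    calc _ = 256 * (4 / δ) * (2 / δ) * κ * rowSq V Sᶜ := by field_simp
      _ ≤ 256 * (4 / δ) * (2 / δ) * κ * (Zq q * Psi k p r n lam) := by gcongr
      _ = _ := by ring
  have e3 : 256 / (n * lam) * (4 / δ) * (12 * r * gconst β + 6 * Tsum β p r k) ≤
      256 * (4 / δ) * (12 * gconst β + 24 * β) * Psi k p r n lam := by
    calc _ ≤ 256 / (n * hfun lam) * (4 / δ) * (12 * (r * k + k * ell p k) * gconst β +
          6 * (4 * β * (r * k + k * ell p k))) := by gcongr
      _ = _ := by rw [hPsi]; ring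
  unfold Cmain
  linarith

/-- **Theorem 7** (adaptation): starting from any initial estimator satisfying
the support/correlation condition with high probability, the estimator
obtained from the regression reduction scheme adaptively attains the optimal
rate over `Θ_q(s,p,r,λ)`. -/
theorem adaptive_estimation_upper_bound (κ : ℝ) (hκ : 1 < κ) (q : ℝ)
    (hq0 : 0 ≤ q) (hq2 : q < 2) (β : ℝ) (hβ : 2 < β) (δ : ℝ) (hδ0 : 0 < δ)
    (hδ1 : δ < 1) :
    ∃ C₀ : ℝ, 0 < C₀ ∧
      ∀ C' : ℝ, 0 < C' →
        ∃ C : ℝ, 0 < C ∧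
          ∀ (n p r : ℕ) (s lam : ℝ)
            (V0est : (Fin n → Fin p → ℝ) → (Fin p → Fin r → ℝ)),
            1 ≤ r → r ≤ p →
            Measurable V0est →
            (∀ x, IsOrthonormalCols (Matrix.of (V0est x))) →
            C₀ ≤ lam →
            C₀ * Real.sqrt (Real.log n / n) ≤ lam →
            C₀ * (kq q s p r n lam : ℝ) *
                ((r : ℝ) + Real.log (Real.exp 1 * p / (kq q s p r n lam : ℝ)))
              ≤ (n : ℝ) * hfun lam →
            C₀ * max ((kq q s p r n lam : ℝ) *
                  Real.log (Real.exp 1 * p / (kq q s p r n lam : ℝ)))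
                (Real.log lam) ≤ (n : ℝ) →
            (∀ (V : Matrix (Fin p) (Fin r) ℝ) (Λ : Fin r → ℝ),
              InTheta q s p r lam κ V Λ →
              1 - C' / ((n : ℝ) * hfun lam) ≤
                (reductionMeasure n p r {w |
                  suppCard (Matrix.of (V0est (fun i j => X0w Λ V w i j)))
                      ≤ kq q s p r n lam ∧
                  1 / 2 ≤ sigmaMin
                    (Vᵀ * Matrix.of (V0est (fun i j => X0w Λ V w i j)))}).toReal) →
            (⨆ (V : Matrix (Fin p) (Fin r) ℝ) (Λ : Fin r → ℝ)
                (_ : InTheta q s p r lam κ V Λ),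
                ∫ w, loss
                    (adaptiveEst n p r β δ V0est (X0w Λ V w) (X1w Λ V w)) V
                  ∂ reductionMeasure n p r)
              ≤ min (2 * min (r : ℝ) ((p : ℝ) - r))
                  (C * Psi (kq q s p r n lam) p r n lam) := by
  refine ⟨10 ^ 6, by norm_num, fun C' hC' => ⟨Cmain κ q β δ C', ?_, ?_⟩⟩
  · have hZ := Zq_nonneg q
    have hg := gconst_nonneg β
    unfold Cmain
    positivity
  intro n p r s lam V0est hr hrp hm hV0 hlam _ _ hn h
  have hCpos : 0 ≤ Cmain κ q β δ C' := by
    have hZ := Zq_nonneg q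
    have hg := gconst_nonneg β
    unfold Cmain
    positivity
  have hrp' : (r : ℝ) ≤ p := by exact_mod_cast hrp
  have hmin : 0 ≤ 2 * min (r : ℝ) ((p : ℝ) - r) :=
    mul_nonneg (by norm_num) (le_min (Nat.cast_nonneg _) (by linarith))
  have hPsi0 : 0 ≤ Psi (kq q s p r n lam) p r n lam := by
    have hh0 : 0 ≤ hfun lam := by
      unfold hfun
      have : 0 < lam := by linarith
      positivity
    unfold Psi
    rcases Nat.eq_zero_or_pos (kq q s p r n lam) with h0 | h0
    · rw [h0]; simp
    · have := one_le_ell h0 (kq_le q s p r n lam)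
      unfold ell at this
      positivity
  have hrhs : 0 ≤ min (2 * min (r : ℝ) ((p : ℝ) - r))
      (Cmain κ q β δ C' * Psi (kq q s p r n lam) p r n lam) :=
    le_min hmin (mul_nonneg hCpos hPsi0)
  refine Real.iSup_le (fun V => Real.iSup_le (fun Λ => Real.iSup_le (fun hTh => ?_) hrhs) hrhs) hrhs
  refine le_min ?_ ?_
  · refine integral_le_of_le hmin fun w => ?_
    have ho : ∀ T : Matrix (Fin p) (Fin r) ℝ, IsOrthonormalCols (orthonormalize T) :=
      fun T => (orthonormalize_spec hrp T).1
    have h1 := loss_le_r (adaptiveEst n p r β δ V0est (X0w Λ V w) (X1w Λ V w)) V (ho _) hTh.1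
    have h2 := loss_le_pr (adaptiveEst n p r β δ V0est (X0w Λ V w) (X1w Λ V w)) V (ho _) hTh.1
    rw [mul_min_of_nonneg _ _ (by norm_num)]
    exact le_min h1 h2
  · exact main_bound hκ hq0 hq2 hβ hδ0 hδ1 hC' V0est hr hrp hm hV0 hlam hn V Λ hTh (h V Λ hTh)

end SparsePCA
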